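/- Assume conditions (i), (ii), (iii). Then for every u ∈ φ²(Ω) the distributional commutators [X_i,X_j]u (i,j = 1,…,m) belong to L²_loc(Ω); moreover, for every subdomain Ω′ ⊂⊂ Ω there exists a constant C, depending only on dist(Ω′, ∂Ω) and X_1,…,X_m, such that ‖[X_i,X_j]u‖_{L²(Ω′)} ≤ C ∫_Ω |u| for every u ∈ φ²(Ω) ∩ L¹(Ω). -/

import Mathlib

open MeasureTheory Filter Topology

noncomputable section

/-- Action of a first-order vector field with coefficient vector `c` on a function `u`:
`(Xu)(x) = ∑ j c(x)_j D_j u(x) = Du(x)·c(x)`. -/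
def Xop {n : ℕ} (c : (Fin n → ℝ) → (Fin n → ℝ)) (u : (Fin n → ℝ) → ℝ)
    (x : Fin n → ℝ) : ℝ :=
  fderiv ℝ u x (c x)

/-- Lie bracket of the coefficient vector fields `c`, `d`. -/
def vfBracket {n : ℕ} (c d : (Fin n → ℝ) → (Fin n → ℝ)) (x : Fin n → ℝ) :
    Fin n → ℝ :=
  fun l => fderiv ℝ (fun y => d y l) x (c x) - fderiv ℝ (fun y => c y l) x (d x)

/-- The sub-Laplacian `Δ_X u = ∑ i X_i X_i u`. -/
def subLap {n m : ℕ} (b : Fin m → (Fin n → ℝ) → (Fin n → ℝ))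
    (u : (Fin n → ℝ) → ℝ) (x : Fin n → ℝ) : ℝ :=
  ∑ i, Xop (b i) (Xop (b i) u) x

/-- The commutator `[X_i, X_j] u = X_i X_j u - X_j X_i u`. -/
def commOp {n m : ℕ} (b : Fin m → (Fin n → ℝ) → (Fin n → ℝ)) (i j : Fin m)
    (u : (Fin n → ℝ) → ℝ) (x : Fin n → ℝ) : ℝ :=
  Xop (b i) (Xop (b j) u) x - Xop (b j) (Xop (b i) u) x

/-- The symmetric Hessian `X_s² u = [½ (X_i X_j + X_j X_i) u]`. -/
def symmHess {n m : ℕ} (b : Fin m → (Fin n → ℝ) → (Fin n → ℝ))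
    (u : (Fin n → ℝ) → ℝ) (x : Fin n → ℝ) : Matrix (Fin m) (Fin m) ℝ :=
  fun i j => (Xop (b i) (Xop (b j) u) x + Xop (b j) (Xop (b i) u) x) / 2

theorem symmHess_isHermitian {n m : ℕ} (b : Fin m → (Fin n → ℝ) → (Fin n → ℝ))
    (u : (Fin n → ℝ) → ℝ) (x : Fin n → ℝ) : (symmHess b u x).IsHermitian := by
  unfold Matrix.IsHermitian
  ext i j
  simp only [Matrix.conjTranspose_apply, symmHess, star_trivial]
  ring

/-- Eigenvalues of the symmetric Hessian. -/
def hessEig {n m : ℕ} (b : Fin m → (Fin n → ℝ) → (Fin n → ℝ))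
    (u : (Fin n → ℝ) → ℝ) (x : Fin n → ℝ) : Fin m → ℝ :=
  (symmHess_isHermitian b u x).eigenvalues

/-- `k`-th elementary symmetric function of `m` real numbers. -/
def esymmF {m : ℕ} (k : ℕ) (lam : Fin m → ℝ) : ℝ :=
  ∑ s ∈ Finset.powersetCard k (Finset.univ : Finset (Fin m)), ∏ i ∈ s, lam i

/-- `S_{j,i}(λ)`: the `j`-th elementary symmetric function with the variable `λ_i` set to `0`. -/
def esymmDrop {m : ℕ} (j : ℕ) (i : Fin m) (lam : Fin m → ℝ) : ℝ :=
  ∑ s ∈ Finset.powersetCard j ((Finset.univ : Finset (Fin m)).erase i), ∏ l ∈ s, lam l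

/-- `u` is `k`-convex with respect to the vector fields `b` on `Ω`:
`S_j(λ(X_s²u)) ≥ 0` on `Ω` for `j = 1, …, k`. -/
def IsKConvex {n m : ℕ} (Ω : Set (Fin n → ℝ)) (b : Fin m → (Fin n → ℝ) → (Fin n → ℝ))
    (k : ℕ) (u : (Fin n → ℝ) → ℝ) : Prop :=
  ∀ x ∈ Ω, ∀ j, 1 ≤ j → j ≤ k → 0 ≤ esymmF j (hessEig b u x)

/-- `F_2[u] = S_2(λ(X_s²u))`. -/
def F2fun {n m : ℕ} (b : Fin m → (Fin n → ℝ) → (Fin n → ℝ))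
    (u : (Fin n → ℝ) → ℝ) (x : Fin n → ℝ) : ℝ :=
  esymmF 2 (hessEig b u x)

/-- `𝓔_2[u] = ∑_{i<j} ([X_i,X_j]u)²`. -/
def E2fun {n m : ℕ} (b : Fin m → (Fin n → ℝ) → (Fin n → ℝ))
    (u : (Fin n → ℝ) → ℝ) (x : Fin n → ℝ) : ℝ :=
  ∑ i : Fin m, ∑ j ∈ Finset.Ioi i, (commOp b i j u x) ^ 2

/-- `𝓕_2[u] = F_2[u] + (3/4) 𝓔_2[u]`. -/
def calF2 {n m : ℕ} (b : Fin m → (Fin n → ℝ) → (Fin n → ℝ))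
    (u : (Fin n → ℝ) → ℝ) (x : Fin n → ℝ) : ℝ :=
  F2fun b u x + (3 / 4) * E2fun b u x

/-- `|Xu|(x)`, the length of the subelliptic gradient. -/
def XgradNorm {n m : ℕ} (b : Fin m → (Fin n → ℝ) → (Fin n → ℝ))
    (u : (Fin n → ℝ) → ℝ) (x : Fin n → ℝ) : ℝ :=
  Real.sqrt (∑ i, (Xop (b i) u x) ^ 2)

/-- Condition (i): each `X_i` is divergence free, i.e. anti-self-adjoint. -/
def DivFree {n m : ℕ} (Ω : Set (Fin n → ℝ))
    (b : Fin m → (Fin n → ℝ) → (Fin n → ℝ)) : Prop :=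
  ∀ i : Fin m, ∀ x ∈ Ω, ∑ j, fderiv ℝ (fun y => b i y j) x (Pi.single j 1) = 0

/-- The set of iterated Lie brackets generated by the fields `b`. -/
inductive LieGen {n m : ℕ} (b : Fin m → (Fin n → ℝ) → (Fin n → ℝ)) :
    ((Fin n → ℝ) → (Fin n → ℝ)) → Prop
  | base (i : Fin m) : LieGen b (b i)
  | bracket {c d : (Fin n → ℝ) → (Fin n → ℝ)} :
      LieGen b c → LieGen b d → LieGen b (fun x => vfBracket c d x)

/-- Condition (ii): the Hörmander condition; iterated commutators span `ℝⁿ` at each point. -/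
def Hormander {n m : ℕ} (Ω : Set (Fin n → ℝ))
    (b : Fin m → (Fin n → ℝ) → (Fin n → ℝ)) : Prop :=
  ∀ x ∈ Ω, Submodule.span ℝ {v : Fin n → ℝ | ∃ c, LieGen b c ∧ c x = v} = ⊤

/-- Condition (iii): all second commutators `[X_i,[X_i,X_j]]` vanish. -/
def SecondCommVanish {n m : ℕ} (Ω : Set (Fin n → ℝ))
    (b : Fin m → (Fin n → ℝ) → (Fin n → ℝ)) : Prop :=
  ∀ i j : Fin m, ∀ x ∈ Ω, vfBracket (b i) (fun y => vfBracket (b i) (b j) y) x = 0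

/-- `Ω' ⊂⊂ Ω`: `Ω'` is open and compactly contained in `Ω`. -/
def CptIn {n : ℕ} (Ω' Ω : Set (Fin n → ℝ)) : Prop :=
  IsOpen Ω' ∧ IsCompact (closure Ω') ∧ closure Ω' ⊆ Ω

/-- A sub-unitary (piecewise C¹) curve on `[0,T]` with respect to the fields `b`. -/
def IsSubunitary {n m : ℕ} (b : Fin m → (Fin n → ℝ) → (Fin n → ℝ)) (T : ℝ)
    (γ : ℝ → Fin n → ℝ) : Prop :=
  ContinuousOn γ (Set.Icc 0 T) ∧
  ∃ S : Finset ℝ, ∀ t ∈ Set.Ioo 0 T, t ∉ S →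
    ∃ γ' : Fin n → ℝ, HasDerivAt γ γ' t ∧
      ∀ ξ : Fin n → ℝ, (∑ j, γ' j * ξ j) ^ 2 ≤ ∑ i, (∑ j, b i (γ t) j * ξ j) ^ 2

/-- The Carnot–Carathéodory distance associated with the fields `b`. -/
def ccDist {n m : ℕ} (b : Fin m → (Fin n → ℝ) → (Fin n → ℝ))
    (x y : Fin n → ℝ) : ℝ :=
  sInf {T : ℝ | 0 < T ∧ ∃ γ : ℝ → Fin n → ℝ,
    IsSubunitary b T γ ∧ γ 0 = x ∧ γ T = y}

/-- The C-C ball of radius `R` about `x`. -/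
def ccBall {n m : ℕ} (b : Fin m → (Fin n → ℝ) → (Fin n → ℝ))
    (x : Fin n → ℝ) (R : ℝ) : Set (Fin n → ℝ) :=
  {y | ccDist b x y < R}

/-- The doubling property `|B_{tR}(x)| ≥ C t^Q |B_R(x)|`. -/
def DoublingDim {n m : ℕ} (Ω : Set (Fin n → ℝ))
    (b : Fin m → (Fin n → ℝ) → (Fin n → ℝ)) (Q : ℕ) : Prop :=
  ∃ C > (0 : ℝ), ∃ R0 > (0 : ℝ), ∀ x ∈ Ω, ∀ t ∈ Set.Ioo (0 : ℝ) 1,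
    ∀ R : ℝ, 0 < R → R < R0 →
      C * t ^ Q * (volume (ccBall b x R)).toReal ≤ (volume (ccBall b x (t * R))).toReal

/-- `Q` is the homogeneous dimension of the system `b` in `Ω`. -/
def IsHomDim {n m : ℕ} (Ω : Set (Fin n → ℝ))
    (b : Fin m → (Fin n → ℝ) → (Fin n → ℝ)) (Q : ℕ) : Prop :=
  0 < Q ∧ DoublingDim Ω b Q ∧ ∀ Q' : ℕ, 0 < Q' → DoublingDim Ω b Q' → Q ≤ Q'

/-- The class `φ^k(Ω)` of `L¹_loc(Ω)` limits of smooth `k`-convex functions. -/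
def PhiK {n m : ℕ} (Ω : Set (Fin n → ℝ)) (b : Fin m → (Fin n → ℝ) → (Fin n → ℝ))
    (k : ℕ) (u : (Fin n → ℝ) → ℝ) : Prop :=
  LocallyIntegrableOn u Ω ∧
  ∀ Ω' : Set (Fin n → ℝ), CptIn Ω' Ω →
    ∃ us : ℕ → (Fin n → ℝ) → ℝ,
      (∀ l, ContDiffOn ℝ 2 (us l) Ω' ∧ IsKConvex Ω' b k (us l)) ∧
      ∀ K : Set (Fin n → ℝ), K ⊆ Ω' → IsCompact K →
        Tendsto (fun l => ∫ x in K, |us l x - u x|) atTop (𝓝 0)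

end

/-- `w` is the distributional commutator `[X_i,X_j]u` on `Ω` (using that
`([X_i,X_j])^* = -[X_i,X_j]` for anti-self-adjoint fields). -/
def IsWeakComm {n m : ℕ} (Ω : Set (Fin n → ℝ))
    (b : Fin m → (Fin n → ℝ) → (Fin n → ℝ)) (i j : Fin m)
    (u w : (Fin n → ℝ) → ℝ) : Prop :=
  ∀ η : (Fin n → ℝ) → ℝ, ContDiff ℝ (⊤ : ℕ∞) η → HasCompactSupport η →
    tsupport η ⊆ Ω →
    ∫ x in Ω, w x * η x = -∫ x in Ω, u x * commOp b i j η x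

section VectorFieldCalculus

variable {n m : ℕ}

/-- The divergence of a vector field. -/
noncomputable def divf (c : (Fin n → ℝ) → (Fin n → ℝ)) (x : Fin n → ℝ) : ℝ :=
  ∑ j, fderiv ℝ (fun y => c y j) x (Pi.single j 1)

lemma fderiv_apply_eq_sum (u : (Fin n → ℝ) → ℝ) (x v : Fin n → ℝ) :
    fderiv ℝ u x v = ∑ j, v j * fderiv ℝ u x (Pi.single j 1) := by
  conv_lhs => rw [pi_eq_sum_univ' v, map_sum]
  simp only [map_smul, smul_eq_mul]
  

lemma xop_eq_sum (c : (Fin n → ℝ) → (Fin n → ℝ)) (u : (Fin n → ℝ) → ℝ) (x : Fin n → ℝ) :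
    Xop c u x = ∑ j, c x j * fderiv ℝ u x (Pi.single j 1) :=
  fderiv_apply_eq_sum u x (c x)

lemma contDiff_xop {k l : WithTop ℕ∞} {c : (Fin n → ℝ) → (Fin n → ℝ)} {u : (Fin n → ℝ) → ℝ}
    (hc : ContDiff ℝ k c) (hu : ContDiff ℝ l u) (h : k + 1 ≤ l) : ContDiff ℝ k (Xop c u) :=
  (hu.fderiv_right h).clm_apply hc

lemma hasCompactSupport_xop (c : (Fin n → ℝ) → (Fin n → ℝ)) {u : (Fin n → ℝ) → ℝ}
    (hu : HasCompactSupport u) : HasCompactSupport (Xop c u) := by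
  refine (hu.fderiv (𝕜 := ℝ)).mono fun x hx => ?_
  contrapose! hx
  simp only [Function.mem_support, not_not] at hx ⊢
  simp [Xop, hx]

lemma tsupport_xop_subset (c : (Fin n → ℝ) → (Fin n → ℝ)) (u : (Fin n → ℝ) → ℝ) :
    tsupport (Xop c u) ⊆ tsupport u := by
  refine (closure_mono fun x hx => ?_).trans (tsupport_fderiv_subset ℝ)
  contrapose! hx
  simp only [Function.mem_support, not_not] at hx ⊢
  simp [Xop, hx]

lemma xop_mul {c : (Fin n → ℝ) → (Fin n → ℝ)} {u v : (Fin n → ℝ) → ℝ} {x : Fin n → ℝ}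
    (hu : DifferentiableAt ℝ u x) (hv : DifferentiableAt ℝ v x) :
    Xop c (fun y => u y * v y) x = u x * Xop c v x + v x * Xop c u x := by
  simp [Xop, fderiv_fun_mul hu hv]

lemma xop_add {c : (Fin n → ℝ) → (Fin n → ℝ)} {u v : (Fin n → ℝ) → ℝ} {x : Fin n → ℝ}
    (hu : DifferentiableAt ℝ u x) (hv : DifferentiableAt ℝ v x) :
    Xop c (fun y => u y + v y) x = Xop c u x + Xop c v x := by
  simp [Xop, fderiv_fun_add hu hv]

lemma xop_sub {c : (Fin n → ℝ) → (Fin n → ℝ)} {u v : (Fin n → ℝ) → ℝ} {x : Fin n → ℝ}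
    (hu : DifferentiableAt ℝ u x) (hv : DifferentiableAt ℝ v x) :
    Xop c (fun y => u y - v y) x = Xop c u x - Xop c v x := by
  simp [Xop, fderiv_fun_sub hu hv]

lemma xop_comp {c : (Fin n → ℝ) → (Fin n → ℝ)} {u : (Fin n → ℝ) → ℝ} {g : ℝ → ℝ} {g' : ℝ}
    {x : Fin n → ℝ} (hg : HasDerivAt g g' (u x)) (hu : DifferentiableAt ℝ u x) :
    Xop c (fun y => g (u y)) x = g' * Xop c u x := by
  have := (hg.hasFDerivAt.comp x hu.hasFDerivAt).fderiv
  simp only [Xop]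
  rw [show (fun y => g (u y)) = g ∘ u from rfl, this]
  simp [mul_comm]

lemma integral_xop_mul {c : (Fin n → ℝ) → (Fin n → ℝ)} {G H : (Fin n → ℝ) → ℝ}
    (hc : ContDiff ℝ 1 c) (hG : ContDiff ℝ 1 G) (hH : ContDiff ℝ 1 H)
    (hHs : HasCompactSupport H) :
    ∫ x, Xop c G x * H x =
      -(∫ x, G x * Xop c H x) - ∫ x, divf c x * (G x * H x) := by
  have hcj : ∀ j, ContDiff ℝ 1 fun x => c x j := fun j => contDiff_pi.1 hc j
  have hGj : ∀ v, Continuous fun x => fderiv ℝ G x v := fun v =>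
    (hG.continuous_fderiv one_ne_zero).clm_apply continuous_const
  have hHj : ∀ v, Continuous fun x => fderiv ℝ H x v := fun v =>
    (hH.continuous_fderiv one_ne_zero).clm_apply continuous_const
  have hcjj : ∀ j v, Continuous fun x => fderiv ℝ (fun y => c y j) x v := fun j v =>
    ((hcj j).continuous_fderiv one_ne_zero).clm_apply continuous_const
  have hHv : ∀ v, HasCompactSupport fun x => fderiv ℝ H x v := fun v =>
    hHs.fderiv_apply (𝕜 := ℝ) v
  have hk : ∀ j, ContDiff ℝ 1 fun x => c x j * H x := fun j => (hcj j).mul hH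
  have hks : ∀ j, HasCompactSupport fun x => c x j * H x := fun j => hHs.mul_left
  have e1 : ∀ j, ∫ x, fderiv ℝ G x (Pi.single j 1) * (c x j * H x) =
      -∫ x, G x * fderiv ℝ (fun y => c y j * H y) x (Pi.single j 1) := by
    intro j
    rw [integral_mul_fderiv_eq_neg_fderiv_mul_of_integrable, neg_neg]
    · exact ((hGj _).mul (hk j).continuous).integrable_of_hasCompactSupport (hks j).mul_left
    · refine (hG.continuous.mul (((hk j).continuous_fderiv one_ne_zero).clm_apply
        continuous_const)).integrable_of_hasCompactSupport
        (HasCompactSupport.mul_left ((hks j).fderiv_apply (𝕜 := ℝ) _))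
    · exact (hG.continuous.mul (hk j).continuous).integrable_of_hasCompactSupport
        (hks j).mul_left
    · exact fun x _ => (hG.differentiable one_ne_zero) x
    · exact fun x _ => ((hk j).differentiable one_ne_zero) x
  have i1 : ∀ j, Integrable fun x => fderiv ℝ G x (Pi.single j 1) * (c x j * H x) := fun j =>
    ((hGj _).mul (hk j).continuous).integrable_of_hasCompactSupport (hks j).mul_left
  have i2 : ∀ j, Integrable fun x => G x * (c x j * fderiv ℝ H x (Pi.single j 1)) := fun j =>
    (hG.continuous.mul ((hcj j).continuous.mul (hHj _))).integrable_of_hasCompactSupport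
      (HasCompactSupport.mul_left (HasCompactSupport.mul_left (hHv _)))
  have i3 : ∀ j, Integrable fun x =>
      fderiv ℝ (fun y => c y j) x (Pi.single j 1) * (G x * H x) := fun j =>
    ((hcjj j _).mul (hG.continuous.mul hH.continuous)).integrable_of_hasCompactSupport
      (HasCompactSupport.mul_left (HasCompactSupport.mul_left hHs))
  have e2 : ∀ j, ∫ x, fderiv ℝ G x (Pi.single j 1) * (c x j * H x) =
      -(∫ x, G x * (c x j * fderiv ℝ H x (Pi.single j 1))) -
        ∫ x, fderiv ℝ (fun y => c y j) x (Pi.single j 1) * (G x * H x) := by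
    intro j
    rw [e1 j, neg_sub_left, add_comm, ← integral_add (i2 j) (i3 j)]
    congr 2
    ext x
    rw [fderiv_fun_mul ((hcj j).differentiable one_ne_zero x) (hH.differentiable one_ne_zero x)]
    simp
    ring
  calc ∫ x, Xop c G x * H x
      = ∫ x, ∑ j, fderiv ℝ G x (Pi.single j 1) * (c x j * H x) := by
        congr 1; ext x
        rw [xop_eq_sum, Finset.sum_mul]
        exact Finset.sum_congr rfl fun j _ => by ring
    _ = ∑ j, ∫ x, fderiv ℝ G x (Pi.single j 1) * (c x j * H x) :=
        integral_finsetSum _ fun j _ => i1 j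
    _ = -(∑ j, ∫ x, G x * (c x j * fderiv ℝ H x (Pi.single j 1))) -
        ∑ j, ∫ x, fderiv ℝ (fun y => c y j) x (Pi.single j 1) * (G x * H x) := by
        rw [← Finset.sum_neg_distrib, ← Finset.sum_sub_distrib]
        exact Finset.sum_congr rfl fun j _ => e2 j
    _ = _ := by
        rw [← integral_finsetSum _ fun j _ => i2 j, ← integral_finsetSum _ fun j _ => i3 j]
        congr 2
        · congr 1; ext x
          rw [xop_eq_sum, Finset.mul_sum]
        · ext x
          rw [divf, Finset.sum_mul]

lemma xop_xop {c d : (Fin n → ℝ) → (Fin n → ℝ)} {u : (Fin n → ℝ) → ℝ} {x : Fin n → ℝ}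
    (hd : DifferentiableAt ℝ d x) (hu : ContDiffAt ℝ 2 u x) :
    Xop c (Xop d u) x = fderiv ℝ (fderiv ℝ u) x (c x) (d x) + fderiv ℝ u x (fderiv ℝ d x (c x)) := by
  have h1 : DifferentiableAt ℝ (fderiv ℝ u) x :=
    (hu.fderiv_right (m := 1) le_rfl).differentiableAt one_ne_zero
  have : fderiv ℝ (Xop d u) x = _ := (h1.hasFDerivAt.clm_apply hd.hasFDerivAt).fderiv
  rw [Xop, this]
  simp [add_comm]

lemma vfBracket_eq_lieBracket {c d : (Fin n → ℝ) → (Fin n → ℝ)} {x : Fin n → ℝ}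
    (hc : DifferentiableAt ℝ c x) (hd : DifferentiableAt ℝ d x) :
    vfBracket c d x = VectorField.lieBracket ℝ c d x := by
  ext l
  simp only [vfBracket, VectorField.lieBracket, Pi.sub_apply]
  congr 1
  · rw [fderiv_apply hd]
    rfl
  · rw [fderiv_apply hc]
    rfl

lemma xop_comm {c d : (Fin n → ℝ) → (Fin n → ℝ)} {u : (Fin n → ℝ) → ℝ} {x : Fin n → ℝ}
    (hc : DifferentiableAt ℝ c x) (hd : DifferentiableAt ℝ d x) (hu : ContDiffAt ℝ 2 u x) :
    Xop c (Xop d u) x - Xop d (Xop c u) x = Xop (fun y => vfBracket c d y) u x := by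
  rw [xop_xop hd hu, xop_xop hc hu, Xop, vfBracket_eq_lieBracket hc hd, VectorField.lieBracket,
    map_sub]
  have hs : fderiv ℝ (fderiv ℝ u) x (c x) (d x) = fderiv ℝ (fderiv ℝ u) x (d x) (c x) :=
    (hu.isSymmSndFDerivAt (by simp)).eq _ _
  rw [hs]
  ring

lemma integral_mul_sq_le {f g : (Fin n → ℝ) → ℝ} (hf : Continuous f) (hg : Continuous g)
    (hfs : HasCompactSupport f) (hgs : HasCompactSupport g) :
    |∫ x, f x * g x| ≤ Real.sqrt (∫ x, f x ^ 2) * Real.sqrt (∫ x, g x ^ 2) := by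
  have h := integral_mul_norm_le_Lp_mul_Lq (μ := (volume : Measure (Fin n → ℝ))) (f := f) (g := g)
    Real.HolderConjugate.two_two (hf.memLp_of_hasCompactSupport hfs)
    (hg.memLp_of_hasCompactSupport hgs)
  have h2 : |∫ x, f x * g x| ≤ ∫ x, ‖f x‖ * ‖g x‖ := by
    rw [← Real.norm_eq_abs]
    refine (norm_integral_le_integral_norm _).trans_eq ?_
    simp only [norm_mul]
  refine h2.trans (h.trans_eq ?_)
  simp [Real.sqrt_eq_rpow]

lemma contDiff_divf {k : WithTop ℕ∞} {c : (Fin n → ℝ) → (Fin n → ℝ)} (hc : ContDiff ℝ (k + 1) c) :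
    ContDiff ℝ k (divf c) := by
  unfold divf
  refine ContDiff.sum fun j _ => ?_
  exact ((contDiff_pi.1 hc j).fderiv_right le_rfl).clm_apply contDiff_const

end VectorFieldCalculus

section KernelCalculus

variable {n m : ℕ}

/-- Boundedness of a `δ`-family, uniformly in `0 < δ ≤ 1` and locally uniformly in `z`. -/
def LocBdd (F : ℝ → (Fin n → ℝ) × (Fin n → ℝ) → ℝ) : Prop :=
  ∀ R : ℝ, ∃ C : ℝ, ∀ δ, 0 < δ → δ ≤ 1 → ∀ p : (Fin n → ℝ) × (Fin n → ℝ), ‖p.2‖ ≤ R → |F δ p| ≤ C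

/-- Directional derivative of a `δ`-family. -/
noncomputable def dirD (v : (Fin n → ℝ) × (Fin n → ℝ))
    (F : ℝ → (Fin n → ℝ) × (Fin n → ℝ) → ℝ) : ℝ → (Fin n → ℝ) × (Fin n → ℝ) → ℝ :=
  fun δ p => fderiv ℝ (F δ) p v

/-- `LocBdd` for all directional derivatives up to a given order. -/
def LocBddN : ℕ → (ℝ → (Fin n → ℝ) × (Fin n → ℝ) → ℝ) → Prop
  | 0, F => LocBdd F
  | k + 1, F => LocBdd F ∧ ∀ v, LocBddN k (dirD v F)

/-- Families of smooth functions with all derivatives locally bounded uniformly in `δ`. -/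
structure IsMult (F : ℝ → (Fin n → ℝ) × (Fin n → ℝ) → ℝ) : Prop where
  smooth : ∀ δ, ContDiff ℝ (⊤ : ℕ∞) (F δ)
  bdd : ∀ k, LocBddN k F

lemma LocBddN.zero {k : ℕ} {F : ℝ → (Fin n → ℝ) × (Fin n → ℝ) → ℝ} (h : LocBddN k F) :
    LocBdd F := by
  cases k with
  | zero => exact h
  | succ k => exact h.1

lemma LocBddN.pred {k : ℕ} {F : ℝ → (Fin n → ℝ) × (Fin n → ℝ) → ℝ} (h : LocBddN (k + 1) F) :
    LocBddN k F := by
  induction k generalizing F with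
  | zero => exact h.1
  | succ k ih => exact ⟨h.1, fun v => ih (h.2 v)⟩

lemma LocBdd.congr {F G : ℝ → (Fin n → ℝ) × (Fin n → ℝ) → ℝ} (hF : LocBdd F)
    (h : ∀ δ, 0 < δ → δ ≤ 1 → F δ = G δ) : LocBdd G := by
  intro R
  obtain ⟨C, hC⟩ := hF R
  exact ⟨C, fun δ h0 h1 p hp => h δ h0 h1 ▸ hC δ h0 h1 p hp⟩

lemma LocBddN.congr {k : ℕ} {F G : ℝ → (Fin n → ℝ) × (Fin n → ℝ) → ℝ} (hF : LocBddN k F)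
    (h : ∀ δ, 0 < δ → δ ≤ 1 → F δ = G δ) : LocBddN k G := by
  induction k generalizing F G with
  | zero => exact LocBdd.congr hF h
  | succ k ih =>
    refine ⟨LocBdd.congr hF.1 h, fun v => ih (hF.2 v) fun δ h0 h1 => ?_⟩
    funext p
    change fderiv ℝ (F δ) p v = fderiv ℝ (G δ) p v
    rw [h δ h0 h1]

lemma LocBdd.add {F G : ℝ → (Fin n → ℝ) × (Fin n → ℝ) → ℝ} (hF : LocBdd F) (hG : LocBdd G) :
    LocBdd (fun δ p => F δ p + G δ p) := by
  intro R
  obtain ⟨C, hC⟩ := hF R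
  obtain ⟨D, hD⟩ := hG R
  exact ⟨C + D, fun δ h0 h1 p hp =>
    (abs_add_le _ _).trans (add_le_add (hC δ h0 h1 p hp) (hD δ h0 h1 p hp))⟩

lemma LocBdd.mul {F G : ℝ → (Fin n → ℝ) × (Fin n → ℝ) → ℝ} (hF : LocBdd F) (hG : LocBdd G) :
    LocBdd (fun δ p => F δ p * G δ p) := by
  intro R
  obtain ⟨C, hC⟩ := hF R
  obtain ⟨D, hD⟩ := hG R
  refine ⟨C * D, fun δ h0 h1 p hp => ?_⟩
  rw [abs_mul]
  exact mul_le_mul (hC δ h0 h1 p hp) (hD δ h0 h1 p hp) (abs_nonneg _)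
    ((abs_nonneg _).trans (hC δ h0 h1 p hp))

lemma LocBddN.add {k : ℕ} {F G : ℝ → (Fin n → ℝ) × (Fin n → ℝ) → ℝ}
    (hFs : ∀ δ, ContDiff ℝ (⊤ : ℕ∞) (F δ)) (hGs : ∀ δ, ContDiff ℝ (⊤ : ℕ∞) (G δ))
    (hF : LocBddN k F) (hG : LocBddN k G) : LocBddN k (fun δ p => F δ p + G δ p) := by
  induction k generalizing F G with
  | zero => exact LocBdd.add hF hG
  | succ k ih =>
    refine ⟨hF.1.add hG.1, fun v => ?_⟩
    have e : dirD v (fun δ p => F δ p + G δ p) = fun δ p => dirD v F δ p + dirD v G δ p := by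
      ext δ p
      simp only [dirD]
      rw [fderiv_fun_add ((hFs δ).differentiable (by simp) p)
        ((hGs δ).differentiable (by simp) p)]
      rfl
    rw [e]
    exact ih (fun δ => ((hFs δ).fderiv_right (by simp)).clm_apply contDiff_const)
      (fun δ => ((hGs δ).fderiv_right (by simp)).clm_apply contDiff_const) (hF.2 v) (hG.2 v)

lemma IsMult.add {F G : ℝ → (Fin n → ℝ) × (Fin n → ℝ) → ℝ} (hF : IsMult F) (hG : IsMult G) :
    IsMult (fun δ p => F δ p + G δ p) :=
  ⟨fun δ => (hF.smooth δ).add (hG.smooth δ),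
    fun k => LocBddN.add hF.smooth hG.smooth (hF.bdd k) (hG.bdd k)⟩

lemma IsMult.dirD {F : ℝ → (Fin n → ℝ) × (Fin n → ℝ) → ℝ} (hF : IsMult F)
    (v : (Fin n → ℝ) × (Fin n → ℝ)) : IsMult (dirD v F) :=
  ⟨fun δ => ((hF.smooth δ).fderiv_right (by simp)).clm_apply contDiff_const,
    fun k => (hF.bdd (k + 1)).2 v⟩

lemma dirD_mul {F G : ℝ → (Fin n → ℝ) × (Fin n → ℝ) → ℝ} (hF : IsMult F) (hG : IsMult G)
    (v : (Fin n → ℝ) × (Fin n → ℝ)) :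
    _root_.dirD v (fun δ p => F δ p * G δ p) =
      fun δ p => F δ p * _root_.dirD v G δ p + _root_.dirD v F δ p * G δ p := by
  ext δ p
  simp only [_root_.dirD]
  rw [fderiv_fun_mul ((hF.smooth δ).differentiable (by simp) p)
    ((hG.smooth δ).differentiable (by simp) p)]
  simp
  ring

lemma IsMult.mul {F G : ℝ → (Fin n → ℝ) × (Fin n → ℝ) → ℝ} (hF : IsMult F) (hG : IsMult G) :
    IsMult (fun δ p => F δ p * G δ p) := by
  refine ⟨fun δ => (hF.smooth δ).mul (hG.smooth δ), fun k => ?_⟩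
  induction k generalizing F G with
  | zero => exact LocBdd.mul (hF.bdd 0) (hG.bdd 0)
  | succ k ih =>
    refine ⟨LocBdd.mul (hF.bdd 0) (hG.bdd 0), fun v => ?_⟩
    rw [dirD_mul hF hG]
    exact LocBddN.add (fun δ => (hF.smooth δ).mul ((hG.dirD v).smooth δ))
      (fun δ => ((hF.dirD v).smooth δ).mul (hG.smooth δ)) (ih hF (hG.dirD v)) (ih (hF.dirD v) hG)

lemma isMult_const {t : ℝ → ℝ} {M : ℝ} (ht : ∀ δ, 0 < δ → δ ≤ 1 → |t δ| ≤ M) :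
    IsMult (fun δ (_ : (Fin n → ℝ) × (Fin n → ℝ)) => t δ) := by
  refine ⟨fun δ => contDiff_const, fun k => ?_⟩
  induction k generalizing t M with
  | zero => exact fun R => ⟨M, fun δ h0 h1 p _ => ht δ h0 h1⟩
  | succ k ih =>
    refine ⟨fun R => ⟨M, fun δ h0 h1 p _ => ht δ h0 h1⟩, fun v => ?_⟩
    have : _root_.dirD v (fun δ (_ : (Fin n → ℝ) × (Fin n → ℝ)) => t δ) = fun _ _ => 0 := by
      ext δ p
      simp [_root_.dirD]
    rw [this]
    exact ih (t := fun _ => 0) (M := 0) (by simp)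

lemma IsMult.sum {ι : Type*} (s : Finset ι) {F : ι → ℝ → (Fin n → ℝ) × (Fin n → ℝ) → ℝ}
    (hF : ∀ i ∈ s, IsMult (F i)) : IsMult (fun δ p => ∑ i ∈ s, F i δ p) := by
  classical
  induction s using Finset.induction_on with
  | empty => simpa using isMult_const (t := fun _ => 0) (M := 0) (by simp)
  | insert i s hi ih =>
    simp only [Finset.sum_insert hi]
    exact (hF i (by simp)).add (ih fun j hj => hF j (by simp [hj]))

lemma IsMult.congr {F G : ℝ → (Fin n → ℝ) × (Fin n → ℝ) → ℝ} (hF : IsMult F)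
    (hG : ∀ δ, ContDiff ℝ (⊤ : ℕ∞) (G δ)) (h : ∀ δ, 0 < δ → δ ≤ 1 → F δ = G δ) : IsMult G :=
  ⟨hG, fun k => (hF.bdd k).congr h⟩

lemma fderiv_comp_translate {a : (Fin n → ℝ) → ℝ} (ha : ContDiff ℝ (⊤ : ℕ∞) a) (t : ℝ)
    (p v : (Fin n → ℝ) × (Fin n → ℝ)) :
    fderiv ℝ (fun p : (Fin n → ℝ) × (Fin n → ℝ) => a (p.1 - t • p.2)) p v =
      fderiv ℝ a (p.1 - t • p.2) v.1 - t * fderiv ℝ a (p.1 - t • p.2) v.2 := by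
  have h1 : HasFDerivAt (fun p : (Fin n → ℝ) × (Fin n → ℝ) => p.1 - t • p.2)
      (ContinuousLinearMap.fst ℝ _ _ - t • ContinuousLinearMap.snd ℝ _ _) p :=
    hasFDerivAt_fst.sub (hasFDerivAt_snd.const_smul t)
  have h2 := ((ha.differentiable (by simp) (p.1 - t • p.2)).hasFDerivAt.comp p h1).fderiv
  rw [show (fun p : (Fin n → ℝ) × (Fin n → ℝ) => a (p.1 - t • p.2)) =
    a ∘ fun p : (Fin n → ℝ) × (Fin n → ℝ) => p.1 - t • p.2 from rfl, h2]
  simp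

lemma contDiff_comp_translate {k : WithTop ℕ∞} {a : (Fin n → ℝ) → ℝ} (ha : ContDiff ℝ k a)
    (t : ℝ) : ContDiff ℝ k (fun p : (Fin n → ℝ) × (Fin n → ℝ) => a (p.1 - t • p.2)) :=
  ha.comp (contDiff_fst.sub (contDiff_snd.const_smul t))

lemma contDiff_fderiv_apply_const {a : (Fin n → ℝ) → ℝ} (ha : ContDiff ℝ (⊤ : ℕ∞) a)
    (v : Fin n → ℝ) : ContDiff ℝ (⊤ : ℕ∞) (fun x => fderiv ℝ a x v) :=
  (ha.fderiv_right (by simp)).clm_apply contDiff_const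

lemma exists_bound_of_hasCompactSupport {a : (Fin n → ℝ) → ℝ} (ha : Continuous a)
    (hs : HasCompactSupport a) : ∃ C, ∀ x, |a x| ≤ C :=
  hs.exists_bound_of_continuous ha

lemma isMult_translate {a : (Fin n → ℝ) → ℝ} (ha : ContDiff ℝ (⊤ : ℕ∞) a)
    (hs : HasCompactSupport a) {t : ℝ → ℝ} (ht : ∀ δ, 0 < δ → δ ≤ 1 → |t δ| ≤ 1) :
    IsMult (fun δ (p : (Fin n → ℝ) × (Fin n → ℝ)) => a (p.1 - t δ • p.2)) := by
  refine ⟨fun δ => contDiff_comp_translate ha _, fun k => ?_⟩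
  have h0 : ∀ {a : (Fin n → ℝ) → ℝ}, ContDiff ℝ (⊤ : ℕ∞) a → HasCompactSupport a →
      LocBdd (fun δ (p : (Fin n → ℝ) × (Fin n → ℝ)) => a (p.1 - t δ • p.2)) := by
    intro a ha hs R
    obtain ⟨C, hC⟩ := exists_bound_of_hasCompactSupport ha.continuous hs
    exact ⟨C, fun δ _ _ p _ => hC _⟩
  induction k generalizing a with
  | zero => exact h0 ha hs
  | succ k ih =>
    refine ⟨h0 ha hs, fun v => ?_⟩
    have e : _root_.dirD v (fun δ (p : (Fin n → ℝ) × (Fin n → ℝ)) => a (p.1 - t δ • p.2)) =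
        fun δ p => fderiv ℝ a (p.1 - t δ • p.2) v.1 +
          (-t δ) * fderiv ℝ a (p.1 - t δ • p.2) v.2 := by
      ext δ p
      simp only [_root_.dirD]
      rw [fderiv_comp_translate ha]
      ring
    rw [e]
    have s1 := fun (w : Fin n → ℝ) (δ : ℝ) =>
      contDiff_comp_translate (contDiff_fderiv_apply_const ha w) (t δ)
    have hw := fun w : Fin n → ℝ =>
      ih (contDiff_fderiv_apply_const ha w) (hs.fderiv_apply (𝕜 := ℝ) w)
    have ht' : IsMult (fun δ (_ : (Fin n → ℝ) × (Fin n → ℝ)) => -t δ) :=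
      isMult_const (M := 1) fun δ h0 h1 => by rw [abs_neg]; exact ht δ h0 h1
    refine LocBddN.add (s1 v.1) (fun δ => contDiff_const.mul (s1 v.2 δ)) (hw _) ?_
    have hmul : ∀ (k : ℕ) (c : ℝ → ℝ) (G : ℝ → (Fin n → ℝ) × (Fin n → ℝ) → ℝ),
        (∀ δ, 0 < δ → δ ≤ 1 → |c δ| ≤ 1) → (∀ δ, ContDiff ℝ (⊤ : ℕ∞) (G δ)) → LocBddN k G →
        LocBddN k (fun δ p => c δ * G δ p) := by
      intro k c
      induction k with
      | zero =>
        intro G hc _ hG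
        exact LocBdd.mul (fun R => ⟨1, fun δ h0 h1 _ _ => hc δ h0 h1⟩) hG
      | succ k ih2 =>
        intro G hc hGs hG
        refine ⟨LocBdd.mul (fun R => ⟨1, fun δ h0 h1 _ _ => hc δ h0 h1⟩) hG.1, fun v => ?_⟩
        have : _root_.dirD v (fun δ p => c δ * G δ p) = fun δ p => c δ * _root_.dirD v G δ p := by
          ext δ p
          simp only [_root_.dirD]
          rw [fderiv_const_mul ((hGs δ).differentiable (by simp) p)]
          rfl
        rw [this]
        exact ih2 _ hc (fun δ => ((hGs δ).fderiv_right (by simp)).clm_apply contDiff_const) (hG.2 v)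
    exact hmul k _ _ (fun δ h0 h1 => by rw [abs_neg]; exact ht δ h0 h1) (s1 v.2) (hw _)

lemma isMult_fst {a : (Fin n → ℝ) → ℝ} (ha : ContDiff ℝ (⊤ : ℕ∞) a)
    (hs : HasCompactSupport a) :
    IsMult (fun _ (p : (Fin n → ℝ) × (Fin n → ℝ)) => a p.1) := by
  simpa using isMult_translate ha hs (t := fun _ => 0) (by simp)

lemma isMult_snd {a : (Fin n → ℝ) → ℝ} (ha : ContDiff ℝ (⊤ : ℕ∞) a) :
    IsMult (fun _ (p : (Fin n → ℝ) × (Fin n → ℝ)) => a p.2) := by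
  refine ⟨fun δ => ha.comp contDiff_snd, fun k => ?_⟩
  have h0 : ∀ {a : (Fin n → ℝ) → ℝ}, ContDiff ℝ (⊤ : ℕ∞) a →
      LocBdd (fun _ (p : (Fin n → ℝ) × (Fin n → ℝ)) => a p.2) := by
    intro a ha R
    obtain ⟨C, hC⟩ := (isCompact_closedBall (0 : Fin n → ℝ) R).exists_bound_of_continuousOn
      ha.continuous.continuousOn
    exact ⟨C, fun δ _ _ p hp => hC _ (by simpa using hp)⟩
  induction k generalizing a with
  | zero => exact h0 ha
  | succ k ih =>
    refine ⟨h0 ha, fun v => ?_⟩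
    have e : _root_.dirD v (fun _ (p : (Fin n → ℝ) × (Fin n → ℝ)) => a p.2) =
        fun _ p => fderiv ℝ a p.2 v.2 := by
      ext δ p
      simp only [_root_.dirD]
      have h2 := ((ha.differentiable (by simp) p.2).hasFDerivAt.comp p hasFDerivAt_snd).fderiv
      rw [show (fun p : (Fin n → ℝ) × (Fin n → ℝ) => a p.2) = a ∘ Prod.snd from rfl, h2]
      simp
    rw [e]
    exact ih (contDiff_fderiv_apply_const ha v.2)

/-- The difference quotient `(a(x) - a(x - δ z)) / δ`. -/
noncomputable def diffQuot (a : (Fin n → ℝ) → ℝ) : ℝ → (Fin n → ℝ) × (Fin n → ℝ) → ℝ :=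
  fun δ p => δ⁻¹ * (a p.1 - a (p.1 - δ • p.2))

lemma isMult_diffQuot {a : (Fin n → ℝ) → ℝ} (ha : ContDiff ℝ (⊤ : ℕ∞) a)
    (hs : HasCompactSupport a) : IsMult (diffQuot a) := by
  have hsm : ∀ {a : (Fin n → ℝ) → ℝ}, ContDiff ℝ (⊤ : ℕ∞) a → ∀ δ,
      ContDiff ℝ (⊤ : ℕ∞) (diffQuot a δ) := fun {a} ha δ =>
    contDiff_const.mul ((ha.comp contDiff_fst).sub (contDiff_comp_translate ha δ))
  refine ⟨hsm ha, fun k => ?_⟩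
  have h0 : ∀ {a : (Fin n → ℝ) → ℝ}, ContDiff ℝ (⊤ : ℕ∞) a → HasCompactSupport a →
      LocBdd (diffQuot a) := by
    intro a ha hs R
    obtain ⟨L, hL⟩ := ContDiff.lipschitzWith_of_hasCompactSupport hs ha (by simp)
    refine ⟨L * R, fun δ h0 h1 p hp => ?_⟩
    have h := hL.dist_le_mul p.1 (p.1 - δ • p.2)
    rw [Real.dist_eq, dist_eq_norm, sub_sub_cancel, norm_smul, Real.norm_of_nonneg h0.le] at h
    rw [diffQuot, abs_mul, abs_of_pos (inv_pos.2 h0), inv_mul_le_iff₀ h0]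
    calc _ ≤ L * (δ * ‖p.2‖) := h
      _ ≤ L * (δ * R) := by gcongr
      _ = _ := by ring
  induction k generalizing a with
  | zero => exact h0 ha hs
  | succ k ih =>
    refine ⟨h0 ha hs, fun v => ?_⟩
    have i1 := ih (contDiff_fderiv_apply_const ha v.1) (hs.fderiv_apply (𝕜 := ℝ) v.1)
    have i2 := isMult_translate (contDiff_fderiv_apply_const ha v.2)
      (hs.fderiv_apply (𝕜 := ℝ) v.2) (t := id) (fun δ h0 h1 => by simpa [abs_of_pos h0] using h1)
    refine (LocBddN.add (hsm (contDiff_fderiv_apply_const ha v.1)) i2.smooth i1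
      (i2.bdd k)).congr fun δ h0 h1 => ?_
    ext p
    have d1 : DifferentiableAt ℝ (fun p : (Fin n → ℝ) × (Fin n → ℝ) => a p.1) p :=
      (ha.comp contDiff_fst).differentiable (by simp) p
    have d2 := (contDiff_comp_translate ha δ).differentiable (by simp) p
    have d3 := fderiv_comp_translate ha 0 p v
    simp only [zero_smul, sub_zero, zero_mul] at d3
    simp only [_root_.dirD, diffQuot]
    rw [show diffQuot a δ = fun p => δ⁻¹ * (a p.1 - a (p.1 - δ • p.2)) from rfl,
      fderiv_const_mul (d1.fun_sub d2), fderiv_fun_sub d1 d2]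
    simp only [smul_apply, sub_apply, smul_eq_mul]
    rw [d3, fderiv_comp_translate ha]
    simp only [id]
    field_simp
    ring

/-- Multiplier families with support bounded in `z`. -/
structure IsKer (F : ℝ → (Fin n → ℝ) × (Fin n → ℝ) → ℝ) : Prop extends IsMult F where
  supp : ∃ R : ℝ, ∀ δ p, R < ‖p.2‖ → F δ p = 0

lemma IsKer.mul {F G : ℝ → (Fin n → ℝ) × (Fin n → ℝ) → ℝ} (hF : IsKer F) (hG : IsMult G) :
    IsKer (fun δ p => F δ p * G δ p) := by
  obtain ⟨R, hR⟩ := hF.supp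
  exact ⟨hF.toIsMult.mul hG, R, fun δ p hp => by simp [hR δ p hp]⟩

lemma IsKer.add {F G : ℝ → (Fin n → ℝ) × (Fin n → ℝ) → ℝ} (hF : IsKer F) (hG : IsKer G) :
    IsKer (fun δ p => F δ p + G δ p) := by
  obtain ⟨R, hR⟩ := hF.supp
  obtain ⟨R', hR'⟩ := hG.supp
  exact ⟨hF.toIsMult.add hG.toIsMult, max R R', fun δ p hp => by
    rw [max_lt_iff] at hp
    simp [hR δ p hp.1, hR' δ p hp.2]⟩

lemma IsKer.sum {ι : Type*} (s : Finset ι) {F : ι → ℝ → (Fin n → ℝ) × (Fin n → ℝ) → ℝ}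
    (hF : ∀ i ∈ s, IsKer (F i)) : IsKer (fun δ p => ∑ i ∈ s, F i δ p) := by
  classical
  induction s using Finset.induction_on with
  | empty => exact ⟨IsMult.sum ∅ (F := F) (by simp), 0, by simp⟩
  | insert i s hi ih =>
    simp only [Finset.sum_insert hi]
    exact (hF i (by simp)).add (ih fun j hj => hF j (by simp [hj]))

lemma IsKer.dirD {F : ℝ → (Fin n → ℝ) × (Fin n → ℝ) → ℝ} (hF : IsKer F)
    (v : (Fin n → ℝ) × (Fin n → ℝ)) : IsKer (dirD v F) := by
  obtain ⟨R, hR⟩ := hF.supp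
  refine ⟨hF.toIsMult.dirD v, R, fun δ p hp => ?_⟩
  have : F δ =ᶠ[𝓝 p] fun _ => 0 := by
    have ho : IsOpen {p : (Fin n → ℝ) × (Fin n → ℝ) | R < ‖p.2‖} :=
      isOpen_lt continuous_const (continuous_norm.comp continuous_snd)
    filter_upwards [ho.mem_nhds hp] with q hq using hR δ q hq
  simp [_root_.dirD, this.fderiv_eq]

lemma isKer_snd {a : (Fin n → ℝ) → ℝ} (ha : ContDiff ℝ (⊤ : ℕ∞) a) (hs : HasCompactSupport a) :
    IsKer (fun _ (p : (Fin n → ℝ) × (Fin n → ℝ)) => a p.2) := by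
  obtain ⟨R, hR⟩ := hs.isCompact.isBounded.subset_closedBall (0 : Fin n → ℝ)
  refine ⟨isMult_snd ha, R, fun δ p hp => ?_⟩
  by_contra h
  have := hR (subset_tsupport a (Function.mem_support.2 h))
  simp at this
  linarith

end KernelCalculus

section ParametricIntegral

variable {n : ℕ}

lemma integral_eq_setIntegral_closedBall {G : Type*} [NormedAddCommGroup G] [NormedSpace ℝ G]
    {g : (Fin n → ℝ) → G} {R : ℝ} (h : ∀ z, R < ‖z‖ → g z = 0) :
    ∫ z, g z = ∫ z in Metric.closedBall 0 R, g z := by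
  refine (setIntegral_eq_integral_of_forall_compl_eq_zero fun z hz => h z ?_).symm
  simpa using hz

lemma continuous_integral_snd {G : Type*} [NormedAddCommGroup G] [NormedSpace ℝ G]
    {f : (Fin n → ℝ) × (Fin n → ℝ) → G} (hf : Continuous f) {R : ℝ}
    (hR : ∀ p, R < ‖p.2‖ → f p = 0) : Continuous fun x => ∫ z, f (x, z) := by
  have e : (fun x => ∫ z, f (x, z)) = fun x => ∫ z in Metric.closedBall 0 R, f (x, z) := by
    ext x
    exact integral_eq_setIntegral_closedBall fun z hz => hR (x, z) hz
  rw [e]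
  exact continuous_parametric_integral_of_continuous (f := fun x z => f (x, z)) hf
    (isCompact_closedBall _ _)

lemma fderiv_eq_zero_of_snd {f : (Fin n → ℝ) × (Fin n → ℝ) → ℝ} {R : ℝ}
    (hR : ∀ p, R < ‖p.2‖ → f p = 0) (p : (Fin n → ℝ) × (Fin n → ℝ)) (hp : R < ‖p.2‖) :
    fderiv ℝ f p = 0 := by
  have : f =ᶠ[𝓝 p] fun _ => 0 := by
    have ho : IsOpen {p : (Fin n → ℝ) × (Fin n → ℝ) | R < ‖p.2‖} :=
      isOpen_lt continuous_const (continuous_norm.comp continuous_snd)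
    filter_upwards [ho.mem_nhds hp] with q hq using hR q hq
  simp [this.fderiv_eq]

lemma hasFDerivAt_integral_snd {f : (Fin n → ℝ) × (Fin n → ℝ) → ℝ} (hf : ContDiff ℝ 1 f) {R : ℝ}
    (hR : ∀ p, R < ‖p.2‖ → f p = 0) (x : Fin n → ℝ) :
    HasFDerivAt (fun x => ∫ z, f (x, z))
      (∫ z, (fderiv ℝ f (x, z)).comp (ContinuousLinearMap.inl ℝ (Fin n → ℝ) (Fin n → ℝ))) x := by
  have hfd : Continuous fun p => (fderiv ℝ f p).comp
      (ContinuousLinearMap.inl ℝ (Fin n → ℝ) (Fin n → ℝ)) :=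
    (hf.continuous_fderiv one_ne_zero).clm_comp continuous_const
  have hcs : ∀ y, HasCompactSupport fun z => f (y, z) := fun y =>
    HasCompactSupport.intro (isCompact_closedBall 0 R) fun z hz => hR _ (by simpa using hz)
  obtain ⟨C, hC⟩ := ((isCompact_closedBall x 1).prod
    (isCompact_closedBall (0 : Fin n → ℝ) R)).exists_bound_of_continuousOn hfd.continuousOn
  have e : (fun x => ∫ z, f (x, z)) = fun x => ∫ z in Metric.closedBall 0 R, f (x, z) := by
    ext x
    exact integral_eq_setIntegral_closedBall fun z hz => hR (x, z) hz
  rw [e, integral_eq_setIntegral_closedBall (R := R) fun z hz => by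
    rw [fderiv_eq_zero_of_snd hR (x, z) hz, ContinuousLinearMap.zero_comp]]
  refine hasFDerivAt_integral_of_dominated_of_fderiv_le (bound := fun _ => C)
    (s := Metric.ball x 1) (Metric.ball_mem_nhds x one_pos)
    (F' := fun x z => (fderiv ℝ f (x, z)).comp
      (ContinuousLinearMap.inl ℝ (Fin n → ℝ) (Fin n → ℝ))) ?_ ?_ ?_ ?_ ?_ ?_
  · exact Eventually.of_forall fun y =>
      (hf.continuous.comp (Continuous.prodMk_right y)).aestronglyMeasurable
  · exact ((hf.continuous.comp (Continuous.prodMk_right x)).integrable_of_hasCompactSupport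
      (hcs x)).integrableOn
  · exact (hfd.comp (Continuous.prodMk_right x)).aestronglyMeasurable
  · filter_upwards [ae_restrict_mem measurableSet_closedBall] with z hz y hy
    exact hC (y, z) ⟨Metric.ball_subset_closedBall hy, hz⟩
  · exact integrableOn_const (by exact (isCompact_closedBall _ _).measure_lt_top.ne)
  · refine Eventually.of_forall fun z y _ => ?_
    have h1 := (hf.differentiable one_ne_zero (y, z)).hasFDerivAt
    exact h1.comp y (hasFDerivAt_prodMk_left y z)

lemma contDiff_integral_snd {f : (Fin n → ℝ) × (Fin n → ℝ) → ℝ} (hf : ContDiff ℝ 1 f) {R : ℝ}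
    (hR : ∀ p, R < ‖p.2‖ → f p = 0) : ContDiff ℝ 1 fun x => ∫ z, f (x, z) := by
  refine contDiff_one_iff_hasFDerivAt.2 ⟨_, ?_, hasFDerivAt_integral_snd hf hR⟩
  refine continuous_integral_snd (f := fun p => (fderiv ℝ f p).comp
      (ContinuousLinearMap.inl ℝ (Fin n → ℝ) (Fin n → ℝ)))
    ((hf.continuous_fderiv one_ne_zero).clm_comp continuous_const) (R := R) fun p hp => ?_
  rw [fderiv_eq_zero_of_snd hR p hp, ContinuousLinearMap.zero_comp]

lemma fderiv_integral_snd {f : (Fin n → ℝ) × (Fin n → ℝ) → ℝ} (hf : ContDiff ℝ 1 f) {R : ℝ}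
    (hR : ∀ p, R < ‖p.2‖ → f p = 0) (x v : Fin n → ℝ) :
    fderiv ℝ (fun x => ∫ z, f (x, z)) x v = ∫ z, fderiv ℝ f (x, z) (v, 0) := by
  have hi : Integrable fun z => (fderiv ℝ f (x, z)).comp
      (ContinuousLinearMap.inl ℝ (Fin n → ℝ) (Fin n → ℝ)) := by
    refine Continuous.integrable_of_hasCompactSupport (((hf.continuous_fderiv one_ne_zero).comp
      (Continuous.prodMk_right x)).clm_comp continuous_const) ?_
    refine HasCompactSupport.intro (isCompact_closedBall 0 R) fun z hz => ?_
    rw [fderiv_eq_zero_of_snd hR (x, z) (by simpa using hz), ContinuousLinearMap.zero_comp]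
  rw [(hasFDerivAt_integral_snd hf hR x).fderiv, ContinuousLinearMap.integral_apply hi]
  rfl

lemma integral_fderiv_eq_zero {g : (Fin n → ℝ) → ℝ} (hg : ContDiff ℝ 1 g)
    (hs : HasCompactSupport g) (v : Fin n → ℝ) : ∫ z, fderiv ℝ g z v = 0 := by
  have h := integral_xop_mul (c := fun _ => v) (G := fun _ => (1 : ℝ)) contDiff_const
    contDiff_const hg hs
  have : (divf fun _ : Fin n → ℝ => v) = 0 := by
    ext x
    simp [divf]
  simpa [Xop, this] using h

end ParametricIntegral

section SmoothingOperators

variable {n m : ℕ}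

/-- The operator `φ ↦ ∫ F_δ(x, z) φ(x - δ z) dz`. -/
noncomputable def kerOp (F : ℝ → (Fin n → ℝ) × (Fin n → ℝ) → ℝ) (δ : ℝ) (φ : (Fin n → ℝ) → ℝ)
    (x : Fin n → ℝ) : ℝ :=
  ∫ z, F δ (x, z) * φ (x - δ • z)

variable {F : ℝ → (Fin n → ℝ) × (Fin n → ℝ) → ℝ} {φ : (Fin n → ℝ) → ℝ}

lemma IsKer.exists_supp (hF : IsKer F) : ∃ R : ℝ, 0 ≤ R ∧ ∀ δ p, R < ‖p.2‖ → F δ p = 0 := by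
  obtain ⟨R, hR⟩ := hF.supp
  exact ⟨max R 0, le_max_right _ _, fun δ p hp => hR δ p ((le_max_left _ _).trans_lt hp)⟩

lemma IsKer.continuous_kerOp (hF : IsKer F) (hφ : Continuous φ) (δ : ℝ) :
    Continuous (kerOp F δ φ) := by
  obtain ⟨R, -, hR⟩ := hF.exists_supp
  exact continuous_integral_snd (f := fun p => F δ p * φ (p.1 - δ • p.2)) (R := R)
    ((hF.smooth δ).continuous.mul (hφ.comp
      (continuous_fst.sub (continuous_snd.const_smul δ))))
    fun p hp => by simp [hR δ p hp]

lemma IsKer.contDiff_kerOp (hF : IsKer F) (hφ : ContDiff ℝ 1 φ) (δ : ℝ) :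
    ContDiff ℝ 1 (kerOp F δ φ) := by
  obtain ⟨R, -, hR⟩ := hF.exists_supp
  exact contDiff_integral_snd (f := fun p => F δ p * φ (p.1 - δ • p.2)) (R := R)
    (((hF.smooth δ).of_le (by simp)).mul (contDiff_comp_translate hφ δ))
    fun p hp => by simp [hR δ p hp]

lemma IsKer.hasCompactSupport_kerOp (hF : IsKer F) (hφ : HasCompactSupport φ) (δ : ℝ) :
    HasCompactSupport (kerOp F δ φ) := by
  obtain ⟨R, hR0, hR⟩ := hF.exists_supp
  obtain ⟨S, hS⟩ := hφ.isCompact.isBounded.subset_closedBall (0 : Fin n → ℝ)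
  refine HasCompactSupport.intro (isCompact_closedBall 0 (S + |δ| * R)) fun x hx => ?_
  simp only [Metric.mem_closedBall, dist_zero_right, not_le] at hx
  refine integral_eq_zero_of_ae (Eventually.of_forall fun z => ?_)
  by_cases hz : R < ‖z‖
  · simp [hR δ (x, z) hz]
  · have : φ (x - δ • z) = 0 := by
      by_contra h
      have h1 := hS (subset_tsupport φ (Function.mem_support.2 h))
      simp only [Metric.mem_closedBall, dist_zero_right] at h1
      have h2 : ‖x‖ ≤ ‖x - δ • z‖ + ‖δ • z‖ := by
        simpa using norm_add_le (x - δ • z) (δ • z)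
      rw [norm_smul, Real.norm_eq_abs] at h2
      have : |δ| * ‖z‖ ≤ |δ| * R := mul_le_mul_of_nonneg_left (not_lt.1 hz) (abs_nonneg _)
      linarith
    simp [this]

lemma IsKer.integrable_ker (hF : IsKer F) (hφ : Continuous φ) (δ : ℝ) (x : Fin n → ℝ) :
    Integrable fun z => F δ (x, z) * φ (x - δ • z) := by
  obtain ⟨R, hR0, hR⟩ := hF.exists_supp
  refine Continuous.integrable_of_hasCompactSupport ?_ ?_
  · exact ((hF.smooth δ).continuous.comp (Continuous.prodMk_right x)).mul (hφ.comp
      (continuous_const.sub (continuous_id.const_smul δ)))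
  · exact HasCompactSupport.intro (isCompact_closedBall 0 R) fun z hz => by
      simp [hR δ (x, z) (by simpa using hz)]

lemma IsKer.fderiv_kerOp (hF : IsKer F) (hφ : ContDiff ℝ 1 φ) (δ : ℝ) (x v : Fin n → ℝ) :
    fderiv ℝ (kerOp F δ φ) x v =
      kerOp (_root_.dirD (v, 0) F) δ φ x + kerOp F δ (fun y => fderiv ℝ φ y v) x := by
  obtain ⟨R, -, hR⟩ := hF.exists_supp
  have h := fderiv_integral_snd (f := fun p => F δ p * φ (p.1 - δ • p.2)) (R := R)
    (((hF.smooth δ).of_le (by simp)).mul (contDiff_comp_translate hφ δ))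
    (fun p hp => by simp [hR δ p hp]) x v
  have hφ' : Continuous fun y => fderiv ℝ φ y v :=
    (hφ.continuous_fderiv one_ne_zero).clm_apply continuous_const
  refine h.trans ?_
  simp only [kerOp]
  rw [← integral_add ((hF.dirD _).integrable_ker hφ.continuous δ x)
    (hF.integrable_ker hφ' δ x)]
  congr 1
  ext z
  have h1 : HasFDerivAt (fun p : (Fin n → ℝ) × (Fin n → ℝ) => p.1 - δ • p.2)
      (ContinuousLinearMap.fst ℝ _ _ - δ • ContinuousLinearMap.snd ℝ _ _) (x, z) :=
    hasFDerivAt_fst.sub (hasFDerivAt_snd.const_smul δ)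
  have h2 : HasFDerivAt (fun p : (Fin n → ℝ) × (Fin n → ℝ) => φ (p.1 - δ • p.2)) _ (x, z) :=
    HasFDerivAt.comp (x, z) (hφ.differentiable one_ne_zero (x - δ • z)).hasFDerivAt h1
  rw [(((hF.smooth δ).differentiable (by simp) (x, z)).hasFDerivAt.fun_mul h2).fderiv]
  simp [_root_.dirD]
  ring

/-- Integration by parts in `z`. -/
lemma IsKer.kerOp_smul_fderiv (hF : IsKer F) (hφ : ContDiff ℝ 1 φ) (δ : ℝ) (x v : Fin n → ℝ) :
    kerOp F δ (fun y => δ * fderiv ℝ φ y v) x = kerOp (_root_.dirD (0, v) F) δ φ x := by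
  obtain ⟨R, -, hR⟩ := hF.exists_supp
  have hφ' : Continuous fun y => δ * fderiv ℝ φ y v :=
    continuous_const.mul ((hφ.continuous_fderiv one_ne_zero).clm_apply continuous_const)
  have hc : ContDiff ℝ 1 fun z => F δ (x, z) * φ (x - δ • z) :=
    (((hF.smooth δ).of_le (by simp)).comp (contDiff_const.prodMk contDiff_id)).mul
      (hφ.comp (contDiff_const.sub (contDiff_id.const_smul δ)))
  have h0 := integral_fderiv_eq_zero hc (HasCompactSupport.intro (isCompact_closedBall 0 R)
    fun z hz => by simp [hR δ (x, z) (by simpa using hz)]) v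
  have h : ∀ z, fderiv ℝ (fun z => F δ (x, z) * φ (x - δ • z)) z v =
      _root_.dirD (0, v) F δ (x, z) * φ (x - δ • z) -
        F δ (x, z) * (δ * fderiv ℝ φ (x - δ • z) v) := by
    intro z
    have h1 : HasFDerivAt (fun z : Fin n → ℝ => x - δ • z)
        (-(δ • ContinuousLinearMap.id ℝ _)) z :=
      ((hasFDerivAt_id z).const_smul δ).const_sub x
    have h2 : HasFDerivAt (fun z : Fin n → ℝ => φ (x - δ • z)) _ z :=
      HasFDerivAt.comp z (hφ.differentiable one_ne_zero (x - δ • z)).hasFDerivAt h1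
    have h3 : HasFDerivAt (fun z : Fin n → ℝ => F δ (x, z)) _ z :=
      HasFDerivAt.comp z ((hF.smooth δ).differentiable (by simp) (x, z)).hasFDerivAt
        (hasFDerivAt_prodMk_right x z)
    rw [(h3.fun_mul h2).fderiv]
    simp [_root_.dirD]
    ring
  simp only [h] at h0
  rw [integral_sub ((hF.dirD _).integrable_ker hφ.continuous δ x) (hF.integrable_ker hφ' δ x)]
    at h0
  simp only [kerOp]
  linarith

lemma IsKer.kerOp_add (hF : IsKer F) {ψ : (Fin n → ℝ) → ℝ} (hφ : Continuous φ)
    (hψ : Continuous ψ) (δ : ℝ) (x : Fin n → ℝ) :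
    kerOp F δ (fun y => φ y + ψ y) x = kerOp F δ φ x + kerOp F δ ψ x := by
  simp only [kerOp]
  rw [← integral_add (hF.integrable_ker hφ δ x) (hF.integrable_ker hψ δ x)]
  simp only [mul_add]

lemma IsKer.kerOp_sub (hF : IsKer F) {ψ : (Fin n → ℝ) → ℝ} (hφ : Continuous φ)
    (hψ : Continuous ψ) (δ : ℝ) (x : Fin n → ℝ) :
    kerOp F δ (fun y => φ y - ψ y) x = kerOp F δ φ x - kerOp F δ ψ x := by
  simp only [kerOp]
  rw [← integral_sub (hF.integrable_ker hφ δ x) (hF.integrable_ker hψ δ x)]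
  simp only [mul_sub]

lemma kerOp_const_mul (t : ℝ) (δ : ℝ) (x : Fin n → ℝ) :
    kerOp F δ (fun y => t * φ y) x = t * kerOp F δ φ x := by
  simp only [kerOp, ← integral_const_mul]
  congr 1
  ext z
  ring

lemma IsKer.kerOp_sum (hF : IsKer F) {ι : Type*} (s : Finset ι) {ψ : ι → (Fin n → ℝ) → ℝ}
    (hψ : ∀ i ∈ s, Continuous (ψ i)) (δ : ℝ) (x : Fin n → ℝ) :
    kerOp F δ (fun y => ∑ i ∈ s, ψ i y) x = ∑ i ∈ s, kerOp F δ (ψ i) x := by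
  simp only [kerOp, Finset.mul_sum]
  exact integral_finsetSum _ fun i hi => hF.integrable_ker (hψ i hi) δ x

lemma kerOp_sum_ker {ι : Type*} (s : Finset ι) {F : ι → ℝ → (Fin n → ℝ) × (Fin n → ℝ) → ℝ}
    (hF : ∀ i ∈ s, IsKer (F i)) (hφ : Continuous φ) (δ : ℝ) (x : Fin n → ℝ) :
    kerOp (fun δ p => ∑ i ∈ s, F i δ p) δ φ x = ∑ i ∈ s, kerOp (F i) δ φ x := by
  simp only [kerOp, Finset.sum_mul]
  exact integral_finsetSum _ fun i hi => (hF i hi).integrable_ker hφ δ x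

lemma kerOp_add_ker {F G : ℝ → (Fin n → ℝ) × (Fin n → ℝ) → ℝ}
    (hF : IsKer F) (hG : IsKer G) (hφ : Continuous φ) (δ : ℝ) (x : Fin n → ℝ) :
    kerOp (fun δ p => F δ p + G δ p) δ φ x = kerOp F δ φ x + kerOp G δ φ x := by
  simp only [kerOp, add_mul]
  exact integral_add (hF.integrable_ker hφ δ x) (hG.integrable_ker hφ δ x)

/-- A multiplication operator is absorbed in the kernel. -/
lemma kerOp_mul (a : (Fin n → ℝ) → ℝ) (δ : ℝ) (x : Fin n → ℝ) :
    kerOp F δ (fun y => a y * φ y) x =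
      kerOp (fun δ p => F δ p * a (p.1 - δ • p.2)) δ φ x := by
  simp only [kerOp, mul_assoc]

end SmoothingOperators

section SmoothingOperators

variable {n m : ℕ}

variable {F : ℝ → (Fin n → ℝ) × (Fin n → ℝ) → ℝ} {φ : (Fin n → ℝ) → ℝ}
  {c : (Fin n → ℝ) → (Fin n → ℝ)}

/-- The kernel of `φ ↦ kerOp F δ (δ Xop c φ)`. -/
noncomputable def absorbKer (F : ℝ → (Fin n → ℝ) × (Fin n → ℝ) → ℝ)
    (c : (Fin n → ℝ) → (Fin n → ℝ)) : ℝ → (Fin n → ℝ) × (Fin n → ℝ) → ℝ :=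
  fun δ p => ∑ j, dirD (0, Pi.single j 1) (fun δ p => F δ p * c (p.1 - δ • p.2) j) δ p

/-- The kernel of the commutator of `Xop c` and `kerOp F δ`. -/
noncomputable def commKer (F : ℝ → (Fin n → ℝ) × (Fin n → ℝ) → ℝ)
    (c : (Fin n → ℝ) → (Fin n → ℝ)) : ℝ → (Fin n → ℝ) × (Fin n → ℝ) → ℝ :=
  fun δ p => ∑ j, dirD (Pi.single j 1, 0) F δ p * c p.1 j +
    ∑ j, dirD (0, Pi.single j 1) (fun δ p => F δ p * diffQuot (fun x => c x j) δ p) δ p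

lemma hasCompactSupport_coord (hcs : HasCompactSupport c) (j : Fin n) :
    HasCompactSupport fun x => c x j :=
  hcs.comp_left (g := fun v : Fin n → ℝ => v j) rfl

lemma IsKer.mul_translate (hF : IsKer F) (hc : ContDiff ℝ (⊤ : ℕ∞) c)
    (hcs : HasCompactSupport c) (j : Fin n) :
    IsKer fun δ p => F δ p * c (p.1 - δ • p.2) j :=
  hF.mul (isMult_translate (contDiff_pi.1 hc j) (hasCompactSupport_coord hcs j) (t := id)
    fun δ h0 h1 => by simpa [abs_of_pos h0] using h1)

lemma IsKer.absorbKer (hF : IsKer F) (hc : ContDiff ℝ (⊤ : ℕ∞) c) (hcs : HasCompactSupport c) :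
    IsKer (absorbKer F c) :=
  IsKer.sum _ fun j _ => (hF.mul_translate hc hcs j).dirD _

lemma IsKer.mul_diffQuot (hF : IsKer F) (hc : ContDiff ℝ (⊤ : ℕ∞) c)
    (hcs : HasCompactSupport c) (j : Fin n) :
    IsKer fun δ p => F δ p * diffQuot (fun x => c x j) δ p :=
  hF.mul (isMult_diffQuot (contDiff_pi.1 hc j) (hasCompactSupport_coord hcs j))

lemma IsKer.dirD_mul_fst (hF : IsKer F) (hc : ContDiff ℝ (⊤ : ℕ∞) c)
    (hcs : HasCompactSupport c) (j : Fin n) :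
    IsKer fun δ p => _root_.dirD (Pi.single j 1, 0) F δ p * c p.1 j :=
  (hF.dirD _).mul (isMult_fst (contDiff_pi.1 hc j) (hasCompactSupport_coord hcs j))

lemma IsKer.commKer (hF : IsKer F) (hc : ContDiff ℝ (⊤ : ℕ∞) c) (hcs : HasCompactSupport c) :
    IsKer (commKer F c) :=
  (IsKer.sum _ fun j _ => hF.dirD_mul_fst hc hcs j).add
    (IsKer.sum _ fun j _ => (hF.mul_diffQuot hc hcs j).dirD _)

lemma continuous_fderiv_single (hφ : ContDiff ℝ 1 φ) (v : Fin n → ℝ) :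
    Continuous fun y => fderiv ℝ φ y v :=
  (hφ.continuous_fderiv one_ne_zero).clm_apply continuous_const

lemma IsKer.kerOp_smul_xop (hF : IsKer F) (hc : ContDiff ℝ (⊤ : ℕ∞) c)
    (hcs : HasCompactSupport c) (hφ : ContDiff ℝ 1 φ) (δ : ℝ) (x : Fin n → ℝ) :
    kerOp F δ (fun y => δ * Xop c φ y) x = kerOp (_root_.absorbKer F c) δ φ x := by
  have e : (fun y => δ * Xop c φ y) =
      fun y => ∑ j, c y j * (δ * fderiv ℝ φ y (Pi.single j 1)) := by
    ext y
    rw [xop_eq_sum, Finset.mul_sum]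
    exact Finset.sum_congr rfl fun j _ => by ring
  rw [e, hF.kerOp_sum Finset.univ
    (ψ := fun j y => c y j * (δ * fderiv ℝ φ y (Pi.single j 1)))
    fun j _ => (contDiff_pi.1 hc j).continuous.mul
      (continuous_const.mul (continuous_fderiv_single hφ _))]
  unfold _root_.absorbKer
  rw [kerOp_sum_ker _ (fun j _ => (hF.mul_translate hc hcs j).dirD _) hφ.continuous]
  refine Finset.sum_congr rfl fun j _ => ?_
  rw [kerOp_mul (fun y => c y j), (hF.mul_translate hc hcs j).kerOp_smul_fderiv hφ]

lemma IsKer.xop_kerOp (hF : IsKer F) (hc : ContDiff ℝ (⊤ : ℕ∞) c)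
    (hcs : HasCompactSupport c) (hφ : ContDiff ℝ 1 φ) {δ : ℝ} (hδ : δ ≠ 0) (x : Fin n → ℝ) :
    Xop c (kerOp F δ φ) x = kerOp F δ (Xop c φ) x + kerOp (_root_.commKer F c) δ φ x := by
  have e : Xop c φ = fun y => ∑ j, c y j * fderiv ℝ φ y (Pi.single j 1) := by
    ext y
    exact xop_eq_sum _ _ _
  rw [e, hF.kerOp_sum Finset.univ (ψ := fun j y => c y j * fderiv ℝ φ y (Pi.single j 1))
    fun j _ => (contDiff_pi.1 hc j).continuous.mul (continuous_fderiv_single hφ _)]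
  unfold _root_.commKer
  rw [kerOp_add_ker (IsKer.sum _ fun j _ => hF.dirD_mul_fst hc hcs j)
    (IsKer.sum _ fun j _ => (hF.mul_diffQuot hc hcs j).dirD _) hφ.continuous,
    kerOp_sum_ker _ (fun j _ => hF.dirD_mul_fst hc hcs j) hφ.continuous,
    kerOp_sum_ker _ (fun j _ => (hF.mul_diffQuot hc hcs j).dirD _) hφ.continuous,
    ← Finset.sum_add_distrib, ← Finset.sum_add_distrib, xop_eq_sum]
  refine Finset.sum_congr rfl fun j _ => ?_
  rw [hF.fderiv_kerOp hφ, ← (hF.mul_diffQuot hc hcs j).kerOp_smul_fderiv hφ,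
    kerOp_mul (fun y => c y j)]
  have i1 := (hF.mul_translate hc hcs j).integrable_ker (continuous_fderiv_single hφ
    (Pi.single j 1)) δ x
  have i2 := (hF.mul_diffQuot hc hcs j).integrable_ker 
    (φ := fun y => δ * fderiv ℝ φ y (Pi.single j 1)) (continuous_const.mul
      (continuous_fderiv_single hφ (Pi.single j 1))) δ x
  have h1 : c x j * kerOp (_root_.dirD (Pi.single j 1, 0) F) δ φ x =
      kerOp (fun δ p => _root_.dirD (Pi.single j 1, 0) F δ p * c p.1 j) δ φ x := by
    simp only [kerOp, ← integral_const_mul]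
    congr 1
    ext z
    ring
  have h2 : c x j * kerOp F δ (fun y => fderiv ℝ φ y (Pi.single j 1)) x =
      kerOp (fun δ p => F δ p * c (p.1 - δ • p.2) j) δ (fun y => fderiv ℝ φ y (Pi.single j 1)) x +
      kerOp (fun δ p => F δ p * diffQuot (fun x => c x j) δ p) δ
        (fun y => δ * fderiv ℝ φ y (Pi.single j 1)) x := by
    simp only [kerOp, ← integral_const_mul]
    rw [← integral_add i1 i2]
    congr 1
    ext z
    simp only [diffQuot]
    field_simp
    ring
  rw [mul_add, h1, h2]
  ring

lemma integral_sq_translate (φ : (Fin n → ℝ) → ℝ) (v : Fin n → ℝ) :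
    ∫ x, φ (x - v) ^ 2 = ∫ x, φ x ^ 2 :=
  integral_sub_right_eq_self (fun x => φ x ^ 2) v

lemma integral_integral_mul_translate {χ φ : (Fin n → ℝ) → ℝ} (hχ : Continuous χ)
    (hχs : HasCompactSupport χ) (hφ : Continuous φ) (hs : HasCompactSupport φ) (δ : ℝ) :
    (Integrable fun x => ∫ z, χ z ^ 2 * φ (x - δ • z) ^ 2) ∧
      ∫ x, ∫ z, χ z ^ 2 * φ (x - δ • z) ^ 2 = (∫ z, χ z ^ 2) * ∫ x, φ x ^ 2 := by
  have hcont : Continuous (Function.uncurry fun x z : Fin n → ℝ => χ z ^ 2 * φ (x - δ • z) ^ 2) :=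
    ((hχ.comp continuous_snd).pow 2).mul ((hφ.comp
      (continuous_fst.sub (continuous_snd.const_smul δ))).pow 2)
  have hcs : HasCompactSupport
      (Function.uncurry fun x z : Fin n → ℝ => χ z ^ 2 * φ (x - δ • z) ^ 2) := by
    refine HasCompactSupport.intro (((hs.isCompact.prod hχs.isCompact).image
      (f := fun p : (Fin n → ℝ) × (Fin n → ℝ) => (p.1 + δ • p.2, p.2)) (by fun_prop)))
      fun p hp => ?_
    by_contra h
    simp only [Function.uncurry, mul_eq_zero, not_or] at h
    refine hp ⟨(p.1 - δ • p.2, p.2), ⟨subset_tsupport _ ?_, subset_tsupport _ ?_⟩, by simp⟩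
    · exact fun h0 => h.2 (by simp [h0])
    · exact fun h0 => h.1 (by simp [h0])
  have hswap := integral_integral_swap_of_hasCompactSupport (μ := (volume : Measure (Fin n → ℝ)))
    (ν := (volume : Measure (Fin n → ℝ))) hcont hcs
  refine ⟨(hcont.integrable_of_hasCompactSupport hcs).integral_prod_left, ?_⟩
  rw [hswap, ← integral_mul_const]
  congr 1
  ext z
  rw [integral_const_mul, integral_sq_translate]

lemma exists_smooth_cutoff_ball {R : ℝ} (hR : 0 ≤ R) : ∃ χ : (Fin n → ℝ) → ℝ,
    ContDiff ℝ (⊤ : ℕ∞) χ ∧ HasCompactSupport χ ∧ (∀ z, ‖z‖ ≤ R → χ z = 1) ∧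
      ∀ z, 0 ≤ χ z ∧ χ z ≤ 1 := by
  have χ : ∃ χ : ContDiffBump (0 : Fin n → ℝ), χ.rIn = R + 1 :=
    ⟨⟨R + 1, R + 2, by linarith, by linarith⟩, rfl⟩
  obtain ⟨χ, hχ⟩ := χ
  refine ⟨χ, χ.contDiff, χ.hasCompactSupport, fun z hz => χ.one_of_mem_closedBall ?_,
    fun z => ⟨χ.nonneg, χ.le_one⟩⟩
  rw [Metric.mem_closedBall, dist_zero_right, hχ]
  linarith

lemma hasCompactSupport_sq {f : (Fin n → ℝ) → ℝ} (hs : HasCompactSupport f) :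
    HasCompactSupport fun x => f x ^ 2 :=
  hs.mono fun x hx h => hx (by simp [h])

lemma integrable_sq {f : (Fin n → ℝ) → ℝ} (hf : Continuous f) (hs : HasCompactSupport f) :
    Integrable fun x => f x ^ 2 :=
  Continuous.integrable_of_hasCompactSupport (by fun_prop) (hasCompactSupport_sq hs)

/-- Uniform `L²` boundedness. -/
lemma IsKer.integral_sq_kerOp_le (hF : IsKer F) : ∃ C : ℝ, 0 ≤ C ∧ ∀ δ, 0 < δ → δ ≤ 1 →
    ∀ φ : (Fin n → ℝ) → ℝ, Continuous φ → HasCompactSupport φ →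
      ∫ x, kerOp F δ φ x ^ 2 ≤ C * ∫ x, φ x ^ 2 := by
  obtain ⟨R, hR0, hR⟩ := hF.exists_supp
  obtain ⟨M, hM⟩ := (hF.bdd 0).zero R
  obtain ⟨χ, hχ, hχs, hχ1, -⟩ := exists_smooth_cutoff_ball (n := n) hR0
  have hχc := hχ.continuous
  have hint2 : Integrable fun z => χ z ^ 2 := integrable_sq hχc hχs
  refine ⟨(M ^ 2 * ∫ z, χ z ^ 2) * ∫ z, χ z ^ 2, ?_, fun δ h0 h1 φ hφ hs => ?_⟩
  · have := integral_nonneg (μ := volume) (f := fun z => χ z ^ 2) fun z => sq_nonneg _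
    positivity
  have hpt : ∀ x, kerOp F δ φ x ^ 2 ≤
      (M ^ 2 * ∫ z, χ z ^ 2) * ∫ z, χ z ^ 2 * φ (x - δ • z) ^ 2 := by
    intro x
    have hf : Continuous fun z => F δ (x, z) :=
      (hF.smooth δ).continuous.comp (Continuous.prodMk_right x)
    have hfs : HasCompactSupport fun z => F δ (x, z) :=
      HasCompactSupport.intro (isCompact_closedBall 0 R) fun z hz => hR _ _ (by simpa using hz)
    have hg : Continuous fun z => χ z * φ (x - δ • z) :=
      hχc.mul (hφ.comp (continuous_const.sub (continuous_id.const_smul δ)))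
    have hgs : HasCompactSupport fun z => χ z * φ (x - δ • z) := hχs.mul_right
    have h := integral_mul_sq_le hf hg hfs hgs
    have e : kerOp F δ φ x = ∫ z, F δ (x, z) * (χ z * φ (x - δ • z)) := by
      refine integral_congr_ae (Eventually.of_forall fun z => ?_)
      by_cases hz : R < ‖z‖
      · simp [hR δ (x, z) hz]
      · simp [hχ1 z (not_lt.1 hz)]
    have h2 : ∫ z, F δ (x, z) ^ 2 ≤ M ^ 2 * ∫ z, χ z ^ 2 := by
      rw [← integral_const_mul]
      refine integral_mono_of_nonneg (Eventually.of_forall fun z => sq_nonneg _)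
        (hint2.const_mul _) (Eventually.of_forall fun z => ?_)
      by_cases hz : R < ‖z‖
      · simp [hR δ (x, z) hz]
        positivity
      · have := hM δ h0 h1 (x, z) (not_lt.1 hz)
        simp only [hχ1 z (not_lt.1 hz), one_pow, mul_one]
        exact sq_le_sq' (by linarith [abs_le.1 this]) (abs_le.1 this).2
    rw [e, ← sq_abs]
    calc _ ≤ (Real.sqrt (∫ z, F δ (x, z) ^ 2) *
          Real.sqrt (∫ z, (χ z * φ (x - δ • z)) ^ 2)) ^ 2 := by gcongr
      _ = (∫ z, F δ (x, z) ^ 2) * ∫ z, (χ z * φ (x - δ • z)) ^ 2 := by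
        rw [mul_pow, Real.sq_sqrt (integral_nonneg fun z => sq_nonneg _),
          Real.sq_sqrt (integral_nonneg fun z => sq_nonneg _)]
      _ ≤ _ := by
        simp only [mul_pow]
        gcongr
  obtain ⟨hInt, hswap⟩ := integral_integral_mul_translate hχc hχs hφ hs δ
  calc ∫ x, kerOp F δ φ x ^ 2
      ≤ ∫ x, (M ^ 2 * ∫ z, χ z ^ 2) * ∫ z, χ z ^ 2 * φ (x - δ • z) ^ 2 :=
        integral_mono_of_nonneg (Eventually.of_forall fun z => sq_nonneg _)
          (hInt.const_mul _) (Eventually.of_forall hpt)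
    _ = _ := by rw [integral_const_mul, hswap, mul_assoc, mul_assoc, mul_assoc]

end SmoothingOperators

section SubellipticEstimate

variable {n m : ℕ}

/-- The `L²` norm. -/
noncomputable def nrm (f : (Fin n → ℝ) → ℝ) : ℝ := Real.sqrt (∫ x, f x ^ 2)

variable {f g φ : (Fin n → ℝ) → ℝ}

lemma nrm_nonneg (f : (Fin n → ℝ) → ℝ) : 0 ≤ nrm f := Real.sqrt_nonneg _

lemma nrm_sq (f : (Fin n → ℝ) → ℝ) : nrm f ^ 2 = ∫ x, f x ^ 2 :=
  Real.sq_sqrt (integral_nonneg fun _ => sq_nonneg _)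

lemma nrm_le {f : (Fin n → ℝ) → ℝ} {t : ℝ} (ht : 0 ≤ t) (h : ∫ x, f x ^ 2 ≤ t ^ 2) : nrm f ≤ t :=
  Real.sqrt_le_iff.2 ⟨ht, h⟩

lemma nrm_const_mul (t : ℝ) (f : (Fin n → ℝ) → ℝ) : nrm (fun x => t * f x) = |t| * nrm f := by
  simp only [nrm, mul_pow, integral_const_mul]
  rw [Real.sqrt_mul (sq_nonneg t), Real.sqrt_sq_eq_abs]

lemma integrable_mul_cpt (hf : Continuous f) (hg : Continuous g) (hfs : HasCompactSupport f) :
    Integrable fun x => f x * g x :=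
  (hf.mul hg).integrable_of_hasCompactSupport hfs.mul_right

lemma nrm_add_le (hf : Continuous f) (hg : Continuous g) (hfs : HasCompactSupport f)
    (hgs : HasCompactSupport g) : nrm (fun x => f x + g x) ≤ nrm f + nrm g := by
  refine nrm_le (add_nonneg (nrm_nonneg f) (nrm_nonneg g)) ?_
  have e : (fun x => (f x + g x) ^ 2) = fun x => f x ^ 2 + (2 * (f x * g x) + g x ^ 2) := by
    ext x
    ring
  have i1 := integrable_mul_cpt hf hg hfs
  have i2 : Integrable fun x => 2 * (f x * g x) + g x ^ 2 :=
    (i1.const_mul 2).add (integrable_sq hg hgs)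
  rw [e, integral_add (integrable_sq hf hfs) i2, integral_add (i1.const_mul 2) (integrable_sq hg hgs), integral_const_mul, ← nrm_sq, ← nrm_sq]
  have : |∫ x, f x * g x| ≤ nrm f * nrm g := integral_mul_sq_le hf hg hfs hgs
  nlinarith [le_abs_self (∫ x, f x * g x)]

lemma nrm_sub_le (hf : Continuous f) (hg : Continuous g) (hfs : HasCompactSupport f)
    (hgs : HasCompactSupport g) : nrm (fun x => f x - g x) ≤ nrm f + nrm g := by
  have h := nrm_add_le hf hg.neg hfs hgs.neg
  have e : nrm (fun x => (-g) x) = nrm g := by simp [nrm]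
  have e2 : (fun x => f x - g x) = fun x => f x + (-g) x := by
    ext x
    simp [sub_eq_add_neg]
  rw [e2]
  exact h.trans (by rw [show nrm (-g) = nrm g from e])

lemma nrm_mul_le {a : (Fin n → ℝ) → ℝ} {D : ℝ} (hD : ∀ x, |a x| ≤ D) (hf : Continuous f)
    (hfs : HasCompactSupport f) : nrm (fun x => a x * f x) ≤ D * nrm f := by
  have hD0 : 0 ≤ D := (abs_nonneg _).trans (hD 0)
  refine nrm_le (mul_nonneg hD0 (nrm_nonneg f)) ?_
  rw [mul_pow, nrm_sq, ← integral_const_mul]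
  refine integral_mono_of_nonneg (Eventually.of_forall fun x => sq_nonneg _)
    ((integrable_sq hf hfs).const_mul _) (Eventually.of_forall fun x => ?_)
  simp only [mul_pow]
  have := pow_le_pow_left₀ (abs_nonneg _) (hD x) 2
  rw [sq_abs] at this
  gcongr

lemma IsKer.nrm_kerOp_le {F : ℝ → (Fin n → ℝ) × (Fin n → ℝ) → ℝ} (hF : IsKer F) :
    ∃ C : ℝ, 0 ≤ C ∧ ∀ δ, 0 < δ → δ ≤ 1 →
      ∀ φ : (Fin n → ℝ) → ℝ, Continuous φ → HasCompactSupport φ →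
        nrm (kerOp F δ φ) ≤ C * nrm φ := by
  obtain ⟨C, hC0, hC⟩ := hF.integral_sq_kerOp_le
  refine ⟨Real.sqrt C, Real.sqrt_nonneg _, fun δ h0 h1 φ hφ hs => ?_⟩
  refine nrm_le (mul_nonneg (Real.sqrt_nonneg _) (nrm_nonneg φ)) ?_
  rw [mul_pow, Real.sq_sqrt hC0, nrm_sq]
  exact hC δ h0 h1 φ hφ hs

/-- Cauchy–Schwarz after an integration by parts. -/
lemma exists_abs_integral_xop_mul_le {c : (Fin n → ℝ) → (Fin n → ℝ)}
    (hc : ContDiff ℝ (⊤ : ℕ∞) c) (hcs : HasCompactSupport c) :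
    ∃ D : ℝ, 0 ≤ D ∧ ∀ A w : (Fin n → ℝ) → ℝ, ContDiff ℝ 1 A → ContDiff ℝ 1 w →
      HasCompactSupport A → HasCompactSupport w →
      |∫ x, Xop c A x * w x| ≤ nrm A * nrm (Xop c w) + D * (nrm A * nrm w) := by
  have hdc : Continuous (divf c) := (contDiff_divf (k := 0) (hc.of_le (by simp))).continuous
  have hds : HasCompactSupport (divf c) := by
    refine (hcs.fderiv (𝕜 := ℝ)).mono fun x hx => ?_
    contrapose! hx
    simp only [Function.mem_support, not_not] at hx ⊢
    unfold divf
    refine Finset.sum_eq_zero fun j _ => ?_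
    rw [fderiv_apply ((hc.differentiable (by simp)) x), hx]
    simp
  obtain ⟨D, hD⟩ := exists_bound_of_hasCompactSupport hdc hds
  have hD0 : 0 ≤ D := (abs_nonneg _).trans (hD 0)
  refine ⟨D, hD0, fun A w hA hw hAs hws => ?_⟩
  have hXw : Continuous (Xop c w) :=
    (contDiff_xop (k := 0) (hc.of_le (by simp)) hw (by simp)).continuous
  have e : (fun x => divf c x * (A x * w x)) = fun x => A x * (divf c x * w x) := by
    ext x
    ring
  rw [integral_xop_mul (hc.of_le (by simp)) hA hw hws, e]
  have h1 : |∫ x, A x * Xop c w x| ≤ nrm A * nrm (Xop c w) :=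
    integral_mul_sq_le hA.continuous hXw hAs (hasCompactSupport_xop c hws)
  have h2 : |∫ x, A x * (divf c x * w x)| ≤ nrm A * nrm (fun x => divf c x * w x) :=
    integral_mul_sq_le hA.continuous (hdc.mul hw.continuous) hAs hws.mul_left
  have h3 := mul_le_mul_of_nonneg_left (nrm_mul_le hD hw.continuous hws) (nrm_nonneg A)
  calc _ ≤ |∫ x, A x * Xop c w x| + |∫ x, A x * (divf c x * w x)| := by
        rw [← abs_neg (∫ x, A x * Xop c w x)]
        exact abs_sub _ _
    _ ≤ _ := by linarith

/-- The first order subelliptic norm. -/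
noncomputable def xnrm (b : Fin m → (Fin n → ℝ) → (Fin n → ℝ)) (φ : (Fin n → ℝ) → ℝ) : ℝ :=
  Real.sqrt ((∫ x, φ x ^ 2) + ∑ i, ∫ x, Xop (b i) φ x ^ 2)

lemma xnrm_nonneg (b : Fin m → (Fin n → ℝ) → (Fin n → ℝ)) (φ : (Fin n → ℝ) → ℝ) :
    0 ≤ xnrm b φ := Real.sqrt_nonneg _

lemma nrm_le_xnrm (b : Fin m → (Fin n → ℝ) → (Fin n → ℝ)) (φ : (Fin n → ℝ) → ℝ) :
    nrm φ ≤ xnrm b φ :=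
  Real.sqrt_le_sqrt (le_add_of_nonneg_right (Finset.sum_nonneg fun _ _ =>
    integral_nonneg fun _ => sq_nonneg _))

lemma nrm_xop_le_xnrm (b : Fin m → (Fin n → ℝ) → (Fin n → ℝ)) (φ : (Fin n → ℝ) → ℝ) (i : Fin m) :
    nrm (Xop (b i) φ) ≤ xnrm b φ := by
  refine Real.sqrt_le_sqrt ?_
  have h1 : (0 : ℝ) ≤ ∫ x, φ x ^ 2 := integral_nonneg fun _ => sq_nonneg _
  have h2 := Finset.single_le_sum (f := fun i => ∫ x, Xop (b i) φ x ^ 2)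
    (fun i _ => integral_nonneg fun _ => sq_nonneg _) (Finset.mem_univ i)
  linarith

/-- The field `Y` gains a positive power of `δ` against every kernel family. -/
def GainField (b : Fin m → (Fin n → ℝ) → (Fin n → ℝ)) (Y : (Fin n → ℝ) → (Fin n → ℝ)) : Prop :=
  ∃ s : ℝ, 0 < s ∧ s ≤ 1 ∧ ∀ F, IsKer F → ∃ C : ℝ, 0 ≤ C ∧ ∀ δ, 0 < δ → δ ≤ 1 →
    ∀ φ : (Fin n → ℝ) → ℝ, ContDiff ℝ 2 φ → HasCompactSupport φ →
      nrm (kerOp F δ (fun y => δ * Xop Y φ y)) ≤ C * (δ ^ s * xnrm b φ)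

lemma gainField_base {b : Fin m → (Fin n → ℝ) → (Fin n → ℝ)}
    (hb : ∀ i, ContDiff ℝ (⊤ : ℕ∞) (b i)) (i : Fin m) : GainField b (b i) := by
  refine ⟨1, one_pos, le_rfl, fun F hF => ?_⟩
  obtain ⟨C, hC0, hC⟩ := hF.nrm_kerOp_le
  refine ⟨C, hC0, fun δ h0 h1 φ hφ hs => ?_⟩
  have e : kerOp F δ (fun y => δ * Xop (b i) φ y) = fun x => δ * kerOp F δ (Xop (b i) φ) x := by
    ext x
    exact kerOp_const_mul _ _ _
  have h := hC δ h0 h1 (Xop (b i) φ)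
    (contDiff_xop (k := 0) ((hb i).of_le (by simp)) hφ (by norm_num)).continuous
    (hasCompactSupport_xop _ hs)
  have h2 := nrm_xop_le_xnrm b φ i
  rw [e, nrm_const_mul, abs_of_pos h0, Real.rpow_one]
  calc _ ≤ δ * (C * xnrm b φ) := by gcongr; exact h.trans (by gcongr)
    _ = _ := by ring

lemma contDiff_vfBracket {c d : (Fin n → ℝ) → (Fin n → ℝ)} (hc : ContDiff ℝ (⊤ : ℕ∞) c)
    (hd : ContDiff ℝ (⊤ : ℕ∞) d) : ContDiff ℝ (⊤ : ℕ∞) (vfBracket c d) := by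
  refine contDiff_pi.2 fun l => ?_
  exact (((contDiff_pi.1 hd l).fderiv_right (by simp)).clm_apply hc).sub
    (((contDiff_pi.1 hc l).fderiv_right (by simp)).clm_apply hd)

lemma hasCompactSupport_vfBracket {c d : (Fin n → ℝ) → (Fin n → ℝ)}
    (hc : ContDiff ℝ (⊤ : ℕ∞) c) (hcs : HasCompactSupport c) :
    HasCompactSupport (vfBracket c d) := by
  refine HasCompactSupport.intro hcs.isCompact fun x hx => ?_
  have h0 : c x = 0 := image_eq_zero_of_notMem_tsupport hx
  have h1 : fderiv ℝ c x = 0 := by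
    by_contra h
    exact hx (tsupport_fderiv_subset ℝ (subset_tsupport _ h))
  ext l
  simp only [vfBracket, h0, map_zero, zero_sub, Pi.zero_apply]
  rw [fderiv_apply (hc.differentiable (by simp) x), h1]
  simp

lemma GainField.sub {b : Fin m → (Fin n → ℝ) → (Fin n → ℝ)} {Y Z : (Fin n → ℝ) → (Fin n → ℝ)}
    (hY : ContDiff ℝ (⊤ : ℕ∞) Y) (hZ : ContDiff ℝ (⊤ : ℕ∞) Z)
    (gY : GainField b Y) (gZ : GainField b Z) : GainField b (fun x => Y x - Z x) := by
  obtain ⟨s, hs0, hs1, hs⟩ := gY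
  obtain ⟨t, ht0, ht1, ht⟩ := gZ
  refine ⟨min s t, lt_min hs0 ht0, (min_le_left _ _).trans hs1, fun F hF => ?_⟩
  obtain ⟨C, hC0, hC⟩ := hs F hF
  obtain ⟨D, hD0, hD⟩ := ht F hF
  refine ⟨C + D, add_nonneg hC0 hD0, fun δ h0 h1 φ hφ hφs => ?_⟩
  have hYφ : Continuous fun y => δ * Xop Y φ y := continuous_const.mul
    (contDiff_xop (k := 0) (hY.of_le (by simp)) hφ (by norm_num)).continuous
  have hZφ : Continuous fun y => δ * Xop Z φ y := continuous_const.mul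
    (contDiff_xop (k := 0) (hZ.of_le (by simp)) hφ (by norm_num)).continuous
  have e : kerOp F δ (fun y => δ * Xop (fun x => Y x - Z x) φ y) =
      fun x => kerOp F δ (fun y => δ * Xop Y φ y) x - kerOp F δ (fun y => δ * Xop Z φ y) x := by
    ext x
    rw [← hF.kerOp_sub hYφ hZφ]
    congr 1
    ext y
    simp [Xop, mul_sub]
  have sY : HasCompactSupport fun y => δ * Xop Y φ y := (hasCompactSupport_xop Y hφs).mul_left
  have sZ : HasCompactSupport fun y => δ * Xop Z φ y := (hasCompactSupport_xop Z hφs).mul_left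
  rw [e]
  refine (nrm_sub_le (hF.continuous_kerOp hYφ δ) (hF.continuous_kerOp hZφ δ)
    (hF.hasCompactSupport_kerOp sY δ) (hF.hasCompactSupport_kerOp sZ δ)).trans ?_
  have r1 : δ ^ s ≤ δ ^ min s t := Real.rpow_le_rpow_of_exponent_ge h0 h1 (min_le_left _ _)
  have r2 : δ ^ t ≤ δ ^ min s t := Real.rpow_le_rpow_of_exponent_ge h0 h1 (min_le_right _ _)
  have hN := xnrm_nonneg b φ
  calc _ ≤ C * (δ ^ s * xnrm b φ) + D * (δ ^ t * xnrm b φ) :=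
        add_le_add (hC δ h0 h1 φ hφ hφs) (hD δ h0 h1 φ hφ hφs)
    _ ≤ C * (δ ^ min s t * xnrm b φ) + D * (δ ^ min s t * xnrm b φ) := by gcongr
    _ = _ := by ring

lemma gainField_bracket {b : Fin m → (Fin n → ℝ) → (Fin n → ℝ)}
    (hb : ∀ i, ContDiff ℝ (⊤ : ℕ∞) (b i)) (hbs : ∀ i, HasCompactSupport (b i)) (i : Fin m)
    {Y : (Fin n → ℝ) → (Fin n → ℝ)} (hY : ContDiff ℝ (⊤ : ℕ∞) Y) (hYs : HasCompactSupport Y)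
    (gY : GainField b Y) : GainField b (vfBracket (b i) Y) := by
  obtain ⟨s, hs0, hs1, hs⟩ := gY
  refine ⟨s / 2, by linarith, by linarith, fun F hF => ?_⟩
  have hX := hb i
  have hXs := hbs i
  have hZ := contDiff_vfBracket hX hY
  have hZs : HasCompactSupport (vfBracket (b i) Y) := hasCompactSupport_vfBracket hX hXs
  have hG := hF.absorbKer hZ hZs
  set G := absorbKer F (vfBracket (b i) Y) with hGdef
  obtain ⟨C1, hC10, hC1⟩ := hs F hF
  obtain ⟨C1', hC1'0, hC1'⟩ := hs (commKer F (b i)) (hF.commKer hX hXs)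
  obtain ⟨C2, hC20, hC2⟩ := hs G hG
  obtain ⟨BF, hBF0, hBF⟩ := hF.nrm_kerOp_le
  obtain ⟨BG, hBG0, hBG⟩ := hG.nrm_kerOp_le
  obtain ⟨BG', hBG'0, hBG'⟩ := (hG.commKer hX hXs).nrm_kerOp_le
  obtain ⟨BF2, hBF20, hBF2⟩ := (hF.commKer hY hYs).nrm_kerOp_le
  obtain ⟨BG2, hBG20, hBG2⟩ := (hG.commKer hY hYs).nrm_kerOp_le
  obtain ⟨DX, hDX0, hDX⟩ := exists_abs_integral_xop_mul_le hX hXs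
  obtain ⟨DY, hDY0, hDY⟩ := exists_abs_integral_xop_mul_le hY hYs
  set K := C1 * (BG + BG') + DX * (C1 * BG) + C1' * BG + BF * (C2 + BG2) + DY * (BF * BG) +
    BF2 * BG with hK
  have hK0 : 0 ≤ K := by positivity
  refine ⟨Real.sqrt K, Real.sqrt_nonneg _, fun δ h0 h1 φ hφ hφs => ?_⟩
  set N := xnrm b φ with hN
  have hN0 : 0 ≤ N := xnrm_nonneg b φ
  have hφ1 : ContDiff ℝ 1 φ := hφ.of_le (by norm_num)
  have hNφ : nrm φ ≤ N := nrm_le_xnrm b φ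
  have hNX : nrm (Xop (b i) φ) ≤ N := nrm_xop_le_xnrm b φ i
  have cX : ContDiff ℝ 1 (Xop (b i) φ) := contDiff_xop (hX.of_le (by simp)) hφ (by norm_num)
  have cY : ContDiff ℝ 1 (Xop Y φ) := contDiff_xop (hY.of_le (by simp)) hφ (by norm_num)
  have sX := hasCompactSupport_xop (b i) hφs
  have sY := hasCompactSupport_xop Y hφs
  have cψ : ContDiff ℝ 1 fun y => δ * Xop Y φ y := contDiff_const.mul cY
  have sψ : HasCompactSupport fun y => δ * Xop Y φ y := sY.mul_left
  -- the quantity to be estimated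
  set w := kerOp G δ φ with hw
  have hwe : kerOp F δ (fun y => δ * Xop (vfBracket (b i) Y) φ y) = w := by
    ext x
    exact hF.kerOp_smul_xop hZ hZs hφ1 δ x
  have cw : ContDiff ℝ 1 w := hG.contDiff_kerOp hφ1 δ
  have sw : HasCompactSupport w := hG.hasCompactSupport_kerOp hφs δ
  set A := kerOp F δ (fun y => δ * Xop Y φ y) with hA
  have cA : ContDiff ℝ 1 A := hF.contDiff_kerOp cψ δ
  have sA : HasCompactSupport A := hF.hasCompactSupport_kerOp sψ δ
  set A' := kerOp (commKer F (b i)) δ (fun y => δ * Xop Y φ y) with hA'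
  have cA' : Continuous A' := (hF.commKer hX hXs).continuous_kerOp cψ.continuous δ
  have sA' : HasCompactSupport A' := (hF.commKer hX hXs).hasCompactSupport_kerOp sψ δ
  set B := kerOp F δ (Xop (b i) φ) with hB
  have cB : ContDiff ℝ 1 B := hF.contDiff_kerOp cX δ
  have sB : HasCompactSupport B := hF.hasCompactSupport_kerOp sX δ
  set B' := kerOp (commKer F Y) δ (Xop (b i) φ) with hB'
  have cB' : Continuous B' := (hF.commKer hY hYs).continuous_kerOp cX.continuous δ
  have sB' : HasCompactSupport B' := (hF.commKer hY hYs).hasCompactSupport_kerOp sX δ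
  have cXA : Continuous (Xop (b i) A) :=
    (contDiff_xop (k := 0) (hX.of_le (by simp)) cA (by simp)).continuous
  have cYB : Continuous (Xop Y B) :=
    (contDiff_xop (k := 0) (hY.of_le (by simp)) cB (by simp)).continuous
  have sXA := hasCompactSupport_xop (b i) sA
  have sYB := hasCompactSupport_xop Y sB
  have hsplit : ∀ x, w x = Xop (b i) A x - A' x - δ * (Xop Y B x - B' x) := by
    intro x
    have e1 := hF.xop_kerOp hX hXs cψ h0.ne' x
    have e2 := hF.xop_kerOp hY hYs cX h0.ne' x
    have e3 : Xop (b i) (fun y => δ * Xop Y φ y) = fun y => δ * Xop (b i) (Xop Y φ) y := by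
      ext y
      change fderiv ℝ (fun z => δ * Xop Y φ z) y (b i y) = _
      rw [fderiv_const_mul ((cY.differentiable one_ne_zero) y)]
      rfl
    have e4 : kerOp F δ (fun y => δ * Xop Y (Xop (b i) φ) y) x =
        δ * kerOp F δ (Xop Y (Xop (b i) φ)) x := kerOp_const_mul _ _ _
    have e5 : kerOp F δ (fun y => δ * Xop (vfBracket (b i) Y) φ y) x =
        kerOp F δ (fun y => δ * Xop (b i) (Xop Y φ) y) x -
          kerOp F δ (fun y => δ * Xop Y (Xop (b i) φ) y) x := by
      rw [← hF.kerOp_sub (φ := fun y => δ * Xop (b i) (Xop Y φ) y)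
        (ψ := fun y => δ * Xop Y (Xop (b i) φ) y) (continuous_const.mul
        (contDiff_xop (k := 0) (hX.of_le (by simp)) cY (by simp)).continuous)
        (continuous_const.mul (contDiff_xop (k := 0) (hY.of_le (by simp)) cX (by simp)).continuous)]
      congr 1
      ext y
      rw [← mul_sub, xop_comm (hX.differentiable (by simp) y) (hY.differentiable (by simp) y)
        hφ.contDiffAt]
    rw [← hwe, e5, e4, ← e3]
    rw [← hA, ← hA'] at e1
    rw [← hB, ← hB'] at e2
    linear_combination -e1 + δ * e2
  have nA : nrm A ≤ C1 * (δ ^ s * N) := hC1 δ h0 h1 φ hφ hφs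
  have nA' : nrm A' ≤ C1' * (δ ^ s * N) := hC1' δ h0 h1 φ hφ hφs
  have nB : nrm B ≤ BF * N :=
    (hBF δ h0 h1 _ cX.continuous sX).trans (by gcongr)
  have nB' : nrm B' ≤ BF2 * N :=
    (hBF2 δ h0 h1 _ cX.continuous sX).trans (by gcongr)
  have nw : nrm w ≤ BG * N := (hBG δ h0 h1 _ hφ1.continuous hφs).trans (by gcongr)
  have nXw : nrm (Xop (b i) w) ≤ (BG + BG') * N := by
    have e : Xop (b i) w = fun x => kerOp G δ (Xop (b i) φ) x + kerOp (commKer G (b i)) δ φ x := by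
      ext x
      exact hG.xop_kerOp hX hXs hφ1 h0.ne' x
    rw [e]
    refine (nrm_add_le (hG.continuous_kerOp cX.continuous δ)
      ((hG.commKer hX hXs).continuous_kerOp hφ1.continuous δ) (hG.hasCompactSupport_kerOp sX δ)
      ((hG.commKer hX hXs).hasCompactSupport_kerOp hφs δ)).trans ?_
    rw [add_mul]
    exact add_le_add ((hBG δ h0 h1 _ cX.continuous sX).trans (by gcongr))
      ((hBG' δ h0 h1 _ hφ1.continuous hφs).trans (by gcongr))
  have hδs : δ ≤ δ ^ s := by
    simpa using Real.rpow_le_rpow_of_exponent_ge h0 h1 hs1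
  have nYw : δ * nrm (Xop Y w) ≤ (C2 + BG2) * (δ ^ s * N) := by
    have e : (fun x => δ * Xop Y w x) = fun x => kerOp G δ (fun y => δ * Xop Y φ y) x +
        δ * kerOp (commKer G Y) δ φ x := by
      ext x
      rw [kerOp_const_mul, ← mul_add, ← hG.xop_kerOp hY hYs hφ1 h0.ne' x]
    have e' : δ * nrm (Xop Y w) = nrm fun x => δ * Xop Y w x := by
      rw [nrm_const_mul, abs_of_pos h0]
    rw [e', e]
    refine (nrm_add_le (g := fun x => δ * kerOp (commKer G Y) δ φ x)
      (hG.continuous_kerOp cψ.continuous δ) (continuous_const.mul ((hG.commKer hY hYs).continuous_kerOp hφ1.continuous δ))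
      (hG.hasCompactSupport_kerOp sψ δ)
      (((hG.commKer hY hYs).hasCompactSupport_kerOp hφs δ).mul_left)).trans ?_
    rw [nrm_const_mul, abs_of_pos h0, add_mul]
    refine add_le_add (hC2 δ h0 h1 φ hφ hφs) ?_
    calc _ ≤ δ * (BG2 * nrm φ) := by gcongr; exact hBG2 δ h0 h1 _ hφ1.continuous hφs
      _ ≤ δ ^ s * (BG2 * N) := by
          have := nrm_nonneg φ
          gcongr
      _ = _ := by ring
  have I1 := hDX A w cA cw sA sw
  have I2 := hDY B w cB cw sB sw
  have I3 : |∫ x, A' x * w x| ≤ nrm A' * nrm w := integral_mul_sq_le cA' cw.continuous sA' sw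
  have I4 : |∫ x, B' x * w x| ≤ nrm B' * nrm w := integral_mul_sq_le cB' cw.continuous sB' sw
  have hInt : nrm w ^ 2 = (∫ x, Xop (b i) A x * w x) - (∫ x, A' x * w x) -
      (δ * (∫ x, Xop Y B x * w x) - δ * ∫ x, B' x * w x) := by
    have j1 := integrable_mul_cpt cXA cw.continuous sXA
    have j2 := integrable_mul_cpt cA' cw.continuous sA'
    have j3 := integrable_mul_cpt cYB cw.continuous sYB
    have j4 := integrable_mul_cpt cB' cw.continuous sB'
    rw [nrm_sq, ← integral_sub j1 j2, ← integral_const_mul, ← integral_const_mul,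
      ← integral_sub (j3.const_mul δ) (j4.const_mul δ)]
    rw [← integral_sub (f := fun x => Xop (b i) A x * w x - A' x * w x)
      (g := fun x => δ * (Xop Y B x * w x) - δ * (B' x * w x)) (j1.sub j2)
      ((j3.const_mul δ).sub (j4.const_mul δ))]
    congr 1
    ext x
    rw [sq]
    nth_rewrite 1 [hsplit x]
    ring
  have hds0 : 0 ≤ δ ^ s := Real.rpow_nonneg h0.le s
  have E1 : |∫ x, Xop (b i) A x * w x| ≤
      (C1 * (BG + BG') + DX * (C1 * BG)) * (δ ^ s * N ^ 2) := by
    refine I1.trans ?_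
    calc _ ≤ (C1 * (δ ^ s * N)) * ((BG + BG') * N) + DX * ((C1 * (δ ^ s * N)) * (BG * N)) := by
          gcongr <;> exact nrm_nonneg _
      _ = _ := by ring
  have E2 : |∫ x, A' x * w x| ≤ C1' * BG * (δ ^ s * N ^ 2) := by
    refine I3.trans ?_
    calc _ ≤ (C1' * (δ ^ s * N)) * (BG * N) := by
          gcongr <;> exact nrm_nonneg _
      _ = _ := by ring
  have E3 : δ * |∫ x, Xop Y B x * w x| ≤
      (BF * (C2 + BG2) + DY * (BF * BG)) * (δ ^ s * N ^ 2) := by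
    calc _ ≤ δ * (nrm B * nrm (Xop Y w) + DY * (nrm B * nrm w)) := by gcongr
      _ = nrm B * (δ * nrm (Xop Y w)) + δ * (DY * (nrm B * nrm w)) := by ring
      _ ≤ (BF * N) * ((C2 + BG2) * (δ ^ s * N)) + δ ^ s * (DY * ((BF * N) * (BG * N))) := by
          have := nrm_nonneg B
          have := nrm_nonneg w
          gcongr <;> first | exact nrm_nonneg _ | exact mul_nonneg h0.le (nrm_nonneg _)
      _ = _ := by ring
  have E4 : δ * |∫ x, B' x * w x| ≤ BF2 * BG * (δ ^ s * N ^ 2) := by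
    calc _ ≤ δ ^ s * ((BF2 * N) * (BG * N)) := by
          gcongr
          refine I4.trans ?_
          gcongr <;> exact nrm_nonneg _
      _ = _ := by ring
  have hfin : nrm w ^ 2 ≤ K * (δ ^ s * N ^ 2) := by
    rw [hInt, hK]
    have a1 := le_abs_self (∫ x, Xop (b i) A x * w x)
    have a2 := neg_abs_le (∫ x, A' x * w x)
    have a3 := mul_le_mul_of_nonneg_left (neg_abs_le (∫ x, Xop Y B x * w x)) h0.le
    have a4 := mul_le_mul_of_nonneg_left (le_abs_self (∫ x, B' x * w x)) h0.le
    simp only [mul_neg] at a3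
    linarith
  rw [hwe]
  refine nrm_le (by positivity) ?_ |>.trans_eq rfl
  rw [← nrm_sq]
  refine hfin.trans_eq ?_
  have e : (δ ^ (s / 2)) ^ 2 = δ ^ s := by
    rw [← Real.rpow_natCast, ← Real.rpow_mul h0.le]
    norm_num
  rw [mul_pow, Real.sq_sqrt hK0, mul_pow, e]

lemma exists_smooth_cutoff {K V : Set (Fin n → ℝ)} (hK : IsCompact K) (hV : IsOpen V)
    (hKV : K ⊆ V) : ∃ χ : (Fin n → ℝ) → ℝ, ContDiff ℝ (⊤ : ℕ∞) χ ∧ HasCompactSupport χ ∧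
      tsupport χ ⊆ V ∧ (∀ᶠ x in 𝓝ˢ K, χ x = 1) ∧ ∀ x, 0 ≤ χ x ∧ χ x ≤ 1 := by
  obtain ⟨L, hL, hKL, hLV⟩ := exists_compact_between hK hV hKV
  obtain ⟨f, h1, h0, hf⟩ := exists_contMDiffMap_one_nhds_of_subset_interior
    (modelWithCornersSelf ℝ (Fin n → ℝ)) (n := (⊤ : ℕ∞)) hK.isClosed hKL
  have ht : tsupport f ⊆ L := closure_minimal (fun x hx => by
    by_contra h
    exact hx (h0 x h)) hL.isClosed
  exact ⟨f, f.contMDiff.contDiff, HasCompactSupport.intro hL h0, ht.trans hLV, h1, hf⟩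

lemma GainField.congr {b : Fin m → (Fin n → ℝ) → (Fin n → ℝ)} {Y Z : (Fin n → ℝ) → (Fin n → ℝ)}
    (gY : GainField b Y) (h : ∀ x, Y x = Z x) : GainField b Z := (funext h : Y = Z) ▸ gY

lemma GainField.smul {b : Fin m → (Fin n → ℝ) → (Fin n → ℝ)} {Y : (Fin n → ℝ) → (Fin n → ℝ)}
    (gY : GainField b Y) {a : (Fin n → ℝ) → ℝ} (ha : ContDiff ℝ (⊤ : ℕ∞) a)
    (has : HasCompactSupport a) : GainField b (fun x => a x • Y x) := by
  obtain ⟨s, hs0, hs1, hs⟩ := gY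
  refine ⟨s, hs0, hs1, fun F hF => ?_⟩
  have hG := hF.mul (isMult_translate ha has (t := id)
    fun δ h0 h1 => by simpa [abs_of_pos h0] using h1)
  obtain ⟨C, hC0, hC⟩ := hs _ hG
  refine ⟨C, hC0, fun δ h0 h1 φ hφ hφs => ?_⟩
  have e : kerOp F δ (fun y => δ * Xop (fun x => a x • Y x) φ y) =
      kerOp (fun δ p => F δ p * a (p.1 - δ • p.2)) δ (fun y => δ * Xop Y φ y) := by
    ext x
    rw [← kerOp_mul]
    congr 1
    ext y
    simp only [Xop, map_smul, smul_eq_mul]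
    ring
  rw [e]
  exact hC δ h0 h1 φ hφ hφs

lemma gainField_zero (b : Fin m → (Fin n → ℝ) → (Fin n → ℝ)) :
    GainField b (fun _ => (0 : Fin n → ℝ)) := by
  refine ⟨1, one_pos, le_rfl, fun F _ => ⟨0, le_rfl, fun δ _ _ φ _ _ => ?_⟩⟩
  have e : kerOp F δ (fun y => δ * Xop (fun _ => (0 : Fin n → ℝ)) φ y) = fun _ => 0 := by
    ext x
    simp [kerOp, Xop]
  rw [e]
  simp [nrm]

lemma GainField.add {b : Fin m → (Fin n → ℝ) → (Fin n → ℝ)} {Y Z : (Fin n → ℝ) → (Fin n → ℝ)}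
    (hY : ContDiff ℝ (⊤ : ℕ∞) Y) (hZ : ContDiff ℝ (⊤ : ℕ∞) Z)
    (gY : GainField b Y) (gZ : GainField b Z) : GainField b (fun x => Y x + Z x) := by
  have h := (gainField_zero b).sub contDiff_const hZ gZ
  exact (gY.sub hY (contDiff_const.sub hZ) h).congr fun x => by simp

lemma GainField.sum {ι : Type*} {b : Fin m → (Fin n → ℝ) → (Fin n → ℝ)} (t : Finset ι)
    {Y : ι → (Fin n → ℝ) → (Fin n → ℝ)} (hY : ∀ k ∈ t, ContDiff ℝ (⊤ : ℕ∞) (Y k))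
    (gY : ∀ k ∈ t, GainField b (Y k)) : GainField b (fun x => ∑ k ∈ t, Y k x) := by
  classical
  induction t using Finset.induction_on with
  | empty => simpa using gainField_zero b
  | insert k t hk ih =>
    simp only [Finset.sum_insert hk]
    exact (gY k (Finset.mem_insert_self k t)).add (hY k (Finset.mem_insert_self k t))
      (ContDiff.sum fun j hj => hY j (Finset.mem_insert_of_mem hj))
      (ih (fun j hj => hY j (Finset.mem_insert_of_mem hj))
        fun j hj => gY j (Finset.mem_insert_of_mem hj))

lemma GainField.const_smul {b : Fin m → (Fin n → ℝ) → (Fin n → ℝ)}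
    {Y : (Fin n → ℝ) → (Fin n → ℝ)} (hYs : HasCompactSupport Y)
    (gY : GainField b Y) (t : ℝ) : GainField b (fun x => t • Y x) := by
  obtain ⟨χ, hχ, hχs, -, h1, -⟩ := exists_smooth_cutoff hYs.isCompact isOpen_univ
    (Set.subset_univ _)
  refine (gY.smul (contDiff_const.mul hχ) (hχs.mul_left (f := fun _ => t))).congr fun x => ?_
  by_cases hx : x ∈ tsupport Y
  · rw [h1.self_of_nhdsSet x hx, mul_one]
  · rw [image_eq_zero_of_notMem_tsupport hx, smul_zero, smul_zero]

lemma two_le_top : (2 : WithTop ℕ∞) ≤ ((⊤ : ℕ∞) : WithTop ℕ∞) := by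
  exact WithTop.coe_le_coe.2 (le_top : (2 : ℕ∞) ≤ ⊤)

lemma gainField_lieGen {b : Fin m → (Fin n → ℝ) → (Fin n → ℝ)}
    (hb : ∀ i, ContDiff ℝ (⊤ : ℕ∞) (b i)) (hbs : ∀ i, HasCompactSupport (b i))
    {c : (Fin n → ℝ) → (Fin n → ℝ)} (hc : LieGen b c) :
    ContDiff ℝ (⊤ : ℕ∞) c ∧ HasCompactSupport c ∧ GainField b c ∧
      ∀ Y, ContDiff ℝ (⊤ : ℕ∞) Y → HasCompactSupport Y → GainField b Y →
        GainField b (vfBracket c Y) := by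
  induction hc with
  | base i => exact ⟨hb i, hbs i, gainField_base hb i, fun Y hY hYs gY =>
      gainField_bracket hb hbs i hY hYs gY⟩
  | @bracket c d _ _ ihc ihd =>
    obtain ⟨hc, hcs, -, pc⟩ := ihc
    obtain ⟨hd, hds, gd, pd⟩ := ihd
    have he := contDiff_vfBracket hc hd
    refine ⟨he, hasCompactSupport_vfBracket hc hcs, pc d hd hds gd, fun Y hY hYs gY => ?_⟩
    have g1 := pc _ (contDiff_vfBracket hd hY) (hasCompactSupport_vfBracket hd hds)
      (pd Y hY hYs gY)
    have g2 := pd _ (contDiff_vfBracket hc hY) (hasCompactSupport_vfBracket hc hcs)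
      (pc Y hY hYs gY)
    refine (g1.sub (contDiff_vfBracket hc (contDiff_vfBracket hd hY))
      (contDiff_vfBracket hd (contDiff_vfBracket hc hY)) g2).congr fun x => ?_
    have D : ∀ {e : (Fin n → ℝ) → (Fin n → ℝ)}, ContDiff ℝ (⊤ : ℕ∞) e → Differentiable ℝ e :=
      fun h => h.differentiable (by simp)
    have E : ∀ {e f : (Fin n → ℝ) → (Fin n → ℝ)}, ContDiff ℝ (⊤ : ℕ∞) e →
        ContDiff ℝ (⊤ : ℕ∞) f → vfBracket e f = VectorField.lieBracket ℝ e f := fun h h' =>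
      funext fun y => vfBracket_eq_lieBracket (D h y) (D h' y)
    have J := VectorField.leibniz_identity_lieBracket (𝕜 := ℝ) (n := 2) (by simp) (x := x)
      (hc.of_le two_le_top).contDiffAt (hd.of_le two_le_top).contDiffAt
      (hY.of_le two_le_top).contDiffAt
    rw [← E hc hd, ← E hd hY, ← E hc hY, ← E hc (contDiff_vfBracket hd hY),
      ← E hd (contDiff_vfBracket hc hY), ← E he hY] at J
    rw [J]
    exact add_sub_cancel_right _ _

lemma exists_gainField_eq {V : Set (Fin n → ℝ)} {b : Fin m → (Fin n → ℝ) → (Fin n → ℝ)}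
    (hb : ∀ i, ContDiff ℝ (⊤ : ℕ∞) (b i)) (hbs : ∀ i, HasCompactSupport (b i))
    (hH : Hormander V b) {x : Fin n → ℝ} (hx : x ∈ V) (v : Fin n → ℝ) :
    ∃ Z : (Fin n → ℝ) → (Fin n → ℝ), ContDiff ℝ (⊤ : ℕ∞) Z ∧ HasCompactSupport Z ∧
      GainField b Z ∧ Z x = v := by
  have hv : v ∈ Submodule.span ℝ {v : Fin n → ℝ | ∃ c, LieGen b c ∧ c x = v} := by
    rw [hH x hx]
    trivial
  induction hv using Submodule.span_induction with
  | mem v h =>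
    obtain ⟨c, hc, rfl⟩ := h
    obtain ⟨h1, h2, h3, -⟩ := gainField_lieGen hb hbs hc
    exact ⟨c, h1, h2, h3, rfl⟩
  | zero => exact ⟨fun _ => 0, contDiff_const, HasCompactSupport.zero, gainField_zero b, rfl⟩
  | add v w _ _ ihv ihw =>
    obtain ⟨Y, h1, h2, h3, h4⟩ := ihv
    obtain ⟨Z, k1, k2, k3, k4⟩ := ihw
    exact ⟨_, h1.add k1, h2.add k2, h3.add h1 k1 k3, by simp [h4, k4]⟩
  | smul t v _ ih =>
    obtain ⟨Y, h1, h2, h3, h4⟩ := ih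
    exact ⟨_, h1.const_smul t, h2.smul_left (f := fun _ => t), h3.const_smul h2 t, by simp [h4]⟩

lemma contDiff_det {M : (Fin n → ℝ) → Matrix (Fin n) (Fin n) ℝ}
    (hM : ∀ i j, ContDiff ℝ (⊤ : ℕ∞) fun x => M x i j) :
    ContDiff ℝ (⊤ : ℕ∞) fun x => (M x).det := by
  simp only [Matrix.det_apply]
  refine ContDiff.sum fun σ _ => ContDiff.const_smul _ ?_
  exact contDiff_prod fun i _ => hM _ _

lemma contDiff_adjugate {M : (Fin n → ℝ) → Matrix (Fin n) (Fin n) ℝ}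
    (hM : ∀ i j, ContDiff ℝ (⊤ : ℕ∞) fun x => M x i j) (i j : Fin n) :
    ContDiff ℝ (⊤ : ℕ∞) fun x => (M x).adjugate i j := by
  simp only [Matrix.adjugate_apply]
  refine contDiff_det fun k l => ?_
  by_cases h : k = j
  · subst h
    simpa using contDiff_const
  · simpa [Matrix.updateRow_ne h] using hM k l

/-- Near any point of a region where Hörmander's condition holds, the coordinate fields gain. -/
lemma exists_gainField_single {V : Set (Fin n → ℝ)} {b : Fin m → (Fin n → ℝ) → (Fin n → ℝ)}
    (hb : ∀ i, ContDiff ℝ (⊤ : ℕ∞) (b i)) (hbs : ∀ i, HasCompactSupport (b i))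
    (hH : Hormander V b) {x : Fin n → ℝ} (hx : x ∈ V) :
    ∃ a : (Fin n → ℝ) → ℝ, ContDiff ℝ (⊤ : ℕ∞) a ∧ HasCompactSupport a ∧ a x = 1 ∧
      ∀ j, GainField b fun y => a y • (Pi.single j 1 : Fin n → ℝ) := by
  choose Z hZ hZs gZ hZx using fun k : Fin n =>
    exists_gainField_eq hb hbs hH hx (Pi.single k 1)
  obtain ⟨χ, hχ, hχs, -, hχ1, -⟩ := exists_smooth_cutoff (isCompact_singleton (x := x))
    isOpen_univ (Set.subset_univ _)
  set M : (Fin n → ℝ) → Matrix (Fin n) (Fin n) ℝ := fun y => Matrix.of fun l k => Z k y l with hM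
  have hMs : ∀ i j, ContDiff ℝ (⊤ : ℕ∞) fun y => M y i j := fun i j => contDiff_pi.1 (hZ j) i
  refine ⟨fun y => χ y * (M y).det, hχ.mul (contDiff_det hMs), hχs.mul_right, ?_, fun j => ?_⟩
  · have : M x = 1 := by
      ext l k
      simp [hM, hZx, Matrix.one_apply, Pi.single_apply]
    simp only [this, Matrix.det_one, hχ1.self_of_nhdsSet x rfl, mul_one]
  · refine (GainField.sum Finset.univ (Y := fun k y => (χ y * (M y).adjugate k j) • Z k y)
      (fun k _ => (hχ.mul (contDiff_adjugate hMs k j)).smul (hZ k))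
      fun k _ => (gZ k).smul (hχ.mul (contDiff_adjugate hMs k j)) hχs.mul_right).congr fun y => ?_
    ext l
    have h := congrFun (congrFun (Matrix.mul_adjugate (M y)) l) j
    rw [Matrix.mul_apply] at h
    simp only [Matrix.smul_apply, Matrix.one_apply, smul_eq_mul] at h
    simp only [Finset.sum_apply, Pi.smul_apply, smul_eq_mul, Pi.single_apply, mul_assoc]
    rw [← h, Finset.mul_sum]
    refine Finset.sum_congr rfl fun k _ => ?_
    simp only [hM, Matrix.of_apply]
    ring

lemma exists_gain_partial {V K : Set (Fin n → ℝ)} {b : Fin m → (Fin n → ℝ) → (Fin n → ℝ)}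
    (hb : ∀ i, ContDiff ℝ (⊤ : ℕ∞) (b i)) (hbs : ∀ i, HasCompactSupport (b i))
    (hH : Hormander V b) (hK : IsCompact K) (hKV : K ⊆ V) (j : Fin n) :
    ∃ a : (Fin n → ℝ) → ℝ, (∀ x ∈ K, a x = 1) ∧
      GainField b fun y => a y • (Pi.single j 1 : Fin n → ℝ) := by
  have hloc : ∀ x ∈ K, ∃ a : (Fin n → ℝ) → ℝ, ContDiff ℝ (⊤ : ℕ∞) a ∧ HasCompactSupport a ∧
      a x = 1 ∧ GainField b fun y => a y • (Pi.single j 1 : Fin n → ℝ) := fun x hx => by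
    obtain ⟨a, h1, h2, h3, h4⟩ := exists_gainField_single hb hbs hH (hKV hx)
    exact ⟨a, h1, h2, h3, h4 j⟩
  choose! a ha has ha1 ga using hloc
  obtain ⟨t, htK, ht⟩ := hK.elim_nhds_subcover (fun x => {y | a x y ≠ 0}) fun x hx =>
    (isOpen_ne_fun (ha x hx).continuous continuous_const).mem_nhds (by simp [ha1 x hx])
  set D : (Fin n → ℝ) → ℝ := fun y => ∑ x ∈ t, a x y ^ 2 with hD
  have hDs : ContDiff ℝ (⊤ : ℕ∞) D := ContDiff.sum fun x hx => (ha x (htK x hx)).pow 2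
  have hKD : K ⊆ {y | 0 < D y} := fun y hy => by
    obtain ⟨x, hx, hxy⟩ := Set.mem_iUnion₂.1 (ht hy)
    exact Finset.sum_pos' (f := fun x => a x y ^ 2) (fun _ _ => sq_nonneg _) ⟨x, hx, sq_pos_of_ne_zero hxy⟩
  obtain ⟨χ, hχ, hχs, hχD, hχ1, -⟩ := exists_smooth_cutoff hK
    (isOpen_lt continuous_const hDs.continuous) hKD
  have hq : ContDiff ℝ (⊤ : ℕ∞) fun y => χ y / D y := by
    rw [contDiff_iff_contDiffAt]
    intro y
    by_cases hy : y ∈ tsupport χ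
    · exact hχ.contDiffAt.div hDs.contDiffAt (hχD hy).ne'
    · have : (fun y => χ y / D y) =ᶠ[𝓝 y] fun _ => 0 := by
        filter_upwards [(isClosed_tsupport χ).isOpen_compl.mem_nhds hy] with z hz
        rw [image_eq_zero_of_notMem_tsupport hz, zero_div]
      exact contDiffAt_const.congr_of_eventuallyEq this
  have hqs : HasCompactSupport fun y => χ y / D y := by
    simp only [div_eq_mul_inv]
    exact hχs.mul_right
  have hg := GainField.sum (b := b) t
    (Y := fun x y => (χ y / D y * a x y) • (a x y • (Pi.single j 1 : Fin n → ℝ)))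
    (fun x hx => (hq.mul (ha x (htK x hx))).smul ((ha x (htK x hx)).smul contDiff_const))
    fun x hx => (ga x (htK x hx)).smul (hq.mul (ha x (htK x hx))) hqs.mul_right
  refine ⟨fun y => χ y / D y * D y, fun x hx => ?_, hg.congr fun y => ?_⟩
  · have h0 : D x ≠ 0 := ne_of_gt (hKD hx)
    simp only [div_mul_cancel₀ _ h0, hχ1.self_of_nhdsSet x hx]
  · simp only [smul_smul, ← Finset.sum_smul, hD, Finset.mul_sum]
    congr 1
    refine Finset.sum_congr rfl fun x _ => ?_
    ring

end SubellipticEstimate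

section SubellipticGain

variable {n m : ℕ}

lemma exists_gain_partials {V K : Set (Fin n → ℝ)} {b : Fin m → (Fin n → ℝ) → (Fin n → ℝ)}
    (hb : ∀ i, ContDiff ℝ (⊤ : ℕ∞) (b i)) (hbs : ∀ i, HasCompactSupport (b i))
    (hH : Hormander V b) (hK : IsCompact K) (hKV : K ⊆ V) :
    ∃ s : ℝ, 0 < s ∧ ∀ F : Fin n → ℝ → (Fin n → ℝ) × (Fin n → ℝ) → ℝ, (∀ j, IsKer (F j)) →
      ∃ C : ℝ, 0 ≤ C ∧ ∀ δ, 0 < δ → δ ≤ 1 → ∀ φ : (Fin n → ℝ) → ℝ, ContDiff ℝ 2 φ →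
        tsupport φ ⊆ K → ∀ j,
          nrm (kerOp (F j) δ (fun y => δ * fderiv ℝ φ y (Pi.single j 1))) ≤
            C * (δ ^ s * xnrm b φ) := by
  choose a ha1 s hs0 hs1 hs using fun j => exists_gain_partial hb hbs hH hK hKV j
  obtain ⟨σ, hσ0, hσ⟩ : ∃ σ : ℝ, 0 < σ ∧ ∀ j, σ ≤ s j := by
    have h : Set.Finite (Set.range s) := Set.finite_range s
    rcases isEmpty_or_nonempty (Fin n) with hn | hn
    · exact ⟨1, one_pos, fun j => isEmptyElim j⟩
    · obtain ⟨j, hj⟩ := Finite.exists_min s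
      exact ⟨s j, hs0 j, hj⟩
  refine ⟨σ, hσ0, fun F hF => ?_⟩
  choose C hC0 hC using fun j => hs j (F j) (hF j)
  refine ⟨∑ j, C j, Finset.sum_nonneg fun j _ => hC0 j, fun δ h0 h1 φ hφ hφK j => ?_⟩
  have hφs : HasCompactSupport φ := hK.of_isClosed_subset (isClosed_tsupport φ) hφK
  have e : (fun y => δ * fderiv ℝ φ y (Pi.single j 1)) =
      fun y => δ * Xop (fun y => a j y • (Pi.single j 1 : Fin n → ℝ)) φ y := by
    ext y
    simp only [Xop, map_smul, smul_eq_mul]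
    by_cases hy : y ∈ tsupport φ
    · rw [ha1 j y (hφK hy), one_mul]
    · have : fderiv ℝ φ y = 0 := by
        by_contra h
        exact hy (tsupport_fderiv_subset ℝ (subset_tsupport _ h))
      simp [this]
  have hN := xnrm_nonneg b φ
  rw [e]
  refine (hC j δ h0 h1 φ hφ hφs).trans ?_
  have h2 : δ ^ s j ≤ δ ^ σ := Real.rpow_le_rpow_of_exponent_ge h0 h1 (hσ j)
  have h3 : C j ≤ ∑ j, C j := Finset.single_le_sum (fun j _ => hC0 j) (Finset.mem_univ j)
  gcongr
  exact Finset.sum_nonneg fun j _ => hC0 j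

lemma hasDerivAt_smoothing {θ φ : (Fin n → ℝ) → ℝ} (hθ : ContDiff ℝ (⊤ : ℕ∞) θ)
    (hθs : HasCompactSupport θ) (hφ : ContDiff ℝ 1 φ) (hφs : HasCompactSupport φ) :
    (∃ B : ℝ, ∀ (x : Fin n → ℝ) (t : ℝ), |∫ z, θ z * fderiv ℝ φ (x - t • z) z| ≤ B) ∧
    ∀ x t, HasDerivAt (fun t : ℝ => ∫ z, θ z * φ (x - t • z))
      (-∫ z, θ z * fderiv ℝ φ (x - t • z) z) t := by
  have hdc : Continuous (fderiv ℝ φ) := hφ.continuous_fderiv one_ne_zero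
  obtain ⟨M, hM⟩ := (hφs.fderiv ℝ).exists_bound_of_continuous hdc
  have hbc : Continuous fun z => |θ z| * (M * ‖z‖) := by fun_prop
  have hbi : Integrable fun z => |θ z| * (M * ‖z‖) :=
    hbc.integrable_of_hasCompactSupport (HasCompactSupport.intro hθs fun z hz => by
      simp [image_eq_zero_of_notMem_tsupport hz])
  have hpt : ∀ x z : Fin n → ℝ, ∀ t : ℝ, ‖θ z * fderiv ℝ φ (x - t • z) z‖ ≤ |θ z| * (M * ‖z‖) := by
    intro x z t
    rw [norm_mul, Real.norm_eq_abs]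
    gcongr
    exact (ContinuousLinearMap.le_opNorm _ _).trans (by gcongr; exact hM _)
  refine ⟨⟨∫ z, |θ z| * (M * ‖z‖), fun x t => ?_⟩, fun x t => ?_⟩
  · exact norm_integral_le_of_norm_le hbi (Eventually.of_forall fun z => hpt x z t)
  · rw [← integral_neg]
    have hc : ∀ t : ℝ, Continuous fun z => θ z * φ (x - t • z) := fun t =>
      hθ.continuous.mul (hφ.continuous.comp (by fun_prop))
    refine (hasDerivAt_integral_of_dominated_loc_of_deriv_le (s := Set.univ) univ_mem
      (F := fun t z => θ z * φ (x - t • z))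
      (F' := fun t z => -(θ z * fderiv ℝ φ (x - t • z) z)) (bound := fun z => |θ z| * (M * ‖z‖))
      (Eventually.of_forall fun t => (hc t).aestronglyMeasurable)
      ((hc t).integrable_of_hasCompactSupport hθs.mul_right)
      ?_ (Eventually.of_forall fun z t _ => by rw [norm_neg]; exact hpt x z t) hbi
      (Eventually.of_forall fun z t _ => ?_)).2
    · exact (hθ.continuous.mul ((hdc.comp (by fun_prop)).clm_apply
        continuous_id)).neg.aestronglyMeasurable
    · have h1 : HasDerivAt (fun t : ℝ => x - t • z) (-z) t := by
        simpa using (hasDerivAt_id t).smul_const z |>.const_sub x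
      have h2 := ((hφ.differentiable one_ne_zero _).hasFDerivAt.comp_hasDerivAt t h1).const_mul (θ z)
      simpa using h2

lemma integral_theta_fderiv {θ φ : (Fin n → ℝ) → ℝ} (hθ : ContDiff ℝ (⊤ : ℕ∞) θ)
    (hθs : HasCompactSupport θ) (hφ : ContDiff ℝ 1 φ) (x : Fin n → ℝ) (t : ℝ) :
    ∫ z, θ z * fderiv ℝ φ (x - t • z) z =
      ∑ j, kerOp (fun _ p => θ p.2 * p.2 j) t (fun y => fderiv ℝ φ y (Pi.single j 1)) x := by
  simp only [kerOp]
  rw [← integral_finsetSum]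
  · congr 1
    ext z
    rw [fderiv_apply_eq_sum, Finset.mul_sum]
    exact Finset.sum_congr rfl fun j _ => by ring
  · intro j _
    have hdc : Continuous (fderiv ℝ φ) := hφ.continuous_fderiv one_ne_zero
    refine Continuous.integrable_of_hasCompactSupport ?_ (hθs.mul_right.mul_right)
    exact (hθ.continuous.mul (continuous_apply j)).mul ((hdc.comp (by fun_prop)).clm_apply
      continuous_const)

lemma isKer_theta_mul {θ : (Fin n → ℝ) → ℝ} (hθ : ContDiff ℝ (⊤ : ℕ∞) θ)
    (hθs : HasCompactSupport θ) (j : Fin n) :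
    IsKer fun _ (p : (Fin n → ℝ) × (Fin n → ℝ)) => θ p.2 * p.2 j :=
  isKer_snd (a := fun z => θ z * z j) (hθ.mul (contDiff_apply ℝ ℝ j)) hθs.mul_right

/-- Smoothing at scale `δ` approximates to order `δ ^ s` in the subelliptic norm. -/
lemma exists_nrm_sub_smoothing_le {V K : Set (Fin n → ℝ)}
    {b : Fin m → (Fin n → ℝ) → (Fin n → ℝ)}
    (hb : ∀ i, ContDiff ℝ (⊤ : ℕ∞) (b i)) (hbs : ∀ i, HasCompactSupport (b i))
    (hH : Hormander V b) (hK : IsCompact K) (hKV : K ⊆ V) {θ : (Fin n → ℝ) → ℝ}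
    (hθ : ContDiff ℝ (⊤ : ℕ∞) θ) (hθs : HasCompactSupport θ) (hθ1 : ∫ z, θ z = 1) :
    ∃ s : ℝ, 0 < s ∧ ∃ C : ℝ, 0 ≤ C ∧ ∀ δ, 0 < δ → δ ≤ 1 → ∀ φ : (Fin n → ℝ) → ℝ,
      ContDiff ℝ 2 φ → tsupport φ ⊆ K →
        nrm (fun x => φ x - ∫ z, θ z * φ (x - δ • z)) ≤ C * (δ ^ s * xnrm b φ) := by
  obtain ⟨s, hs0, hs⟩ := exists_gain_partials hb hbs hH hK hKV
  obtain ⟨C, hC0, hC⟩ := hs (fun j _ p => θ p.2 * p.2 j) (isKer_theta_mul hθ hθs)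
  refine ⟨s, hs0, n * C / s, by positivity, fun δ hδ0 hδ1 φ hφ hφK => ?_⟩
  have hφs : HasCompactSupport φ := hK.of_isClosed_subset (isClosed_tsupport φ) hφK
  have hφ1 : ContDiff ℝ 1 φ := hφ.of_le (by norm_num)
  have hN := xnrm_nonneg b φ
  set N := xnrm b φ with hNdef
  have hPc : ∀ t, Continuous fun x => ∫ z, θ z * φ (x - t • z) := fun t =>
    (isKer_snd hθ hθs).continuous_kerOp hφ1.continuous t
  have hPs : HasCompactSupport fun x => ∫ z, θ z * φ (x - δ • z) :=
    (isKer_snd hθ hθs).hasCompactSupport_kerOp hφs δ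
  have hP0 : ∀ x, ∫ z, θ z * φ (x - (0 : ℝ) • z) = φ x := fun x => by
    simp only [zero_smul, sub_zero, integral_mul_const, hθ1, one_mul]
  obtain ⟨⟨B, hB⟩, hder⟩ := hasDerivAt_smoothing hθ hθs hφ1 hφs
  set f : (Fin n → ℝ) → ℝ := fun x => φ x - ∫ z, θ z * φ (x - δ • z) with hf
  have hfc : Continuous f := hφ1.continuous.sub (hPc δ)
  have hfs : HasCompactSupport f := hφs.sub hPs
  set h : ℝ → ℝ := fun t => ∫ x, f x * ∫ z, θ z * φ (x - t • z) with hh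
  set G : ℝ → (Fin n → ℝ) → ℝ := fun t x => ∫ z, θ z * fderiv ℝ φ (x - t • z) z with hG
  have hdφ : ∀ j : Fin n, Continuous fun y => fderiv ℝ φ y (Pi.single j 1) := fun j =>
    (hφ1.continuous_fderiv one_ne_zero).clm_apply continuous_const
  have hdφs : ∀ j : Fin n, HasCompactSupport fun y => fderiv ℝ φ y (Pi.single j 1) := fun j =>
    hφs.fderiv_apply ℝ _
  have hGe : ∀ t, G t = fun x => ∑ j, kerOp (fun _ p => θ p.2 * p.2 j) t
      (fun y => fderiv ℝ φ y (Pi.single j 1)) x := fun t => by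
    ext x
    exact integral_theta_fderiv hθ hθs hφ1 x t
  have hkc : ∀ t j, Continuous (kerOp (fun _ p => θ p.2 * p.2 j) t
      (fun y => fderiv ℝ φ y (Pi.single j 1))) := fun t j =>
    (isKer_theta_mul hθ hθs j).continuous_kerOp (hdφ j) t
  have hks : ∀ t j, HasCompactSupport (kerOp (fun _ p => θ p.2 * p.2 j) t
      (fun y => fderiv ℝ φ y (Pi.single j 1))) := fun t j =>
    (isKer_theta_mul hθ hθs j).hasCompactSupport_kerOp (hdφs j) t
  have hGc : ∀ t, Continuous (G t) := fun t => by
    rw [hGe]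
    exact continuous_finsetSum _ fun j _ => hkc t j
  have hdh : ∀ t, HasDerivAt h (-∫ x, f x * G t x) t := by
    intro t
    rw [← integral_neg]
    refine (hasDerivAt_integral_of_dominated_loc_of_deriv_le (s := Set.univ) univ_mem
      (F := fun t x => f x * ∫ z, θ z * φ (x - t • z))
      (F' := fun t x => -(f x * G t x)) (bound := fun x => |f x| * B)
      (Eventually.of_forall fun t => (hfc.mul (hPc t)).aestronglyMeasurable)
      ((hfc.mul (hPc t)).integrable_of_hasCompactSupport hfs.mul_right)
      (hfc.mul (hGc t)).neg.aestronglyMeasurable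
      (Eventually.of_forall fun x t _ => ?_) 
      ((hfc.abs.mul continuous_const).integrable_of_hasCompactSupport ?_)
      (Eventually.of_forall fun x t _ => ?_)).2
    · rw [norm_neg, norm_mul, Real.norm_eq_abs]
      gcongr
      exact hB x t
    · exact (HasCompactSupport.intro hfs fun z hz => by
        simp [image_eq_zero_of_notMem_tsupport hz])
    · simpa using (hder x t).const_mul (f x)
  have hbd : ∀ t, 0 < t → t ≤ 1 → |∫ x, f x * G t x| ≤ n * C * nrm f * N * t ^ (s - 1) := by
    intro t h0 h1
    have e : ∫ x, f x * G t x = ∑ j, ∫ x, f x * kerOp (fun _ p => θ p.2 * p.2 j) t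
        (fun y => fderiv ℝ φ y (Pi.single j 1)) x := by
      rw [hGe, ← integral_finsetSum _ fun j _ => integrable_mul_cpt hfc (hkc t j) hfs]
      simp only [Finset.mul_sum]
    rw [e]
    refine (Finset.abs_sum_le_sum_abs _ _).trans ?_
    have hj : ∀ j : Fin n, |∫ x, f x * kerOp (fun _ p => θ p.2 * p.2 j) t
        (fun y => fderiv ℝ φ y (Pi.single j 1)) x| ≤ C * nrm f * N * t ^ (s - 1) := by
      intro j
      refine (integral_mul_sq_le hfc (hkc t j) hfs (hks t j)).trans ?_
      have h2 := hC t h0 h1 φ hφ hφK j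
      have h3 : kerOp (fun _ p => θ p.2 * p.2 j) t (fun y => t * fderiv ℝ φ y (Pi.single j 1)) =
          fun x => t * kerOp (fun _ p => θ p.2 * p.2 j) t
            (fun y => fderiv ℝ φ y (Pi.single j 1)) x := by
        ext x
        exact kerOp_const_mul _ _ _
      rw [h3, nrm_const_mul, abs_of_pos h0] at h2
      rw [Real.rpow_sub_one h0.ne']
      have h4 : nrm (kerOp (fun _ p => θ p.2 * p.2 j) t
          (fun y => fderiv ℝ φ y (Pi.single j 1))) ≤ C * (t ^ s * N) / t := by
        rw [le_div_iff₀ h0]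
        linarith
      calc _ ≤ nrm f * (C * (t ^ s * N) / t) :=
            mul_le_mul_of_nonneg_left h4 (nrm_nonneg f)
        _ = _ := by ring
    refine (Finset.sum_le_sum fun j _ => hj j).trans_eq ?_
    simp
    ring
  set A := n * C * nrm f * N / s with hA
  have hdA : ∀ t ∈ Set.Ioo 0 δ, HasDerivAt (fun t => A * t ^ s + h t)
      (A * (s * t ^ (s - 1)) + -∫ x, f x * G t x) t := fun t ht =>
    ((Real.hasDerivAt_rpow_const (Or.inl ht.1.ne')).const_mul A).add (hdh t)
  have hmono : MonotoneOn (fun t => A * t ^ s + h t) (Set.Icc 0 δ) := by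
    refine monotoneOn_of_deriv_nonneg (convex_Icc 0 δ) ?_ ?_ ?_
    · refine ContinuousOn.add (ContinuousOn.mul continuousOn_const
        (Real.continuous_rpow_const hs0.le).continuousOn) ?_
      exact fun t _ => (hdh t).continuousAt.continuousWithinAt
    all_goals rw [interior_Icc]
    · exact fun t ht => (hdA t ht).differentiableAt.differentiableWithinAt
    · intro t ht
      rw [(hdA t ht).deriv]
      have h2 := hbd t ht.1 (ht.2.le.trans hδ1)
      have h3 : A * (s * t ^ (s - 1)) = n * C * nrm f * N * t ^ (s - 1) := by
        rw [hA]
        field_simp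
      have h4 := le_abs_self (∫ x, f x * G t x)
      linarith
  have hm := hmono (Set.left_mem_Icc.2 hδ0.le) (Set.right_mem_Icc.2 hδ0.le) hδ0.le
  simp only [Real.zero_rpow hs0.ne'] at hm
  have hsq : nrm f ^ 2 = h 0 - h δ := by
    rw [nrm_sq, hh]
    simp only [hP0]
    rw [← integral_sub (integrable_mul_cpt hfc hφ1.continuous hfs)
      (integrable_mul_cpt hfc (hPc δ) hfs)]
    congr 1
    ext x
    simp only [hf]
    ring
  have hfin : nrm f * nrm f ≤ nrm f * (n * C / s * (δ ^ s * N)) := by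
    have : A * δ ^ s = nrm f * (n * C / s * (δ ^ s * N)) := by
      rw [hA]
      ring
    rw [← sq, ← this]
    linarith
  rcases (nrm_nonneg f).eq_or_lt with h0 | h0
  · rw [← h0]
    positivity
  · exact le_of_mul_le_mul_left hfin h0

lemma sq_integral_smoothing_le {θ φ : (Fin n → ℝ) → ℝ} (hθ : Continuous θ)
    (hθs : HasCompactSupport θ) (hφ : Continuous φ) (hφs : HasCompactSupport φ) {δ : ℝ}
    (hδ : 0 < δ) (x : Fin n → ℝ) :
    |∫ z, θ z * φ (x - δ • z)| ≤ nrm θ * (Real.sqrt (δ ^ n)⁻¹ * nrm φ) := by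
  have hs : HasCompactSupport fun z => φ (x - δ • z) := by
    obtain ⟨S, hS⟩ := hφs.isCompact.isBounded.subset_closedBall (0 : Fin n → ℝ)
    refine HasCompactSupport.intro (isCompact_closedBall 0 ((S + ‖x‖) / δ)) fun z hz => ?_
    by_contra h
    have h1 := hS (subset_tsupport φ (Function.mem_support.2 h))
    rw [mem_closedBall_zero_iff] at h1
    refine hz ?_
    rw [mem_closedBall_zero_iff, le_div_iff₀ hδ]
    have h2 : ‖δ • z‖ ≤ ‖x‖ + ‖x - δ • z‖ := by
      simpa using norm_sub_le x (x - δ • z)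
    rw [norm_smul, Real.norm_eq_abs, abs_of_pos hδ] at h2
    linarith
  refine (integral_mul_sq_le (g := fun z => φ (x - δ • z)) hθ
    (hφ.comp (by fun_prop)) hθs hs).trans ?_
  have e : ∫ z, φ (x - δ • z) ^ 2 = (δ ^ n)⁻¹ * ∫ z, φ z ^ 2 := by
    have h1 := Measure.integral_comp_smul (volume : Measure (Fin n → ℝ))
      (fun z => φ (x - z) ^ 2) δ
    rw [h1, integral_sub_left_eq_self (fun z => φ z ^ 2)]
    simp [abs_of_pos hδ]
  rw [e, Real.sqrt_mul (by positivity)]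
  rfl

lemma volume_le_abs_le {f : (Fin n → ℝ) → ℝ} (hf : Continuous f) (hfs : HasCompactSupport f)
    {t : ℝ} (ht : 0 < t) : volume {x | t ≤ |f x|} ≤ ENNReal.ofReal (nrm f ^ 2 / t ^ 2) := by
  have h := mul_meas_ge_le_integral_of_nonneg (μ := (volume : Measure (Fin n → ℝ)))
    (Eventually.of_forall fun x => sq_nonneg (f x)) (integrable_sq hf hfs) (t ^ 2)
  have e : {x | t ^ 2 ≤ f x ^ 2} = {x | t ≤ |f x|} := by
    ext x
    simp only [Set.mem_ofPred_eq]
    rw [sq_le_sq, abs_of_pos ht]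
  rw [e, ← nrm_sq] at h
  have hfin : volume {x | t ≤ |f x|} ≠ ⊤ := by
    refine ne_top_of_le_ne_top hfs.isCompact.measure_lt_top.ne (measure_mono fun x hx => ?_)
    refine subset_tsupport f fun h0 => ?_
    rw [Set.mem_ofPred_eq, h0, abs_zero] at hx
    exact absurd ht (not_lt.2 hx)
  rw [← ENNReal.ofReal_toReal hfin]
  refine ENNReal.ofReal_le_ofReal ?_
  rw [le_div_iff₀ (by positivity)]
  rw [measureReal_def] at h
  linarith

/-- Layer-cake integration of a weak-type decay that is better than quadratic. -/
lemma exists_integral_rpow_le {κ L A : ℝ} (hκ : 0 < κ) (hL : 0 < L) (hA : 0 ≤ A) :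
    ∃ C : ℝ, 0 ≤ C ∧ ∀ φ : (Fin n → ℝ) → ℝ, Continuous φ →
      (∀ t, 0 < t → volume {x | t < |φ x|} ≤ ENNReal.ofReal (1 / t ^ 2)) →
      (∀ t, L < t → volume {x | t < |φ x|} ≤ ENNReal.ofReal (A * t ^ (-2 - 2 * κ))) →
      ∫ x, |φ x| ^ (2 + κ) ≤ C := by
  set J1 := ∫⁻ t in Set.Ioc 0 L, ENNReal.ofReal (t ^ (κ - 1)) with hJ1
  set J2 := ∫⁻ t in Set.Ioi L, ENNReal.ofReal (A * t ^ (-1 - κ)) with hJ2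
  have h1 : J1 ≠ ⊤ := by
    have h : IntegrableOn (fun t : ℝ => t ^ (κ - 1)) (Set.Ioc 0 L) := by
      rw [← intervalIntegrable_iff_integrableOn_Ioc_of_le hL.le]
      exact intervalIntegral.intervalIntegrable_rpow' (by linarith)
    exact h.lintegral_lt_top.ne
  have h2 : J2 ≠ ⊤ :=
    ((integrableOn_Ioi_rpow_of_lt (a := -1 - κ) (by linarith) hL).const_mul A).lintegral_lt_top.ne
  refine ⟨(ENNReal.ofReal (2 + κ) * (J1 + J2)).toReal, ENNReal.toReal_nonneg,
    fun φ hφ hw1 hw2 => ?_⟩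
  rw [integral_eq_lintegral_of_nonneg_ae
    (Eventually.of_forall fun x => Real.rpow_nonneg (abs_nonneg _) _)
    ((hφ.abs.rpow_const fun x => Or.inr (by linarith)).aestronglyMeasurable)]
  refine ENNReal.toReal_mono (ENNReal.mul_ne_top ENNReal.ofReal_ne_top
    (ENNReal.add_ne_top.2 ⟨h1, h2⟩)) ?_
  rw [lintegral_rpow_eq_lintegral_meas_lt_mul _ (Eventually.of_forall fun x => abs_nonneg _)
    hφ.abs.aemeasurable (by linarith)]
  gcongr
  rw [← Set.Ioc_union_Ioi_eq_Ioi hL.le, lintegral_union measurableSet_Ioi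
    (Set.Ioc_disjoint_Ioi le_rfl)]
  refine add_le_add (setLIntegral_mono' measurableSet_Ioc fun t ht => ?_)
    (setLIntegral_mono' measurableSet_Ioi fun t ht => ?_)
  · refine (mul_le_mul_left (hw1 t ht.1) _).trans_eq ?_
    rw [← ENNReal.ofReal_mul (by positivity)]
    congr 1
    have ht0 : 0 < t := ht.1
    rw [show (2 + κ - 1 : ℝ) = (κ - 1) + (2 : ℕ) by push_cast; ring, Real.rpow_add ht0,
      Real.rpow_natCast]
    field_simp
  · have ht0 : 0 < t := hL.trans ht
    refine (mul_le_mul_left (hw2 t ht) _).trans_eq ?_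
    rw [← ENNReal.ofReal_mul (by positivity)]
    congr 1
    rw [mul_assoc, ← Real.rpow_add ht0]
    congr 2
    ring

lemma xnrm_const_mul (b : Fin m → (Fin n → ℝ) → (Fin n → ℝ)) {φ : (Fin n → ℝ) → ℝ}
    (hφ : Differentiable ℝ φ) (t : ℝ) : xnrm b (fun x => t * φ x) = |t| * xnrm b φ := by
  have e : ∀ i x, Xop (b i) (fun x => t * φ x) x = t * Xop (b i) φ x := fun i x => by
    unfold Xop
    rw [fderiv_const_mul (hφ x)]
    rfl
  unfold xnrm
  simp only [e, mul_pow, integral_const_mul, ← Finset.mul_sum, ← mul_add]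
  rw [Real.sqrt_mul (sq_nonneg t), Real.sqrt_sq_eq_abs]

/-- Sobolev inequality for a Hörmander system, with some exponent above `2`. -/
theorem exists_sobolev {V K : Set (Fin n → ℝ)}
    {b : Fin m → (Fin n → ℝ) → (Fin n → ℝ)}
    (hb : ∀ i, ContDiff ℝ (⊤ : ℕ∞) (b i)) (hbs : ∀ i, HasCompactSupport (b i))
    (hH : Hormander V b) (hK : IsCompact K) (hKV : K ⊆ V) :
    ∃ q : ℝ, 2 < q ∧ ∃ C : ℝ, 0 ≤ C ∧ ∀ φ : (Fin n → ℝ) → ℝ,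
      ContDiff ℝ 2 φ → tsupport φ ⊆ K → ∫ x, |φ x| ^ q ≤ C * xnrm b φ ^ q := by
  have χ : ContDiffBump (0 : Fin n → ℝ) := ⟨1, 2, by norm_num, by norm_num⟩
  set θ : (Fin n → ℝ) → ℝ := χ.normed volume with hθdef
  have hθ : ContDiff ℝ (⊤ : ℕ∞) θ := χ.contDiff_normed
  have hθs : HasCompactSupport θ := χ.hasCompactSupport_normed
  obtain ⟨s, hs0, C, hC0, hC⟩ := exists_nrm_sub_smoothing_le hb hbs hH hK hKV hθ hθs
    χ.integral_normed
  set d : ℝ := n + 1 with hd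
  have hd0 : 0 < d := by positivity
  set κ := 2 * s / d with hκ
  have hκ0 : 0 < κ := by positivity
  have hL : 0 < nrm θ + 1 := by linarith [nrm_nonneg θ]
  set L := nrm θ + 1 with hLdef
  obtain ⟨Q, hQ0, hQ⟩ := exists_integral_rpow_le (n := n) (A := C ^ 2 * L ^ (2 + 2 * κ)) hκ0 hL
    (by positivity)
  have key : ∀ φ : (Fin n → ℝ) → ℝ, ContDiff ℝ 2 φ → tsupport φ ⊆ K → xnrm b φ ≤ 1 →
      ∫ x, |φ x| ^ (2 + κ) ≤ Q := by
    intro φ hφ hφK hN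
    have hφs : HasCompactSupport φ := hK.of_isClosed_subset (isClosed_tsupport φ) hφK
    have hn1 : nrm φ ≤ 1 := (nrm_le_xnrm b φ).trans hN
    refine hQ φ hφ.continuous (fun t ht => ?_) fun t ht => ?_
    · refine (measure_mono fun x (hx : t < |φ x|) => hx.le).trans
        ((volume_le_abs_le hφ.continuous hφs ht).trans (ENNReal.ofReal_le_ofReal ?_))
      gcongr
      exact pow_le_one₀ (nrm_nonneg φ) hn1
    · have ht0 : 0 < t := hL.trans ht
      set τ := t / L with hτ
      have hτ1 : 1 ≤ τ := (one_le_div hL).2 ht.le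
      have hτ0 : 0 < τ := one_pos.trans_le hτ1
      set δ := τ ^ (-(2 / d)) with hδ
      have hδ0 : 0 < δ := Real.rpow_pos_of_pos hτ0 _
      have hδ1 : δ ≤ 1 := Real.rpow_le_one_of_one_le_of_nonpos hτ1 (by
        have : 0 < 2 / d := by positivity
        linarith)
      have hδn : Real.sqrt (δ ^ n)⁻¹ ≤ τ := by
        rw [Real.sqrt_le_left hτ0.le, hδ, ← Real.rpow_natCast, ← Real.rpow_mul hτ0.le,
          ← Real.rpow_neg hτ0.le, ← Real.rpow_natCast]
        refine Real.rpow_le_rpow_of_exponent_le hτ1 ?_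
        have : 2 / d * n ≤ 2 := by
          rw [div_mul_eq_mul_div, div_le_iff₀ hd0, hd]
          linarith
        push_cast
        linarith
      have hP : ∀ x, |∫ z, θ z * φ (x - δ • z)| ≤ nrm θ * τ := fun x => by
        refine (sq_integral_smoothing_le hθ.continuous hθs hφ.continuous hφs hδ0 x).trans ?_
        have := nrm_nonneg θ
        gcongr
        calc _ ≤ τ * 1 := by
              have := nrm_nonneg φ
              gcongr
          _ = τ := mul_one τ
      set f : (Fin n → ℝ) → ℝ := fun x => φ x - ∫ z, θ z * φ (x - δ • z) with hf
      have hfc : Continuous f := hφ.continuous.sub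
        ((isKer_snd hθ hθs).continuous_kerOp hφ.continuous δ)
      have hfs : HasCompactSupport f := hφs.sub ((isKer_snd hθ hθs).hasCompactSupport_kerOp hφs δ)
      have hsub : {x | t < |φ x|} ⊆ {x | τ ≤ |f x|} := by
        intro x hx
        simp only [Set.mem_ofPred_eq] at hx ⊢
        have h1 := hP x
        have h2 : |φ x| ≤ |f x| + |∫ z, θ z * φ (x - δ • z)| := by
          have : φ x = f x + ∫ z, θ z * φ (x - δ • z) := by simp [hf]
          nth_rewrite 1 [this]
          exact abs_add_le _ _
        have h3 : t = nrm θ * τ + τ := by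
          have h4 : t = L * τ := by
            rw [hτ]
            field_simp
          rw [h4, hLdef]
          ring
        linarith
      refine (measure_mono hsub).trans ((volume_le_abs_le hfc hfs hτ0).trans
        (ENNReal.ofReal_le_ofReal ?_))
      have hnf : nrm f ≤ C * δ ^ s := by
        refine (hC δ hδ0 hδ1 φ hφ hφK).trans ?_
        have : 0 ≤ δ ^ s := by positivity
        calc _ ≤ C * (δ ^ s * 1) := by gcongr
          _ = _ := by rw [mul_one]
      have hδs : δ ^ s = τ ^ (-κ) := by
        rw [hδ, ← Real.rpow_mul hτ0.le, hκ]
        congr 1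
        ring
      rw [hδs] at hnf
      calc nrm f ^ 2 / τ ^ 2 ≤ (C * τ ^ (-κ)) ^ 2 / τ ^ 2 := by
            have := nrm_nonneg f
            gcongr
        _ = C ^ 2 * τ ^ (-2 - 2 * κ) := by
            rw [mul_pow, ← Real.rpow_natCast (τ ^ (-κ)), ← Real.rpow_mul hτ0.le,
              ← Real.rpow_natCast τ, mul_div_assoc, ← Real.rpow_sub hτ0]
            congr 2
            push_cast
            ring
        _ = C ^ 2 * L ^ (2 + 2 * κ) * t ^ (-2 - 2 * κ) := by
            rw [hτ, Real.div_rpow ht0.le hL.le, show (-2 - 2 * κ) = -(2 + 2 * κ) by ring,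
              Real.rpow_neg hL.le]
            field_simp
  refine ⟨2 + κ, by linarith, Q, hQ0, fun φ hφ hφK => ?_⟩
  have hφs : HasCompactSupport φ := hK.of_isClosed_subset (isClosed_tsupport φ) hφK
  rcases (xnrm_nonneg b φ).eq_or_lt with h0 | h0
  · have h1 : ∫ x, φ x ^ 2 = 0 := by
      rw [← nrm_sq, le_antisymm ((nrm_le_xnrm b φ).trans h0.ge) (nrm_nonneg φ)]
      norm_num
    have h3 : ∀ x, φ x = 0 := by
      intro x
      by_contra hx
      exact (Continuous.integral_pos_of_hasCompactSupport_nonneg_nonzero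
        (μ := (volume : Measure (Fin n → ℝ))) (f := fun x => φ x ^ 2) (x := x)
        (hφ.continuous.pow 2) (hasCompactSupport_sq hφs) (fun x => sq_nonneg _)
        (pow_ne_zero 2 hx)).ne' h1
    simp [h3, Real.zero_rpow (by linarith : 2 + κ ≠ 0), ← h0]
  · set N := xnrm b φ with hN
    have h := key (fun x => N⁻¹ * φ x) (contDiff_const.mul hφ)
      ((tsupport_mul_subset_right (f := fun _ => N⁻¹) (g := φ)).trans hφK)
      (by rw [xnrm_const_mul b (hφ.differentiable two_ne_zero), abs_of_pos (inv_pos.2 h0),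
          inv_mul_cancel₀ h0.ne'])
    have e : ∀ x, |N⁻¹ * φ x| ^ (2 + κ) = (N ^ (2 + κ))⁻¹ * |φ x| ^ (2 + κ) := fun x => by
      rw [abs_mul, abs_of_pos (inv_pos.2 h0), Real.mul_rpow (inv_pos.2 h0).le (abs_nonneg _),
        Real.inv_rpow h0.le]
    simp only [e, integral_const_mul] at h
    rwa [inv_mul_le_iff₀ (Real.rpow_pos_of_pos h0 _), mul_comm] at h

end SubellipticGain

section TwoConvexAlgebra

variable {n m : ℕ}

lemma two_mul_esymmF_two (lam : Fin m → ℝ) :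
    2 * esymmF 2 lam = (∑ i, lam i) ^ 2 - ∑ i, lam i ^ 2 := by
  have h := congrArg (MvPolynomial.aeval lam) (MvPolynomial.mul_esymm_eq_sum (Fin m) ℝ 2)
  have e : (Finset.HasAntidiagonal.antidiagonal 2).filter (fun a : ℕ × ℕ => a.1 < 2) =
      ({(0, 2), (1, 1)} : Finset (ℕ × ℕ)) := by
    decide
  rw [e] at h
  simp [MvPolynomial.esymm, MvPolynomial.psum, Finset.powersetCard_one] at h
  unfold esymmF
  rw [h]
  ring

lemma esymmF_one (lam : Fin m → ℝ) : esymmF 1 lam = ∑ i, lam i := by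
  simp [esymmF, Finset.powersetCard_one]

lemma sum_sq_eq_sum_sq_eigenvalues {A : Matrix (Fin m) (Fin m) ℝ} (hA : A.IsHermitian) :
    ∑ i, ∑ j, A i j ^ 2 = ∑ i, hA.eigenvalues i ^ 2 := by
  have h1 : ∑ i, ∑ j, A i j ^ 2 = (A * A).trace := by
    simp only [Matrix.trace, Matrix.diag_apply, Matrix.mul_apply]
    refine Finset.sum_congr rfl fun i _ => Finset.sum_congr rfl fun j _ => ?_
    have := hA.apply i j
    simp only [star_trivial] at this
    rw [this, sq]
  rw [h1]
  have h2 := hA.spectral_theorem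
  set U := hA.eigenvectorUnitary
  set D : Matrix (Fin m) (Fin m) ℝ := Matrix.diagonal (RCLike.ofReal ∘ hA.eigenvalues) with hD
  have h3 : A * A = (Unitary.conjStarAlgAut ℝ (Matrix (Fin m) (Fin m) ℝ) U) (D * D) := by
    rw [map_mul, ← h2]
  rw [h3, Unitary.conjStarAlgAut_apply, Matrix.trace_mul_cycle, Unitary.coe_star_mul_self, one_mul,
    hD, Matrix.diagonal_mul_diagonal, Matrix.trace_diagonal]
  simp [sq]

/-- The trace of the symmetric Hessian. -/
lemma sum_hessEig (b : Fin m → (Fin n → ℝ) → (Fin n → ℝ)) (u : (Fin n → ℝ) → ℝ) (x : Fin n → ℝ) :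
    ∑ i, hessEig b u x i = subLap b u x := by
  have h := (symmHess_isHermitian b u x).trace_eq_sum_eigenvalues
  simp only [RCLike.ofReal_real_eq_id, id] at h
  unfold hessEig
  rw [← h, Matrix.trace, subLap]
  refine Finset.sum_congr rfl fun i _ => ?_
  rw [Matrix.diag_apply, symmHess]
  ring

lemma sum_sq_symmHess_eq (b : Fin m → (Fin n → ℝ) → (Fin n → ℝ)) (u : (Fin n → ℝ) → ℝ)
    (x : Fin n → ℝ) :
    ∑ i, ∑ j, symmHess b u x i j ^ 2 = ∑ i, hessEig b u x i ^ 2 :=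
  sum_sq_eq_sum_sq_eigenvalues _

lemma IsKConvex.subLap_nonneg {V : Set (Fin n → ℝ)} {b : Fin m → (Fin n → ℝ) → (Fin n → ℝ)}
    {u : (Fin n → ℝ) → ℝ} (h : IsKConvex V b 2 u) {x : Fin n → ℝ} (hx : x ∈ V) :
    0 ≤ subLap b u x := by
  have := h x hx 1 le_rfl one_le_two
  rwa [esymmF_one, sum_hessEig] at this

lemma IsKConvex.sum_sq_symmHess_le {V : Set (Fin n → ℝ)}
    {b : Fin m → (Fin n → ℝ) → (Fin n → ℝ)}
    {u : (Fin n → ℝ) → ℝ} (h : IsKConvex V b 2 u) {x : Fin n → ℝ} (hx : x ∈ V) :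
    ∑ i, ∑ j, symmHess b u x i j ^ 2 ≤ subLap b u x ^ 2 := by
  have h1 := h x hx 2 one_le_two le_rfl
  have h2 := two_mul_esymmF_two (hessEig b u x)
  rw [sum_hessEig] at h2
  rw [sum_sq_symmHess_eq]
  linarith

/-- Squared length of the horizontal gradient. -/
noncomputable def gradSq (b : Fin m → (Fin n → ℝ) → (Fin n → ℝ)) (u : (Fin n → ℝ) → ℝ) (x : Fin n → ℝ) : ℝ :=
  ∑ i, Xop (b i) u x ^ 2

/-- Sum of the squares of all commutators. -/
noncomputable def commSq (b : Fin m → (Fin n → ℝ) → (Fin n → ℝ)) (u : (Fin n → ℝ) → ℝ) (x : Fin n → ℝ) : ℝ :=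
  ∑ i, ∑ j, commOp b i j u x ^ 2

lemma gradSq_nonneg (b : Fin m → (Fin n → ℝ) → (Fin n → ℝ)) (u : (Fin n → ℝ) → ℝ)
    (x : Fin n → ℝ) : 0 ≤ gradSq b u x :=
  Finset.sum_nonneg fun _ _ => sq_nonneg _

lemma commSq_nonneg (b : Fin m → (Fin n → ℝ) → (Fin n → ℝ)) (u : (Fin n → ℝ) → ℝ)
    (x : Fin n → ℝ) : 0 ≤ commSq b u x :=
  Finset.sum_nonneg fun _ _ => Finset.sum_nonneg fun _ _ => sq_nonneg _

lemma commSq_le_quadratic {V : Set (Fin n → ℝ)} {b : Fin m → (Fin n → ℝ) → (Fin n → ℝ)}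
    {u : (Fin n → ℝ) → ℝ} (h : IsKConvex V b 2 u) {x : Fin n → ℝ} (hx : x ∈ V) :
    3 / 4 * commSq b u x ≤ ∑ i, ∑ j,
      (Xop (b i) (Xop (b i) u) x * Xop (b j) (Xop (b j) u) x
        - Xop (b j) (Xop (b i) u) x * (2 * Xop (b i) (Xop (b j) u) x
          - Xop (b j) (Xop (b i) u) x)) := by
  have h1 := h.sum_sq_symmHess_le hx
  have h2 : ∑ i, ∑ j, Xop (b j) (Xop (b i) u) x ^ 2 = ∑ i, ∑ j, Xop (b i) (Xop (b j) u) x ^ 2 :=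
    Finset.sum_comm
  set a : Fin m → Fin m → ℝ := fun i j => Xop (b i) (Xop (b j) u) x with ha
  have h4 : ∑ i, ∑ j, symmHess b u x i j ^ 2 =
      (1 / 2) * ∑ i, ∑ j, a i j ^ 2 + (1 / 2) * ∑ i, ∑ j, a i j * a j i := by
    have : ∀ i j, symmHess b u x i j ^ 2 =
        (1 / 4) * a i j ^ 2 + (1 / 4) * a j i ^ 2 + (1 / 2) * (a i j * a j i) := fun i j => by
      simp only [symmHess, ha]
      ring
    simp only [this, Finset.sum_add_distrib, ← Finset.mul_sum]
    rw [h2]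
    ring
  have h5 : commSq b u x = 2 * ∑ i, ∑ j, a i j ^ 2 - 2 * ∑ i, ∑ j, a i j * a j i := by
    have : ∀ i j, commOp b i j u x ^ 2 =
        a i j ^ 2 + a j i ^ 2 - 2 * (a i j * a j i) := fun i j => by
      simp only [commOp, ha]
      ring
    simp only [commSq, this, Finset.sum_add_distrib, Finset.sum_sub_distrib, ← Finset.mul_sum]
    rw [h2]
    ring
  have h6 : ∑ i, ∑ j, (a i i * a j j - a j i * (2 * a i j - a j i)) =
      subLap b u x ^ 2 - 2 * ∑ i, ∑ j, a i j * a j i + ∑ i, ∑ j, a i j ^ 2 := by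
    have : ∀ i j, a i i * a j j - a j i * (2 * a i j - a j i) =
        a i i * a j j - 2 * (a i j * a j i) + a j i ^ 2 := fun i j => by ring
    simp only [this, Finset.sum_add_distrib, Finset.sum_sub_distrib, ← Finset.mul_sum]
    rw [h2, ← Finset.sum_mul, sq]
    rfl
  rw [h6]
  linarith

end TwoConvexAlgebra

section WeakCommutation

variable {n m : ℕ}

lemma exists_contDiff_norm_fderiv_sub_le {w : (Fin n → ℝ) → ℝ} (hw : ContDiff ℝ 1 w)
    (hws : HasCompactSupport w) {ε : ℝ} (hε : 0 < ε) :
    ∃ v : (Fin n → ℝ) → ℝ, ContDiff ℝ (⊤ : ℕ∞) v ∧ ∀ x, ‖fderiv ℝ v x - fderiv ℝ w x‖ ≤ ε := by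
  have hc := hw.continuous_fderiv one_ne_zero
  have hu : UniformContinuous (fderiv ℝ w) :=
    (hws.fderiv (𝕜 := ℝ)).uniformContinuous_of_continuous hc
  obtain ⟨r, hr0, hr⟩ := Metric.uniformContinuous_iff.1 hu ε hε
  let φ : ContDiffBump (0 : Fin n → ℝ) := ⟨r / 2, r, by positivity, by linarith⟩
  refine ⟨convolution (φ.normed volume) w (ContinuousLinearMap.lsmul ℝ ℝ) volume,
    φ.hasCompactSupport_normed.contDiff_convolution_left _ φ.contDiff_normed
      hw.continuous.locallyIntegrable, fun x => ?_⟩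
  have hd := hws.hasFDerivAt_convolution_right (ContinuousLinearMap.lsmul ℝ ℝ)
    (μ := (volume : Measure (Fin n → ℝ))) (f := φ.normed volume)
    φ.continuous_normed.locallyIntegrable hw x
  rw [hd.fderiv]
  have h2 := φ.dist_normed_convolution_le (μ := (volume : Measure (Fin n → ℝ)))
    (g := fderiv ℝ w) (x₀ := x) (ε := ε) hc.aestronglyMeasurable
    fun y hy => (hr (Metric.mem_ball.1 hy)).le
  rw [dist_eq_norm] at h2
  exact h2

lemma integral_fderiv_apply_eq_zero {e : (Fin n → ℝ) → (Fin n → ℝ)} (he : Continuous e)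
    (hes : HasCompactSupport e)
    (h : ∀ v : (Fin n → ℝ) → ℝ, ContDiff ℝ (⊤ : ℕ∞) v → ∫ x, fderiv ℝ v x (e x) = 0)
    {w : (Fin n → ℝ) → ℝ} (hw : ContDiff ℝ 1 w) : ∫ x, fderiv ℝ w x (e x) = 0 := by
  have hInt : ∀ v : (Fin n → ℝ) → ℝ, ContDiff ℝ 1 v →
      Integrable fun x => fderiv ℝ v x (e x) := fun v hv => by
    refine ((hv.continuous_fderiv one_ne_zero).clm_apply he).integrable_of_hasCompactSupport ?_
    refine hes.mono fun x hx => ?_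
    contrapose! hx
    simp only [Function.mem_support, not_not] at hx ⊢
    rw [hx, map_zero]
  obtain ⟨χ, hχ, hχs, -, hχ1, -⟩ := exists_smooth_cutoff (V := Set.univ) hes.isCompact isOpen_univ
    (Set.subset_univ _)
  set w' : (Fin n → ℝ) → ℝ := fun x => χ x * w x with hw'
  have hw'1 : ContDiff ℝ 1 w' := (hχ.of_le (by exact_mod_cast le_top)).mul hw
  have hw's : HasCompactSupport w' := hχs.mul_right
  have e1 : ∀ x, fderiv ℝ w x (e x) = fderiv ℝ w' x (e x) := fun x => by
    by_cases hx : x ∈ tsupport e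
    · have : w' =ᶠ[𝓝 x] w := by
        filter_upwards [eventually_nhdsSet_iff_forall.1 hχ1 x hx] with y hy
        simp only [hw', hy, one_mul]
      rw [this.fderiv_eq]
    · rw [image_eq_zero_of_notMem_tsupport hx, map_zero, map_zero]
  simp only [e1]
  have hI : 0 ≤ ∫ x, ‖e x‖ := integral_nonneg fun x => norm_nonneg _
  refine abs_eq_zero.1 (le_antisymm (le_of_forall_pos_le_add fun ε hε => ?_) (abs_nonneg _))
  obtain ⟨v, hv, hvε⟩ := exists_contDiff_norm_fderiv_sub_le hw'1 hw's
    (ε := ε / ((∫ x, ‖e x‖) + 1)) (by positivity)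
  have h1 : ∫ x, fderiv ℝ w' x (e x) = -∫ x, (fderiv ℝ v x (e x) - fderiv ℝ w' x (e x)) := by
    rw [integral_sub (hInt v (hv.of_le (by exact_mod_cast le_top))) (hInt w' hw'1), h v hv]
    ring
  rw [h1, abs_neg, ← Real.norm_eq_abs, zero_add]
  refine (norm_integral_le_of_norm_le (g := fun x => ε / ((∫ x, ‖e x‖) + 1) * ‖e x‖)
    ((he.norm.integrable_of_hasCompactSupport hes.norm).const_mul _)
    (Eventually.of_forall fun x => ?_)).trans ?_
  · rw [← _root_.sub_apply]
    exact (ContinuousLinearMap.le_opNorm _ _).trans (by gcongr; exact hvε x)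
  · rw [integral_const_mul, div_mul_eq_mul_div, div_le_iff₀ (by positivity)]
    nlinarith

/-- Integration by parts against a field that is divergence free on the support. -/
lemma integral_xop_mul_of_divf {c : (Fin n → ℝ) → (Fin n → ℝ)} {G H : (Fin n → ℝ) → ℝ}
    {V : Set (Fin n → ℝ)} (hc : ContDiff ℝ 1 c) (hcV : ∀ x ∈ V, divf c x = 0)
    (hG : ContDiff ℝ 1 G) (hH : ContDiff ℝ 1 H) (hHs : HasCompactSupport H)
    (hHV : tsupport H ⊆ V) :
    ∫ x, Xop c G x * H x = -∫ x, G x * Xop c H x := by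
  rw [integral_xop_mul hc hG hH hHs, sub_eq_self]
  refine integral_eq_zero_of_ae (Eventually.of_forall fun x => ?_)
  by_cases hx : x ∈ tsupport H
  · simp [hcV x (hHV hx)]
  · simp [image_eq_zero_of_notMem_tsupport hx]

lemma DivFree.divf_eq_zero {V : Set (Fin n → ℝ)} {b : Fin m → (Fin n → ℝ) → (Fin n → ℝ)}
    (h : DivFree V b) (i : Fin m) {x : Fin n → ℝ} (hx : x ∈ V) : divf (b i) x = 0 :=
  h i x hx

/-- Weak form of `X_i X_j v - X_j X_i v = [X_i, X_j] v` for smooth `v`. -/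
lemma integral_xop_mul_xop_sub_of_contDiff {V : Set (Fin n → ℝ)}
    {c d : (Fin n → ℝ) → (Fin n → ℝ)}
    (hc : ContDiff ℝ (⊤ : ℕ∞) c) (hd : ContDiff ℝ (⊤ : ℕ∞) d)
    (hcV : ∀ x ∈ V, divf c x = 0) (hdV : ∀ x ∈ V, divf d x = 0)
    {f v : (Fin n → ℝ) → ℝ} (hf : ContDiff ℝ 1 f) (hfs : HasCompactSupport f)
    (hfV : tsupport f ⊆ V) (hv : ContDiff ℝ 2 v) :
    ∫ x, (Xop c f x * Xop d v x - Xop d f x * Xop c v x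
      + f x * Xop (fun y => vfBracket c d y) v x) = 0 := by
  have h1 : (1 : WithTop ℕ∞) ≤ ((⊤ : ℕ∞) : WithTop ℕ∞) := by exact_mod_cast le_top
  have hXf : ∀ {a : (Fin n → ℝ) → (Fin n → ℝ)}, ContDiff ℝ (⊤ : ℕ∞) a → Continuous (Xop a f) :=
    fun ha => (hf.continuous_fderiv one_ne_zero).clm_apply ha.continuous
  have hXv : ∀ {a : (Fin n → ℝ) → (Fin n → ℝ)}, ContDiff ℝ (⊤ : ℕ∞) a → ContDiff ℝ 1 (Xop a v) :=
    fun ha => contDiff_xop (ha.of_le h1) hv (by norm_num)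
  have hXXv : ∀ {a a' : (Fin n → ℝ) → (Fin n → ℝ)}, ContDiff ℝ (⊤ : ℕ∞) a →
      ContDiff ℝ (⊤ : ℕ∞) a' → Continuous (Xop a (Xop a' v)) := fun ha ha' =>
    ((hXv ha').continuous_fderiv one_ne_zero).clm_apply ha.continuous
  have hp : ∀ {a a' : (Fin n → ℝ) → (Fin n → ℝ)}, ContDiff ℝ (⊤ : ℕ∞) a →
      ContDiff ℝ (⊤ : ℕ∞) a' → (∀ x ∈ V, divf a x = 0) →
      ∫ x, Xop a f x * Xop a' v x = -∫ x, f x * Xop a (Xop a' v) x := fun {a a'} ha ha' haV => by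
    have := integral_xop_mul_of_divf (ha.of_le h1) haV (hXv ha') hf hfs hfV
    simp only [mul_comm (f _)]
    rw [this, neg_neg]
    simp only [mul_comm]
  have i1 : Integrable fun x => Xop c f x * Xop d v x :=
    integrable_mul_cpt (hXf hc) (hXv hd).continuous (hasCompactSupport_xop c hfs)
  have i2 : Integrable fun x => Xop d f x * Xop c v x :=
    integrable_mul_cpt (hXf hd) (hXv hc).continuous (hasCompactSupport_xop d hfs)
  have e2 : ∀ x, f x * Xop (fun y => vfBracket c d y) v x =
      f x * Xop c (Xop d v) x - f x * Xop d (Xop c v) x := fun x => by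
    rw [← xop_comm (hc.differentiable (by simp) x) (hd.differentiable (by simp) x)
      hv.contDiffAt, mul_sub]
  simp only [e2]
  have i3 : Integrable fun x => f x * Xop c (Xop d v) x :=
    integrable_mul_cpt hf.continuous (hXXv hc hd) hfs
  have i4 : Integrable fun x => f x * Xop d (Xop c v) x :=
    integrable_mul_cpt hf.continuous (hXXv hd hc) hfs
  have i12 : Integrable fun x => Xop c f x * Xop d v x - Xop d f x * Xop c v x := i1.sub i2
  have i34 : Integrable fun x => f x * Xop c (Xop d v) x - f x * Xop d (Xop c v) x := i3.sub i4
  rw [integral_add i12 i34, integral_sub i1 i2, integral_sub i3 i4,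
    hp hc hd hcV, hp hd hc hdV]
  ring

/-- Weak form of `X_i X_j w - X_j X_i w = [X_i, X_j] w` for `w` of class `C¹`. -/
lemma integral_xop_mul_xop_sub {V : Set (Fin n → ℝ)} {c d : (Fin n → ℝ) → (Fin n → ℝ)}
    (hc : ContDiff ℝ (⊤ : ℕ∞) c) (hd : ContDiff ℝ (⊤ : ℕ∞) d)
    (hcV : ∀ x ∈ V, divf c x = 0) (hdV : ∀ x ∈ V, divf d x = 0)
    {f w : (Fin n → ℝ) → ℝ} (hf : ContDiff ℝ 1 f) (hfs : HasCompactSupport f)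
    (hfV : tsupport f ⊆ V) (hw : ContDiff ℝ 1 w) :
    ∫ x, (Xop c f x * Xop d w x - Xop d f x * Xop c w x
      + f x * Xop (fun y => vfBracket c d y) w x) = 0 := by
  have hXf : ∀ {a : (Fin n → ℝ) → (Fin n → ℝ)}, ContDiff ℝ (⊤ : ℕ∞) a → Continuous (Xop a f) :=
    fun ha => (hf.continuous_fderiv one_ne_zero).clm_apply ha.continuous
  have hec : Continuous fun x => Xop c f x • d x - Xop d f x • c x + f x • vfBracket c d x :=
    (((hXf hc).smul hd.continuous).sub ((hXf hd).smul hc.continuous)).add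
      (hf.continuous.smul (contDiff_vfBracket hc hd).continuous)
  have hes : HasCompactSupport
      fun x => Xop c f x • d x - Xop d f x • c x + f x • vfBracket c d x := by
    refine hfs.mono' fun x hx => ?_
    contrapose! hx
    have h1 : ∀ a : (Fin n → ℝ) → (Fin n → ℝ), Xop a f x = 0 := fun a =>
      image_eq_zero_of_notMem_tsupport fun h => hx (tsupport_xop_subset a f h)
    simp [h1, image_eq_zero_of_notMem_tsupport hx]
  have e1 : ∀ (w : (Fin n → ℝ) → ℝ) (x), Xop c f x * Xop d w x - Xop d f x * Xop c w x
      + f x * Xop (fun y => vfBracket c d y) w x =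
      fderiv ℝ w x (Xop c f x • d x - Xop d f x • c x + f x • vfBracket c d x) := fun w x => by
    rw [map_add, map_sub, map_smul, map_smul, map_smul]
    rfl
  simp_rw [e1]
  refine integral_fderiv_apply_eq_zero hec hes (fun v hv => ?_) hw
  simp_rw [← e1]
  exact integral_xop_mul_xop_sub_of_contDiff hc hd hcV hdV hf hfs hfV (hv.of_le two_le_top)

end WeakCommutation

section WeightedIdentity

variable {n m : ℕ} {V : Set (Fin n → ℝ)} {b : Fin m → (Fin n → ℝ) → (Fin n → ℝ)}
  {u : (Fin n → ℝ) → ℝ}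

lemma contDiff_xop_one (hb : ∀ i, ContDiff ℝ (⊤ : ℕ∞) (b i)) (hu : ContDiff ℝ 2 u) (i : Fin m) :
    ContDiff ℝ 1 (Xop (b i) u) :=
  contDiff_xop ((hb i).of_le (by exact_mod_cast le_top)) hu (by norm_num)

lemma continuous_xop {c : (Fin n → ℝ) → (Fin n → ℝ)} {f : (Fin n → ℝ) → ℝ}
    (hc : ContDiff ℝ (⊤ : ℕ∞) c) (hf : ContDiff ℝ 1 f) : Continuous (Xop c f) :=
  (hf.continuous_fderiv one_ne_zero).clm_apply hc.continuous

lemma vfBracket_swap (c d : (Fin n → ℝ) → (Fin n → ℝ)) (x : Fin n → ℝ) :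
    vfBracket c d x = -vfBracket d c x := by
  ext l
  simp [vfBracket]

lemma xop_vfBracket_swap (c d : (Fin n → ℝ) → (Fin n → ℝ)) (f : (Fin n → ℝ) → ℝ)
    (x : Fin n → ℝ) :
    Xop (fun y => vfBracket c d y) f x = -Xop (fun y => vfBracket d c y) f x := by
  rw [Xop, vfBracket_swap, map_neg]
  rfl

/-- Divergence structure of the quadratic Hessian operator, one pair of indices at a time. -/
lemma integral_pair_eq_zero (hb : ∀ i, ContDiff ℝ (⊤ : ℕ∞) (b i)) (hd : DivFree V b)
    (h2 : SecondCommVanish V b) (hu : ContDiff ℝ 2 u) {f : (Fin n → ℝ) → ℝ}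
    (hf : ContDiff ℝ 1 f) (hfs : HasCompactSupport f) (hfV : tsupport f ⊆ V) (i j : Fin m) :
    ∫ x, (Xop (b i) f x * Xop (b j) (Xop (b j) u) x - Xop (b j) f x *
      (2 * Xop (b i) (Xop (b j) u) x - Xop (b j) (Xop (b i) u) x)) = 0 := by
  have h1 : (1 : WithTop ℕ∞) ≤ ((⊤ : ℕ∞) : WithTop ℕ∞) := by exact_mod_cast le_top
  have hp := contDiff_xop_one hb hu
  have hD : ContDiff ℝ (⊤ : ℕ∞) (fun y => vfBracket (b j) (b i) y) :=
    contDiff_vfBracket (hb j) (hb i)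
  have hDu : ContDiff ℝ 1 (Xop (fun y => vfBracket (b j) (b i) y) u) :=
    contDiff_xop (hD.of_le h1) hu (by norm_num)
  have e1 := integral_xop_mul_xop_sub (hb i) (hb j) (fun x hx => hd.divf_eq_zero i hx)
    (fun x hx => hd.divf_eq_zero j hx) hf hfs hfV (hp j)
  have e2 := integral_xop_mul_of_divf ((hb j).of_le h1) (fun x hx => hd.divf_eq_zero j hx) hDu hf
    hfs hfV
  have e3 : ∀ x, f x * Xop (fun y => vfBracket (b i) (b j) y) (Xop (b j) u) x =
      -(Xop (b j) (Xop (fun y => vfBracket (b j) (b i) y) u) x * f x) := fun x => by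
    by_cases hx : x ∈ tsupport f
    · have h3 := xop_comm ((hb j).differentiable (by simp) x) (hD.differentiable (by simp) x)
        hu.contDiffAt
      have h4 : Xop (fun y => vfBracket (b j) (fun y => vfBracket (b j) (b i) y) y) u x = 0 := by
        rw [Xop, h2 j i x (hfV hx), map_zero]
      rw [h4, sub_eq_zero] at h3
      rw [xop_vfBracket_swap, h3]
      ring
    · simp [image_eq_zero_of_notMem_tsupport hx]
  have e4 : ∀ x, Xop (fun y => vfBracket (b j) (b i) y) u x =
      Xop (b j) (Xop (b i) u) x - Xop (b i) (Xop (b j) u) x := fun x =>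
    (xop_comm ((hb j).differentiable (by simp) x) ((hb i).differentiable (by simp) x)
        hu.contDiffAt).symm
  have i1 : Integrable fun x => Xop (b i) f x * Xop (b j) (Xop (b j) u) x :=
    integrable_mul_cpt (continuous_xop (hb i) hf) (continuous_xop (hb j) (hp j))
      (hasCompactSupport_xop _ hfs)
  have i2 : Integrable fun x => Xop (b j) f x * Xop (b i) (Xop (b j) u) x :=
    integrable_mul_cpt (continuous_xop (hb j) hf) (continuous_xop (hb i) (hp j))
      (hasCompactSupport_xop _ hfs)
  have i3 : Integrable fun x =>
      Xop (fun y => vfBracket (b j) (b i) y) u x * Xop (b j) f x := by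
    have := integrable_mul_cpt (continuous_xop (hb j) hf) hDu.continuous
      (hasCompactSupport_xop (b j) hfs)
    simpa only [mul_comm] using this
  have i4 : Integrable fun x => Xop (b j) (Xop (fun y => vfBracket (b j) (b i) y) u) x * f x := by
    have := integrable_mul_cpt hf.continuous (continuous_xop (hb j) hDu) hfs
    simpa only [mul_comm] using this
  have i12 : Integrable fun x => Xop (b i) f x * Xop (b j) (Xop (b j) u) x -
    Xop (b j) f x * Xop (b i) (Xop (b j) u) x := i1.sub i2
  have i5 : Integrable fun x =>
    -(Xop (b j) (Xop (fun y => vfBracket (b j) (b i) y) u) x * f x) := i4.neg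
  simp only [e3] at e1
  rw [integral_add i12 i5, integral_neg, e2, neg_neg, ← integral_add i12 i3] at e1
  rw [← e1]
  refine integral_congr_ae (Eventually.of_forall fun x => ?_)
  simp only [e4]
  ring

lemma integral_mul_quadratic (hb : ∀ i, ContDiff ℝ (⊤ : ℕ∞) (b i)) (hd : DivFree V b)
    (h2 : SecondCommVanish V b) (hu : ContDiff ℝ 2 u) {ψ : (Fin n → ℝ) → ℝ}
    (hψ : ContDiff ℝ 1 ψ) (hψs : HasCompactSupport ψ) (hψV : tsupport ψ ⊆ V) :
    ∫ x, ∑ i, ∑ j, (ψ x * (Xop (b i) (Xop (b i) u) x * Xop (b j) (Xop (b j) u) x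
        - Xop (b j) (Xop (b i) u) x * (2 * Xop (b i) (Xop (b j) u) x
          - Xop (b j) (Xop (b i) u) x))
      + Xop (b i) ψ x * Xop (b i) u x * Xop (b j) (Xop (b j) u) x
      - Xop (b j) ψ x * Xop (b i) u x * (2 * Xop (b i) (Xop (b j) u) x
          - Xop (b j) (Xop (b i) u) x)) = 0 := by
  have hp := contDiff_xop_one hb hu
  have e : ∀ i j x, ψ x * (Xop (b i) (Xop (b i) u) x * Xop (b j) (Xop (b j) u) x
        - Xop (b j) (Xop (b i) u) x * (2 * Xop (b i) (Xop (b j) u) x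
          - Xop (b j) (Xop (b i) u) x))
      + Xop (b i) ψ x * Xop (b i) u x * Xop (b j) (Xop (b j) u) x
      - Xop (b j) ψ x * Xop (b i) u x * (2 * Xop (b i) (Xop (b j) u) x
          - Xop (b j) (Xop (b i) u) x) =
      Xop (b i) (fun y => ψ y * Xop (b i) u y) x * Xop (b j) (Xop (b j) u) x -
        Xop (b j) (fun y => ψ y * Xop (b i) u y) x *
      (2 * Xop (b i) (Xop (b j) u) x - Xop (b j) (Xop (b i) u) x) := fun i j x => by
    have h1 := hψ.differentiable one_ne_zero x
    have h2 := (hp i).differentiable one_ne_zero x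
    rw [xop_mul h1 h2, xop_mul h1 h2]
    ring
  simp only [e]
  have hf : ∀ i, ContDiff ℝ 1 fun y => ψ y * Xop (b i) u y := fun i => hψ.mul (hp i)
  have hfs : ∀ i, HasCompactSupport fun y => ψ y * Xop (b i) u y := fun i => hψs.mul_right
  have hi : ∀ i j, Integrable fun x =>
      Xop (b i) (fun y => ψ y * Xop (b i) u y) x * Xop (b j) (Xop (b j) u) x -
        Xop (b j) (fun y => ψ y * Xop (b i) u y) x *
      (2 * Xop (b i) (Xop (b j) u) x - Xop (b j) (Xop (b i) u) x) := fun i j =>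
    (integrable_mul_cpt (continuous_xop (hb i) (hf i)) (continuous_xop (hb j) (hp j))
      (hasCompactSupport_xop _ (hfs i))).sub
    (integrable_mul_cpt (continuous_xop (hb j) (hf i)) ((continuous_const.mul
      (continuous_xop (hb i) (hp j))).sub (continuous_xop (hb j) (hp i)))
      (hasCompactSupport_xop _ (hfs i)))
  rw [integral_finsetSum _ fun i _ => integrable_finsetSum _ fun j _ => hi i j]
  refine Finset.sum_eq_zero fun i _ => ?_
  rw [integral_finsetSum _ fun j _ => hi i j]
  refine Finset.sum_eq_zero fun j _ => ?_
  exact integral_pair_eq_zero hb hd h2 hu (hf i) (hfs i)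
    ((tsupport_mul_subset_left (f := ψ)).trans hψV) i j

end WeightedIdentity

section WeightedInequality

variable {n m : ℕ} {V : Set (Fin n → ℝ)} {b : Fin m → (Fin n → ℝ) → (Fin n → ℝ)}
  {u : (Fin n → ℝ) → ℝ}

/-- The horizontal inner product of two gradients. -/
noncomputable def gradDot (b : Fin m → (Fin n → ℝ) → (Fin n → ℝ)) (η u : (Fin n → ℝ) → ℝ)
    (x : Fin n → ℝ) : ℝ :=
  ∑ i, Xop (b i) η x * Xop (b i) u x

lemma abs_gradDot_le (b : Fin m → (Fin n → ℝ) → (Fin n → ℝ)) (η u : (Fin n → ℝ) → ℝ)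
    (x : Fin n → ℝ) :
    |gradDot b η u x| ≤ Real.sqrt (gradSq b η x) * Real.sqrt (gradSq b u x) := by
  rw [← Real.sqrt_mul (gradSq_nonneg b η x)]
  refine Real.abs_le_sqrt ?_
  exact Finset.sum_mul_sq_le_sq_mul_sq _ _ _

lemma abs_sum_sum_mul_le (p q : Fin m → ℝ) (a : Fin m → Fin m → ℝ) :
    |∑ i, ∑ j, q j * p i * a i j| ≤
      Real.sqrt (∑ i, q i ^ 2) * Real.sqrt (∑ i, p i ^ 2) * Real.sqrt (∑ i, ∑ j, a i j ^ 2) := by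
  have h : ∀ f : Fin m → Fin m → ℝ, ∑ i, ∑ j, f i j = ∑ x : Fin m × Fin m, f x.1 x.2 := fun f =>
    (Fintype.sum_prod_type' f).symm
  have h0 : 0 ≤ ∑ i, q i ^ 2 := Finset.sum_nonneg fun _ _ => sq_nonneg _
  have h1 : 0 ≤ ∑ i, p i ^ 2 := Finset.sum_nonneg fun _ _ => sq_nonneg _
  rw [← Real.sqrt_mul h0, ← Real.sqrt_mul (mul_nonneg h0 h1)]
  refine Real.abs_le_sqrt ?_
  have e : (∑ i, q i ^ 2) * (∑ i, p i ^ 2) = ∑ i, ∑ j, (q j * p i) ^ 2 := by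
    rw [mul_comm, Finset.sum_mul_sum]
    simp only [mul_pow, mul_comm]
  rw [e, h, h, h]
  exact Finset.sum_mul_sq_le_sq_mul_sq _ _ _

lemma contDiff_gradSq (hb : ∀ i, ContDiff ℝ (⊤ : ℕ∞) (b i)) (hu : ContDiff ℝ 2 u) :
    ContDiff ℝ 1 (gradSq b u) :=
  ContDiff.sum fun i _ => (contDiff_xop_one hb hu i).pow 2

lemma continuous_gradSq (hb : ∀ i, ContDiff ℝ (⊤ : ℕ∞) (b i)) (hu : ContDiff ℝ 1 u) :
    Continuous (gradSq b u) :=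
  continuous_finsetSum _ fun i _ => (continuous_xop (hb i) hu).pow 2

lemma continuous_subLap (hb : ∀ i, ContDiff ℝ (⊤ : ℕ∞) (b i)) (hu : ContDiff ℝ 2 u) :
    Continuous (subLap b u) :=
  continuous_finsetSum _ fun i _ => continuous_xop (hb i) (contDiff_xop_one hb hu i)

lemma continuous_commSq (hb : ∀ i, ContDiff ℝ (⊤ : ℕ∞) (b i)) (hu : ContDiff ℝ 2 u) :
    Continuous (commSq b u) :=
  continuous_finsetSum _ fun i _ => continuous_finsetSum _ fun j _ =>
    ((continuous_xop (hb i) (contDiff_xop_one hb hu j)).sub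
      (continuous_xop (hb j) (contDiff_xop_one hb hu i))).pow 2

lemma continuous_gradDot (hb : ∀ i, ContDiff ℝ (⊤ : ℕ∞) (b i)) {η : (Fin n → ℝ) → ℝ}
    (hη : ContDiff ℝ 1 η) (hu : ContDiff ℝ 1 u) : Continuous (gradDot b η u) :=
  continuous_finsetSum _ fun i _ => (continuous_xop (hb i) hη).mul (continuous_xop (hb i) hu)

/-- Integration by parts for the horizontal divergence of `h ∇u`. -/
lemma integral_mul_subLap_add_gradDot (hb : ∀ i, ContDiff ℝ (⊤ : ℕ∞) (b i)) (hd : DivFree V b)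
    (hu : ContDiff ℝ 2 u) {h : (Fin n → ℝ) → ℝ}
    (hh : ContDiff ℝ 1 h) (hhs : HasCompactSupport h) (hhV : tsupport h ⊆ V) :
    ∫ x, (h x * subLap b u x + gradDot b h u x) = 0 := by
  have h1 : (1 : WithTop ℕ∞) ≤ ((⊤ : ℕ∞) : WithTop ℕ∞) := by exact_mod_cast le_top
  have hp := contDiff_xop_one hb hu
  have e : ∀ x, h x * subLap b u x + gradDot b h u x =
      ∑ i, (Xop (b i) (Xop (b i) u) x * h x + Xop (b i) u x * Xop (b i) h x) := fun x => by
    rw [subLap, gradDot, Finset.mul_sum, ← Finset.sum_add_distrib]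
    exact Finset.sum_congr rfl fun i _ => by ring
  simp only [e]
  have i1 : ∀ i, Integrable fun x => Xop (b i) (Xop (b i) u) x * h x := fun i => by
    have := integrable_mul_cpt hh.continuous (continuous_xop (hb i) (hp i)) hhs
    simpa only [mul_comm] using this
  have i2 : ∀ i, Integrable fun x => Xop (b i) u x * Xop (b i) h x := fun i => by
    have := integrable_mul_cpt (continuous_xop (hb i) hh) (hp i).continuous
      (hasCompactSupport_xop _ hhs)
    simpa only [mul_comm] using this
  have i3 : ∀ i, Integrable fun x => Xop (b i) (Xop (b i) u) x * h x +
    Xop (b i) u x * Xop (b i) h x := fun i => (i1 i).add (i2 i)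
  rw [integral_finsetSum _ fun i _ => i3 i]
  refine Finset.sum_eq_zero fun i _ => ?_
  rw [integral_add (i1 i) (i2 i), integral_xop_mul_of_divf ((hb i).of_le h1)
    (fun x hx => hd.divf_eq_zero i hx) (hp i) hh hhs hhV]
  ring

lemma weighted_pointwise {x : Fin n → ℝ} (hk : IsKConvex V b 2 u) (hx : x ∈ V)
    {t G G1 G2 : ℝ} (ht : 0 ≤ t) (hG : 0 ≤ G) (hG1 : 0 ≤ G1) (η : (Fin n → ℝ) → ℝ) :
    t * (3 / 4 * G * commSq b u x + 3 / 2 * G1 * gradSq b u x * subLap b u x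
      + 1 / 2 * G2 * gradSq b u x ^ 2) ≤
    (∑ i, ∑ j, (t * G * (Xop (b i) (Xop (b i) u) x * Xop (b j) (Xop (b j) u) x
        - Xop (b j) (Xop (b i) u) x * (2 * Xop (b i) (Xop (b j) u) x
          - Xop (b j) (Xop (b i) u) x))
      + (G * Xop (b i) η x + t * G1 * Xop (b i) u x) * Xop (b i) u x * Xop (b j) (Xop (b j) u) x
      - (G * Xop (b j) η x + t * G1 * Xop (b j) u x) * Xop (b i) u x *
        (2 * Xop (b i) (Xop (b j) u) x - Xop (b j) (Xop (b i) u) x)))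
    + 1 / 2 * (t * G1 * gradSq b u x * subLap b u x + (G1 * gradSq b u x * gradDot b η u x
      + t * G2 * gradSq b u x ^ 2
      + 2 * (t * G1) * ∑ i, ∑ j, Xop (b i) u x * Xop (b j) u x * Xop (b i) (Xop (b j) u) x))
    + (G * Real.sqrt (gradSq b η x) * Real.sqrt (gradSq b u x) *
        (2 * subLap b u x + 3 / 2 * Real.sqrt (commSq b u x))
      + 1 / 2 * G1 * Real.sqrt (gradSq b u x) ^ 3 * Real.sqrt (gradSq b η x)) := by
  have hΔ := hk.subLap_nonneg hx
  have hA := hk.sum_sq_symmHess_le hx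
  have hQ := commSq_le_quadratic hk hx
  have hqp := abs_gradDot_le b η u x
  have hqA := abs_sum_sum_mul_le (fun i => Xop (b i) u x) (fun i => Xop (b i) η x)
    (symmHess b u x)
  have hqc := abs_sum_sum_mul_le (fun i => Xop (b i) u x) (fun i => Xop (b i) η x)
    (fun i j => commOp b i j u x)
  have hA' : Real.sqrt (∑ i, ∑ j, symmHess b u x i j ^ 2) ≤ subLap b u x :=
    (Real.sqrt_le_left hΔ).2 hA
  set E := Real.sqrt (gradSq b η x) with hE
  set P := Real.sqrt (gradSq b u x) with hP
  have hE0 : 0 ≤ E := Real.sqrt_nonneg _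
  have hP0 : 0 ≤ P := Real.sqrt_nonneg _
  have hP2 : P ^ 2 = gradSq b u x := Real.sq_sqrt (gradSq_nonneg b u x)
  change _ ≤ E * P * _ at hqA
  change _ ≤ E * P * Real.sqrt (commSq b u x) at hqc
  set Δ := subLap b u x with hΔdef
  set p : Fin m → ℝ := fun i => Xop (b i) u x with hp
  set q : Fin m → ℝ := fun i => Xop (b i) η x with hq
  set a : Fin m → Fin m → ℝ := fun i j => Xop (b i) (Xop (b j) u) x with ha
  have hT : ∑ i, ∑ j, p j * p i * a j i = ∑ i, ∑ j, p i * p j * a i j := by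
    rw [Finset.sum_comm]
  have e1 : (∑ i, ∑ j, (t * G * (a i i * a j j - a j i * (2 * a i j - a j i))
      + (G * q i + t * G1 * p i) * p i * a j j
      - (G * q j + t * G1 * p j) * p i * (2 * a i j - a j i))) =
      t * G * (∑ i, ∑ j, (a i i * a j j - a j i * (2 * a i j - a j i)))
      + G * (gradDot b η u x * Δ) + t * G1 * (gradSq b u x * Δ)
      - G * ((∑ i, ∑ j, q j * p i * symmHess b u x i j)
        + 3 / 2 * ∑ i, ∑ j, q j * p i * commOp b i j u x)
      - t * G1 * ∑ i, ∑ j, p i * p j * a i j := by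
    have h1 : gradDot b η u x * Δ = ∑ i, ∑ j, q i * p i * a j j := by
      rw [hΔdef, gradDot, subLap, Finset.sum_mul_sum]
    have h2 : gradSq b u x * Δ = ∑ i, ∑ j, p i * p i * a j j := by
      rw [hΔdef, gradSq, subLap, Finset.sum_mul_sum]
      simp only [sq]
      rfl
    have h3 : ∑ i, ∑ j, p i * p j * a i j =
        2 * ∑ i, ∑ j, p i * p j * a i j - ∑ i, ∑ j, p j * p i * a j i := by
      rw [hT]
      ring
    rw [h1, h2, h3]
    simp only [Finset.mul_sum, ← Finset.sum_add_distrib, ← Finset.sum_sub_distrib]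
    refine Finset.sum_congr rfl fun i _ => Finset.sum_congr rfl fun j _ => ?_
    simp only [symmHess, commOp, ha]
    ring
  have e2 := abs_le.1 hqp
  have e3 := abs_le.1 hqA
  have e4 := abs_le.1 hqc
  change _ ≤ (∑ i, ∑ j, (t * G * (a i i * a j j - a j i * (2 * a i j - a j i))
      + (G * q i + t * G1 * p i) * p i * a j j
      - (G * q j + t * G1 * p j) * p i * (2 * a i j - a j i))) + 1 / 2 * (_ + (_ + _ + 2 * (t * G1)
        * ∑ i, ∑ j, p i * p j * a i j)) + _
  rw [e1]
  have f1 : -(G * (E * P * Δ)) ≤ G * (gradDot b η u x * Δ) := by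
    have := mul_le_mul_of_nonneg_left (mul_le_mul_of_nonneg_right e2.1 hΔ) hG
    linarith
  have hEP : 0 ≤ E * P := mul_nonneg hE0 hP0
  have f2 : G * ((∑ i, ∑ j, q j * p i * symmHess b u x i j)
        + 3 / 2 * ∑ i, ∑ j, q j * p i * commOp b i j u x) ≤
      G * (E * P * Δ + 3 / 2 * (E * P * Real.sqrt (commSq b u x))) := by
    refine mul_le_mul_of_nonneg_left (add_le_add (e3.2.trans ?_) ?_) hG
    · exact mul_le_mul_of_nonneg_left hA' hEP
    · exact mul_le_mul_of_nonneg_left e4.2 (by norm_num)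
  have f3 : t * G * (3 / 4 * commSq b u x) ≤
      t * G * (∑ i, ∑ j, (a i i * a j j - a j i * (2 * a i j - a j i))) :=
    mul_le_mul_of_nonneg_left hQ (mul_nonneg ht hG)
  have f4 : -(G1 * P ^ 2 * (E * P)) ≤ G1 * gradSq b u x * gradDot b η u x := by
    rw [← hP2]
    have := mul_le_mul_of_nonneg_left e2.1 (mul_nonneg hG1 (sq_nonneg P))
    linarith
  nlinarith [f1, f2, f3, f4]

end WeightedInequality

section WeightedIntegral

variable {n m : ℕ} {V : Set (Fin n → ℝ)} {b : Fin m → (Fin n → ℝ) → (Fin n → ℝ)}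
  {u : (Fin n → ℝ) → ℝ}

lemma contDiff_one_comp {g g1 : ℝ → ℝ} (hg : ∀ t, HasDerivAt g (g1 t) t) (hg1 : Continuous g1)
    (hu : ContDiff ℝ 1 u) : ContDiff ℝ 1 fun x => g (u x) := by
  have h : ContDiff ℝ 1 g := by
    rw [contDiff_one_iff_deriv]
    exact ⟨fun t => (hg t).differentiableAt, 
      by rwa [show deriv g = g1 from funext fun t => (hg t).deriv]⟩
  exact h.comp hu

lemma xop_eq_zero_of_notMem_tsupport {c : (Fin n → ℝ) → (Fin n → ℝ)} {f : (Fin n → ℝ) → ℝ}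
    {x : Fin n → ℝ} (hx : x ∉ tsupport f) : Xop c f x = 0 :=
  image_eq_zero_of_notMem_tsupport fun h => hx (tsupport_xop_subset c f h)

lemma weighted_integral_le (hb : ∀ i, ContDiff ℝ (⊤ : ℕ∞) (b i)) (hd : DivFree V b)
    (h2 : SecondCommVanish V b) (hu : ContDiff ℝ 2 u) (hk : IsKConvex V b 2 u)
    {η : (Fin n → ℝ) → ℝ} (hη : ContDiff ℝ 1 η) (hηs : HasCompactSupport η)
    (hηV : tsupport η ⊆ V) (hη0 : ∀ x, 0 ≤ η x) {g g1 g2 : ℝ → ℝ}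
    (hg : ∀ t, HasDerivAt g (g1 t) t) (hg1 : ∀ t, HasDerivAt g1 (g2 t) t) (hg2 : Continuous g2)
    (hg0 : ∀ t, 0 ≤ g t) (hg10 : ∀ t, 0 ≤ g1 t) :
    ∫ x, η x * (3 / 4 * g (u x) * commSq b u x + 3 / 2 * g1 (u x) * gradSq b u x * subLap b u x
      + 1 / 2 * g2 (u x) * gradSq b u x ^ 2) ≤
    ∫ x, (g (u x) * Real.sqrt (gradSq b η x) * Real.sqrt (gradSq b u x) *
        (2 * subLap b u x + 3 / 2 * Real.sqrt (commSq b u x))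
      + 1 / 2 * g1 (u x) * Real.sqrt (gradSq b u x) ^ 3 * Real.sqrt (gradSq b η x)) := by
  have hu1 : ContDiff ℝ 1 u := hu.of_le one_le_two
  have hcg1 : Continuous g1 := continuous_iff_continuousAt.2 fun t => (hg1 t).continuousAt
  have hcg : Continuous g := continuous_iff_continuousAt.2 fun t => (hg t).continuousAt
  have hgu := contDiff_one_comp hg hcg1 hu1
  have hg1u := contDiff_one_comp hg1 hg2 hu1
  have hud : Differentiable ℝ u := hu1.differentiable one_ne_zero
  have cP := continuous_gradSq hb hu1
  have cD := continuous_subLap hb hu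
  have cC := continuous_commSq hb hu
  have cE := continuous_gradSq hb hη
  have cX : ∀ i, Continuous (Xop (b i) η) := fun i => continuous_xop (hb i) hη
  have cp : ∀ i, Continuous (Xop (b i) u) := fun i => continuous_xop (hb i) hu1
  have ca : ∀ i j, Continuous (Xop (b i) (Xop (b j) u)) := fun i j =>
    continuous_xop (hb i) (contDiff_xop_one hb hu j)
  have cd := continuous_gradDot hb hη hu1
  have hz : ∀ x, x ∉ tsupport η → η x = 0 ∧ gradSq b η x = 0 ∧ gradDot b η u x = 0 ∧
      ∀ i, Xop (b i) η x = 0 := fun x hx =>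
    ⟨image_eq_zero_of_notMem_tsupport hx,
      by simp [gradSq, xop_eq_zero_of_notMem_tsupport hx],
      by simp [gradDot, xop_eq_zero_of_notMem_tsupport hx],
      fun i => xop_eq_zero_of_notMem_tsupport hx⟩
  set ψ : (Fin n → ℝ) → ℝ := fun x => η x * g (u x) with hψ
  set h : (Fin n → ℝ) → ℝ := fun x => η x * g1 (u x) * gradSq b u x with hh
  have hψ1 : ContDiff ℝ 1 ψ := hη.mul hgu
  have hh1 : ContDiff ℝ 1 h := (hη.mul hg1u).mul (contDiff_gradSq hb hu)
  have hψs : HasCompactSupport ψ := hηs.mul_right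
  have hhs : HasCompactSupport h := hηs.mul_right.mul_right
  have hψV : tsupport ψ ⊆ V := (tsupport_mul_subset_left (f := η)).trans hηV
  have hhV : tsupport h ⊆ V := ((tsupport_mul_subset_left (f := fun x => η x * g1 (u x))).trans
    (tsupport_mul_subset_left (f := η))).trans hηV
  have I1 := integral_mul_quadratic hb hd h2 hu hψ1 hψs hψV
  have I2 := integral_mul_subLap_add_gradDot hb hd hu hh1 hhs hhV
  have eψ : ∀ i x, Xop (b i) ψ x = g (u x) * Xop (b i) η x + η x * g1 (u x) * Xop (b i) u x :=
    fun i x => by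
      rw [hψ, xop_mul (hη.differentiable one_ne_zero x) (hgu.differentiable one_ne_zero x),
        xop_comp (hg (u x)) (hud x)]
      ring
  have eh : ∀ x, gradDot b h u x = g1 (u x) * gradSq b u x * gradDot b η u x
      + η x * g2 (u x) * gradSq b u x ^ 2
      + 2 * (η x * g1 (u x)) *
        ∑ i, ∑ j, Xop (b i) u x * Xop (b j) u x * Xop (b i) (Xop (b j) u) x := fun x => by
    have e1 : ∀ i, Xop (b i) (gradSq b u) x =
        ∑ j, 2 * Xop (b j) u x * Xop (b i) (Xop (b j) u) x := fun i => by
      have hdj : ∀ j, DifferentiableAt ℝ (Xop (b j) u) x := fun j =>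
        (contDiff_xop_one hb hu j).differentiable one_ne_zero x
      rw [Xop, show gradSq b u = fun y => ∑ j, Xop (b j) u y ^ 2 from rfl,
        fderiv_fun_sum (u := Finset.univ) (A := fun j y => Xop (b j) u y ^ 2)
          fun j _ => (hdj j).fun_pow 2]
      simp only [_root_.sum_apply]
      refine Finset.sum_congr rfl fun j _ => ?_
      rw [fderiv_fun_pow 2 (hdj j)]
      simp [Xop]
    have e2 : ∀ i, Xop (b i) h x = η x * g1 (u x) * Xop (b i) (gradSq b u) x +
        gradSq b u x * (η x * (g2 (u x) * Xop (b i) u x) + g1 (u x) * Xop (b i) η x) := fun i => by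
      rw [hh, xop_mul ((hη.mul hg1u).differentiable one_ne_zero x)
        ((contDiff_gradSq hb hu).differentiable one_ne_zero x),
        xop_mul (hη.differentiable one_ne_zero x) (hg1u.differentiable one_ne_zero x),
        xop_comp (hg1 (u x)) (hud x)]
    have e3 : gradSq b u x ^ 2 = gradSq b u x * ∑ i, Xop (b i) u x * Xop (b i) u x := by
      rw [sq]
      simp only [gradSq, sq]
    rw [e3]
    simp only [gradDot, e2, e1, Finset.mul_sum, ← Finset.sum_add_distrib]
    refine Finset.sum_congr rfl fun i _ => ?_
    rw [add_mul, Finset.sum_mul, add_comm]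
    congr 1
    · ring
    · exact Finset.sum_congr rfl fun j _ => by ring
  simp only [eψ] at I1
  simp only [eh] at I2
  have hInt : ∀ F : (Fin n → ℝ) → ℝ, Continuous F → (∀ x, x ∉ tsupport η → F x = 0) →
      Integrable F := fun F hF hF0 =>
    hF.integrable_of_hasCompactSupport (HasCompactSupport.intro hηs.isCompact fun x hx => hF0 x hx)
  have cu := hu.continuous
  have cη := hη.continuous
  have hI1 := hInt (fun x => ∑ i, ∑ j, (ψ x *
      (Xop (b i) (Xop (b i) u) x * Xop (b j) (Xop (b j) u) x
        - Xop (b j) (Xop (b i) u) x * (2 * Xop (b i) (Xop (b j) u) x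
          - Xop (b j) (Xop (b i) u) x))
      + (g (u x) * Xop (b i) η x + η x * g1 (u x) * Xop (b i) u x) * Xop (b i) u x *
        Xop (b j) (Xop (b j) u) x
      - (g (u x) * Xop (b j) η x + η x * g1 (u x) * Xop (b j) u x) * Xop (b i) u x *
        (2 * Xop (b i) (Xop (b j) u) x - Xop (b j) (Xop (b i) u) x)))
    (by fun_prop) fun x hx => by
      obtain ⟨z1, z2, z3, z4⟩ := hz x hx
      simp [hψ, z1, z4]
  have hI2 := hInt (fun x => h x * subLap b u x + (g1 (u x) * gradSq b u x * gradDot b η u x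
      + η x * g2 (u x) * gradSq b u x ^ 2
      + 2 * (η x * g1 (u x)) *
        ∑ i, ∑ j, Xop (b i) u x * Xop (b j) u x * Xop (b i) (Xop (b j) u) x))
    (by fun_prop) fun x hx => by
      obtain ⟨z1, z2, z3, z4⟩ := hz x hx
      simp [hh, z1, z3]
  have hR := hInt (fun x => g (u x) * Real.sqrt (gradSq b η x) * Real.sqrt (gradSq b u x) *
        (2 * subLap b u x + 3 / 2 * Real.sqrt (commSq b u x))
      + 1 / 2 * g1 (u x) * Real.sqrt (gradSq b u x) ^ 3 * Real.sqrt (gradSq b η x))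
    (by fun_prop) fun x hx => by
      obtain ⟨z1, z2, z3, z4⟩ := hz x hx
      simp [z2]
  have hL := hInt (fun x => η x * (3 / 4 * g (u x) * commSq b u x
      + 3 / 2 * g1 (u x) * gradSq b u x * subLap b u x
      + 1 / 2 * g2 (u x) * gradSq b u x ^ 2))
    (by fun_prop) fun x hx => by
      obtain ⟨z1, z2, z3, z4⟩ := hz x hx
      simp [z1]
  have hsum := (hI1.add (hI2.const_mul (1 / 2))).add hR
  refine (integral_mono hL hsum fun x => ?_).trans_eq ?_
  · by_cases hx : x ∈ tsupport η
    · exact weighted_pointwise hk (hηV hx) (hη0 x) (hg0 _) (hg10 _) η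
    · obtain ⟨z1, z2, z3, z4⟩ := hz x hx
      simp [hψ, hh, z1, z2, z3, z4]
  · rw [integral_add' (hI1.add (hI2.const_mul (1 / 2))) hR,
      integral_add' hI1 (hI2.const_mul (1 / 2)), integral_const_mul, I1, I2]
    simp

end WeightedIntegral

section Weight

/-- The Japanese bracket `√(1 + t²)`. -/
noncomputable def jap (t : ℝ) : ℝ := Real.sqrt (1 + t ^ 2)

lemma jap_sq (t : ℝ) : jap t ^ 2 = 1 + t ^ 2 := Real.sq_sqrt (by positivity)

lemma one_le_jap (t : ℝ) : 1 ≤ jap t := Real.one_le_sqrt.2 (by nlinarith [sq_nonneg t])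

lemma jap_pos (t : ℝ) : 0 < jap t := one_pos.trans_le (one_le_jap t)

lemma abs_le_jap (t : ℝ) : |t| ≤ jap t := Real.abs_le_sqrt (by linarith)

lemma jap_le (t : ℝ) : jap t ≤ 1 + |t| := by
  refine Real.sqrt_le_iff.2 ⟨by positivity, ?_⟩
  nlinarith [sq_abs t, abs_nonneg t]

lemma hasDerivAt_jap (t : ℝ) : HasDerivAt jap (t / jap t) t := by
  have h : HasDerivAt (fun s : ℝ => 1 + s ^ 2) (2 * t) t := by
    simpa using (hasDerivAt_pow 2 t).const_add 1
  have := h.sqrt (by positivity)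
  refine this.congr_deriv ?_
  unfold jap
  field_simp

lemma contDiff_jap {k : WithTop ℕ∞} : ContDiff ℝ k jap :=
  ContDiff.sqrt (by fun_prop) fun t => by positivity

/-- The weight `y ^ a + y ^ 2`, where `y = t + √(1 + t²)`. -/
noncomputable def weight (a t : ℝ) : ℝ := Real.exp (a * Real.arsinh t) + Real.exp (2 * Real.arsinh t)

/-- The derivative of `weight`. -/
noncomputable def weight1 (a t : ℝ) : ℝ :=
  (a * Real.exp (a * Real.arsinh t) + 2 * Real.exp (2 * Real.arsinh t)) / jap t

/-- The second derivative of `weight`. -/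
noncomputable def weight2 (a t : ℝ) : ℝ :=
  (a ^ 2 * Real.exp (a * Real.arsinh t) + 4 * Real.exp (2 * Real.arsinh t)) / jap t ^ 2 -
    (a * Real.exp (a * Real.arsinh t) + 2 * Real.exp (2 * Real.arsinh t)) * (t / jap t) / jap t ^ 2

variable {a : ℝ}

lemma weight_pos (a t : ℝ) : 0 < weight a t := by unfold weight; positivity

lemma hasDerivAt_exp_mul_arsinh (c t : ℝ) :
    HasDerivAt (fun s => Real.exp (c * Real.arsinh s)) (c * Real.exp (c * Real.arsinh t) / jap t)
      t := by
  refine ((Real.hasDerivAt_arsinh t).const_mul c).exp.congr_deriv ?_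
  unfold jap
  ring

lemma hasDerivAt_weight (a t : ℝ) : HasDerivAt (weight a) (weight1 a t) t := by
  refine ((hasDerivAt_exp_mul_arsinh a t).add (hasDerivAt_exp_mul_arsinh 2 t)).congr_deriv ?_
  unfold weight1
  ring

lemma hasDerivAt_weight1 (a t : ℝ) : HasDerivAt (weight1 a) (weight2 a t) t := by
  have h := ((((hasDerivAt_exp_mul_arsinh a t).const_mul a).add
    ((hasDerivAt_exp_mul_arsinh 2 t).const_mul 2)).div (hasDerivAt_jap t) (jap_pos t).ne')
  refine h.congr_deriv ?_
  have := (jap_pos t).ne'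
  simp only [Pi.add_apply]
  unfold weight2
  field_simp
  ring

lemma contDiff_weight {k : WithTop ℕ∞} (a : ℝ) : ContDiff ℝ k (weight a) := by
  have := Real.contDiff_arsinh (n := k)
  unfold weight
  fun_prop

lemma continuous_weight2 (a : ℝ) : Continuous (weight2 a) := by
  have h1 := Real.continuous_arsinh
  have h2 : Continuous jap := (contDiff_jap (k := 0)).continuous
  have h3 : ∀ t, jap t ≠ 0 := fun t => (jap_pos t).ne'
  unfold weight2
  fun_prop (disch := simp [h3])

lemma weight1_le (ha2 : a ≤ 2) (t : ℝ) : weight1 a t ≤ 2 * weight a t / jap t := by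
  unfold weight1 weight
  have := jap_pos t
  have := Real.exp_pos (a * Real.arsinh t)
  gcongr
  nlinarith

lemma le_weight1 (ha2 : a ≤ 2) (t : ℝ) : a * weight a t / jap t ≤ weight1 a t := by
  unfold weight1 weight
  have := jap_pos t
  have := Real.exp_pos (2 * Real.arsinh t)
  gcongr
  nlinarith

lemma le_weight2 (ha : 0 < a) (ha2 : a ≤ 1) (t : ℝ) :
    a ^ 2 * weight a t / jap t ^ 2 ≤ weight2 a t := by
  unfold weight2 weight
  have hj := jap_pos t
  have h1 := Real.exp_pos (a * Real.arsinh t)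
  have h2 := Real.exp_pos (2 * Real.arsinh t)
  rw [← sub_div]
  gcongr
  have h3 : t / jap t ≤ 1 := by
    rw [div_le_one hj]
    exact (le_abs_self t).trans (abs_le_jap t)
  set c := t / jap t with hc
  set E := Real.exp (a * Real.arsinh t)
  set F := Real.exp (2 * Real.arsinh t)
  rcases le_total t 0 with ht | ht
  · have : c ≤ 0 := div_nonpos_of_nonpos_of_nonneg ht hj.le
    have : (a * E + 2 * F) * c ≤ 0 := mul_nonpos_of_nonneg_of_nonpos (by positivity) this
    nlinarith [mul_pos ha h2]
  · have hEF : E ≤ F := by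
      refine Real.exp_le_exp.2 ?_
      have := Real.arsinh_nonneg_iff.2 ht
      nlinarith
    have : (a * E + 2 * F) * c ≤ (a * E + 2 * F) * 1 := by gcongr
    nlinarith [mul_pos ha h2, mul_le_mul_of_nonneg_left hEF ha.le]

lemma weight_le (ha : 0 ≤ a) (ha2 : a ≤ 2) (t : ℝ) : weight a t ≤ 9 * jap t ^ 2 := by
  have h1 : Real.exp (a * Real.arsinh t) ≤ 1 + Real.exp (2 * Real.arsinh t) := by
    rcases le_total (Real.arsinh t) 0 with h | h
    · have : Real.exp (a * Real.arsinh t) ≤ 1 := Real.exp_le_one_iff.2 (by nlinarith)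
      linarith [Real.exp_pos (2 * Real.arsinh t)]
    · have : Real.exp (a * Real.arsinh t) ≤ Real.exp (2 * Real.arsinh t) :=
        Real.exp_le_exp.2 (by nlinarith)
      linarith
  have h2 : Real.exp (2 * Real.arsinh t) = (t + jap t) ^ 2 := by
    rw [two_mul, Real.exp_add, Real.exp_arsinh, jap, ← sq]
  have h3 := abs_le.1 (abs_le_jap t)
  have h4 := one_le_jap t
  unfold weight
  nlinarith

lemma one_le_weight_mul (ha : 0 < a) (t : ℝ) : 1 ≤ weight a t * (2 * jap t) ^ a := by
  have h1 : Real.exp (-(a * Real.arsinh t)) ≤ (2 * jap t) ^ a := by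
    have : Real.exp (-(a * Real.arsinh t)) = (Real.exp (Real.arsinh (-t))) ^ a := by
      rw [← Real.exp_mul, Real.arsinh_neg]; ring_nf
    rw [this, Real.exp_arsinh]
    refine Real.rpow_le_rpow ?_ ?_ ha.le
    · rw [← Real.exp_arsinh]; positivity
    · rw [neg_sq]
      change -t + jap t ≤ _
      linarith [(abs_le.1 (abs_le_jap t)).1]
  calc (1:ℝ) = Real.exp (a * Real.arsinh t) * Real.exp (-(a * Real.arsinh t)) := by
        rw [← Real.exp_add]; simp
    _ ≤ weight a t * (2 * jap t) ^ a := by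
        refine mul_le_mul ?_ h1 (Real.exp_pos _).le (weight_pos a t).le
        unfold weight
        linarith [Real.exp_pos (2 * Real.arsinh t)]

end Weight

section EnergyEstimate

variable {n m : ℕ} {V : Set (Fin n → ℝ)} {b : Fin m → (Fin n → ℝ) → (Fin n → ℝ)}
  {u ζ : (Fin n → ℝ) → ℝ} {a B : ℝ}

lemma sqrt_gradSq_pow (hζ : Differentiable ℝ ζ) (hζ0 : ∀ x, 0 ≤ ζ x) (j : ℕ) (x : Fin n → ℝ) :
    Real.sqrt (gradSq b (fun y => ζ y ^ j) x) =
      j * ζ x ^ (j - 1) * Real.sqrt (gradSq b ζ x) := by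
  have h : gradSq b (fun y => ζ y ^ j) x = (j * ζ x ^ (j - 1)) ^ 2 * gradSq b ζ x := by
    unfold gradSq
    rw [Finset.mul_sum]
    refine Finset.sum_congr rfl fun i _ => ?_
    rw [xop_comp (g := fun t => t ^ j) (hasDerivAt_pow j (ζ x)) (hζ x)]
    ring
  rw [h, Real.sqrt_mul (sq_nonneg _), Real.sqrt_sq]
  have := hζ0 x
  positivity

lemma integrable_pow_mul {F : (Fin n → ℝ) → ℝ} (hζ : Continuous ζ) (hζs : HasCompactSupport ζ)
    (hF : Continuous F) {j : ℕ} (hj : j ≠ 0) : Integrable fun x => ζ x ^ j * F x := by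
  refine Continuous.integrable_of_hasCompactSupport (by fun_prop) ?_
  refine HasCompactSupport.mul_right ?_
  refine hζs.mono fun x hx => ?_
  simp only [Function.mem_support] at hx ⊢
  exact fun h => hx (by simp [h, hj])

lemma gradDot_mul_comp {η : (Fin n → ℝ) → ℝ} {F F1 : ℝ → ℝ} (hF : ∀ t, HasDerivAt F (F1 t) t)
    (hη : Differentiable ℝ η) (hu : Differentiable ℝ u) (x : Fin n → ℝ) :
    gradDot b (fun y => η y * F (u y)) u x =
      F (u x) * gradDot b η u x + η x * F1 (u x) * gradSq b u x := by
  unfold gradDot gradSq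
  rw [Finset.mul_sum, Finset.mul_sum, ← Finset.sum_add_distrib]
  refine Finset.sum_congr rfl fun i _ => ?_
  have hFd : DifferentiableAt ℝ (fun y => F (u y)) x :=
    ((hF (u x)).differentiableAt).comp x (hu x)
  rw [xop_mul (hη x) hFd, xop_comp (hF (u x)) (hu x)]
  ring

/-- Integration by parts bounding a weighted integral of the sub-Laplacian. -/
lemma integral_mul_comp_subLap_le (hb : ∀ i, ContDiff ℝ (⊤ : ℕ∞) (b i)) (hd : DivFree V b)
    (hu : ContDiff ℝ 2 u) {η H : (Fin n → ℝ) → ℝ} {F F1 : ℝ → ℝ}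
    (hF : ∀ t, HasDerivAt F (F1 t) t) (hF1 : Continuous F1)
    (hη : ContDiff ℝ 1 η) (hηs : HasCompactSupport η) (hηV : tsupport η ⊆ V) (hη0 : ∀ x, 0 ≤ η x)
    (hH : Integrable H)
    (hle : ∀ x, |F (u x)| * Real.sqrt (gradSq b η x) * Real.sqrt (gradSq b u x) +
      η x * |F1 (u x)| * gradSq b u x ≤ H x) :
    ∫ x, η x * F (u x) * subLap b u x ≤ ∫ x, H x := by
  have hu1 : ContDiff ℝ 1 u := hu.of_le (by norm_num)
  have hFu : ContDiff ℝ 1 fun y => F (u y) := contDiff_one_comp hF hF1 hu1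
  have hh : ContDiff ℝ 1 fun y => η y * F (u y) := hη.mul hFu
  have hhs : HasCompactSupport fun y => η y * F (u y) := hηs.mul_right
  have key := integral_mul_subLap_add_gradDot hb hd hu hh hhs
    ((tsupport_mul_subset_left (f := η) (g := fun y => F (u y))).trans hηV)
  have i1 : Integrable fun x => η x * F (u x) * subLap b u x :=
    (hh.continuous.mul (continuous_subLap hb hu)).integrable_of_hasCompactSupport hhs.mul_right
  have hsum : Integrable fun x => η x * F (u x) * subLap b u x +
      gradDot b (fun y => η y * F (u y)) u x := by
    refine Continuous.integrable_of_hasCompactSupport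
      ((hh.continuous.mul (continuous_subLap hb hu)).add (continuous_gradDot hb hh hu1)) ?_
    refine HasCompactSupport.intro hhs fun x hx => ?_
    have h0 : η x * F (u x) = 0 := 
      image_eq_zero_of_notMem_tsupport (f := fun y => η y * F (u y)) hx
    rw [h0, zero_mul, zero_add]
    exact Finset.sum_eq_zero fun i _ => by
      rw [xop_eq_zero_of_notMem_tsupport (f := fun y => η y * F (u y)) hx, zero_mul]
  have i3 := hH.add hsum
  have : ∫ x, η x * F (u x) * subLap b u x ≤ ∫ x, (H x + (η x * F (u x) * subLap b u x +
      gradDot b (fun y => η y * F (u y)) u x)) := by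
    refine integral_mono i1 i3 fun x => ?_
    simp only
    rw [gradDot_mul_comp hF (hη.differentiable (by norm_num)) (hu1.differentiable (by norm_num))]
    have h1 := hle x
    have h2 : |F (u x) * gradDot b η u x| ≤
        |F (u x)| * Real.sqrt (gradSq b η x) * Real.sqrt (gradSq b u x) := by
      rw [abs_mul, mul_assoc]
      exact mul_le_mul_of_nonneg_left (abs_gradDot_le b η u x) (abs_nonneg _)
    have h3 : |η x * F1 (u x) * gradSq b u x| = η x * |F1 (u x)| * gradSq b u x := by
      rw [abs_mul, abs_mul, abs_of_nonneg (hη0 x), abs_of_nonneg (gradSq_nonneg b u x)]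
    have h4 := neg_abs_le (F (u x) * gradDot b η u x)
    have h5 := neg_abs_le (η x * F1 (u x) * gradSq b u x)
    linarith
  rwa [integral_add hH hsum, key, add_zero] at this

/-- The quadratic part of the weighted energy. -/
noncomputable def energyDensity (a : ℝ) (b : Fin m → (Fin n → ℝ) → (Fin n → ℝ)) (u : (Fin n → ℝ) → ℝ)
    (x : Fin n → ℝ) : ℝ :=
  weight a (u x) * commSq b u x + weight a (u x) / jap (u x) * gradSq b u x * subLap b u x +
    weight a (u x) / jap (u x) ^ 2 * gradSq b u x ^ 2

lemma continuous_energyDensity (hb : ∀ i, ContDiff ℝ (⊤ : ℕ∞) (b i)) (hu : ContDiff ℝ 2 u) :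
    Continuous (energyDensity a b u) := by
  have cP := continuous_gradSq hb (hu.of_le one_le_two)
  have cD := continuous_subLap hb hu
  have cC := continuous_commSq hb hu
  have cu := hu.continuous
  have cw : Continuous (weight a) := (contDiff_weight (k := 0) a).continuous
  have cj : Continuous jap := (contDiff_jap (k := 0)).continuous
  have hj : ∀ t, jap t ≠ 0 := fun t => (jap_pos t).ne'
  unfold energyDensity
  fun_prop (disch := simp [hj])

lemma energyDensity_nonneg {x : Fin n → ℝ} (hx : 0 ≤ subLap b u x) :
    0 ≤ energyDensity a b u x := by
  unfold energyDensity
  have := (weight_pos a (u x)).le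
  have := (jap_pos (u x)).le
  have := gradSq_nonneg b u x
  have := commSq_nonneg b u x
  positivity

lemma young_energy {ε D z g r p d c : ℝ} (hε : 0 < ε) (hg : 0 ≤ g) (hr : 0 < r)
    (hd : 0 ≤ d) :
    D * z * (g * p * (2 * d + 3 / 2 * c) + g / r * p ^ 3) ≤
      ε * z ^ 2 * (g * c ^ 2 + g / r * p ^ 2 * d + g / r ^ 2 * p ^ 4) +
        D ^ 2 / ε * (g * p ^ 2 + g * r * d) := by
  have h1 : 2 * D * z * p ≤ ε * z ^ 2 * p ^ 2 / r + D ^ 2 * r / ε := by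
    have : ε * z ^ 2 * p ^ 2 / r + D ^ 2 * r / ε - 2 * D * z * p =
        (ε * z * p - D * r) ^ 2 / (ε * r) := by field_simp; ring
    have h : 0 ≤ (ε * z * p - D * r) ^ 2 / (ε * r) := by positivity
    linarith
  have h2 : 3 / 2 * D * z * p * c ≤ ε * z ^ 2 * c ^ 2 + 9 / 16 * (D ^ 2 / ε) * p ^ 2 := by
    have : ε * z ^ 2 * c ^ 2 + 9 / 16 * (D ^ 2 / ε) * p ^ 2 - 3 / 2 * D * z * p * c =
        (ε * z * c - 3 / 4 * D * p) ^ 2 / ε := by field_simp; ring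
    have h : 0 ≤ (ε * z * c - 3 / 4 * D * p) ^ 2 / ε := by positivity
    linarith
  have h3 : D * z * p ^ 3 / r ≤ ε * z ^ 2 * p ^ 4 / r ^ 2 + 1 / 4 * (D ^ 2 / ε) * p ^ 2 := by
    have : ε * z ^ 2 * p ^ 4 / r ^ 2 + 1 / 4 * (D ^ 2 / ε) * p ^ 2 - D * z * p ^ 3 / r =
        p ^ 2 * (ε * z * p / r - 1 / 2 * D) ^ 2 / ε := by field_simp; ring
    have h : 0 ≤ p ^ 2 * (ε * z * p / r - 1 / 2 * D) ^ 2 / ε := by positivity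
    linarith
  have e1 := mul_le_mul_of_nonneg_left h1 (mul_nonneg hg hd)
  have e2 := mul_le_mul_of_nonneg_left h2 hg
  have e3 := mul_le_mul_of_nonneg_left h3 hg
  have e4 : 0 ≤ g * (3 / 16 * (D ^ 2 / ε) * p ^ 2) := by positivity
  have e5 : ε * z ^ 2 * (g * c ^ 2 + g / r * p ^ 2 * d + g / r ^ 2 * p ^ 4) +
        D ^ 2 / ε * (g * p ^ 2 + g * r * d) - D * z * (g * p * (2 * d + 3 / 2 * c) + g / r * p ^ 3)
      = (g * d * (ε * z ^ 2 * p ^ 2 / r + D ^ 2 * r / ε) - g * d * (2 * D * z * p)) +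
        (g * (ε * z ^ 2 * c ^ 2 + 9 / 16 * (D ^ 2 / ε) * p ^ 2) - g * (3 / 2 * D * z * p * c)) +
        (g * (ε * z ^ 2 * p ^ 4 / r ^ 2 + 1 / 4 * (D ^ 2 / ε) * p ^ 2) - g * (D * z * p ^ 3 / r)) +
        g * (3 / 16 * (D ^ 2 / ε) * p ^ 2) := by
    field_simp
    ring
  linarith

/-- The weighted inequality with the cutoff `ζ ^ (2 * k + 4)`, after absorbing quadratic terms. -/
lemma integral_energyDensity_le (hb : ∀ i, ContDiff ℝ (⊤ : ℕ∞) (b i)) (hd : DivFree V b)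
    (h2 : SecondCommVanish V b) (hζ : ContDiff ℝ 1 ζ) (hζs : HasCompactSupport ζ)
    (hζV : tsupport ζ ⊆ V) (hζ0 : ∀ x, 0 ≤ ζ x)
    (hB : ∀ x, Real.sqrt (gradSq b ζ x) ≤ B) (ha : 0 < a) (ha2 : a ≤ 1) (k : ℕ)
    (hu : ContDiff ℝ 2 u) (hk : IsKConvex V b 2 u) :
    ∫ x, ζ x ^ (2 * k + 4) * energyDensity a b u x ≤
      ((2 * k + 4 : ℕ) * B) ^ 2 * (4 / a ^ 2) ^ 2 * ∫ x, ζ x ^ (2 * k + 2) *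
        (weight a (u x) * gradSq b u x + weight a (u x) * jap (u x) * subLap b u x) := by
  have hB0 : 0 ≤ B := (Real.sqrt_nonneg _).trans (hB 0)
  have hu1 : ContDiff ℝ 1 u := hu.of_le one_le_two
  have cP := continuous_gradSq hb hu1
  have cD := continuous_subLap hb hu
  have cC := continuous_commSq hb hu
  have cu := hu.continuous
  have cw : Continuous (weight a) := (contDiff_weight (k := 0) a).continuous
  have cj : Continuous jap := (contDiff_jap (k := 0)).continuous
  have c2 := continuous_weight2 a
  have c1 : Continuous (weight1 a) :=
    continuous_iff_continuousAt.2 fun t => (hasDerivAt_weight1 a t).continuousAt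
  set N := 2 * k + 4 with hN
  set D : ℝ := N * B with hD
  have hD0 : 0 ≤ D := by positivity
  have hj : ∀ x, x ∉ V → ζ x = 0 := fun x hx =>
    image_eq_zero_of_notMem_tsupport fun h => hx (hζV h)
  have hηs : HasCompactSupport fun x => ζ x ^ N := hζs.comp_left (g := fun t => t ^ N) (by simp [hN])
  have hηV : tsupport (fun x => ζ x ^ N) ⊆ V :=
    (closure_mono fun x hx => by
      simp only [Function.mem_support] at hx ⊢
      exact fun h => hx (by simp [h, hN])).trans hζV
  have hw10 : ∀ t, 0 ≤ weight1 a t := fun t => by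
    refine le_trans ?_ (le_weight1 (by linarith) t)
    have := weight_pos a t
    have := jap_pos t
    positivity
  have key := weighted_integral_le hb hd h2 hu hk (hζ.pow N) hηs hηV
    (fun x => pow_nonneg (hζ0 x) N) (hasDerivAt_weight a) (hasDerivAt_weight1 a)
    c2 (fun t => (weight_pos a t).le) hw10
  have iG : Integrable fun x => ζ x ^ N * energyDensity a b u x :=
    integrable_pow_mul hζ.continuous hζs (continuous_energyDensity hb hu) (by omega)
  have iR : Integrable fun x => ζ x ^ (2 * k + 2) *
      (weight a (u x) * gradSq b u x + weight a (u x) * jap (u x) * subLap b u x) :=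
    integrable_pow_mul hζ.continuous hζs (by fun_prop) (by omega)
  have iL : Integrable fun x => ζ x ^ N * (3 / 4 * weight a (u x) * commSq b u x +
      3 / 2 * weight1 a (u x) * gradSq b u x * subLap b u x
      + 1 / 2 * weight2 a (u x) * gradSq b u x ^ 2) :=
    integrable_pow_mul hζ.continuous hζs (by fun_prop) (by omega)
  have hlow : a ^ 2 / 2 * ∫ x, ζ x ^ N * energyDensity a b u x ≤
      ∫ x, ζ x ^ N * (3 / 4 * weight a (u x) * commSq b u x +
      3 / 2 * weight1 a (u x) * gradSq b u x * subLap b u x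
      + 1 / 2 * weight2 a (u x) * gradSq b u x ^ 2) := by
    rw [← integral_const_mul]
    refine integral_mono (iG.const_mul _) iL fun x => ?_
    by_cases hx : x ∈ V
    · have hs := hk.subLap_nonneg hx
      have hg := weight_pos a (u x)
      have hr := jap_pos (u x)
      have hP := gradSq_nonneg b u x
      have hC := commSq_nonneg b u x
      have l1 := le_weight1 (a := a) (by linarith) (u x)
      have l2 := le_weight2 ha ha2 (u x)
      have hz := pow_nonneg (hζ0 x) N
      have e1 : a ^ 2 / 2 * (weight a (u x) * commSq b u x) ≤
          3 / 4 * weight a (u x) * commSq b u x := by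
        have h3 : 0 ≤ weight a (u x) * commSq b u x := by positivity
        have h4 : a ^ 2 / 2 ≤ 3 / 4 := by nlinarith
        have h5 := mul_le_mul_of_nonneg_right h4 h3
        linarith
      have e2 : a ^ 2 / 2 * (weight a (u x) / jap (u x) * gradSq b u x * subLap b u x) ≤
          3 / 2 * weight1 a (u x) * gradSq b u x * subLap b u x := by
        have h3 := mul_le_mul_of_nonneg_right l1 (mul_nonneg hP hs)
        have h4 : 0 ≤ weight a (u x) / jap (u x) * gradSq b u x * subLap b u x := by positivity
        have h5 : a * weight a (u x) / jap (u x) * (gradSq b u x * subLap b u x) =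
          a * (weight a (u x) / jap (u x) * gradSq b u x * subLap b u x) := by ring
        have h6 : a ^ 2 / 2 ≤ 3 / 2 * a := by nlinarith
        have h7 := mul_le_mul_of_nonneg_right h6 h4
        linarith
      have e3 : a ^ 2 / 2 * (weight a (u x) / jap (u x) ^ 2 * gradSq b u x ^ 2) ≤
          1 / 2 * weight2 a (u x) * gradSq b u x ^ 2 := by
        have h3 := mul_le_mul_of_nonneg_right l2 (sq_nonneg (gradSq b u x))
        have h5 : a ^ 2 * weight a (u x) / jap (u x) ^ 2 * gradSq b u x ^ 2 =
          a ^ 2 * (weight a (u x) / jap (u x) ^ 2 * gradSq b u x ^ 2) := by ring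
        linarith
      have e4 := mul_le_mul_of_nonneg_left (add_le_add (add_le_add e1 e2) e3) hz
      unfold energyDensity
      refine le_trans (le_of_eq ?_) (e4.trans (le_of_eq ?_)) <;> ring
    · have hNz : N ≠ 0 := by omega
      simp [hj x hx, hNz]
  have hup : ∫ x, (weight a (u x) * Real.sqrt (gradSq b (fun y => ζ y ^ N) x) *
        Real.sqrt (gradSq b u x) * (2 * subLap b u x + 3 / 2 * Real.sqrt (commSq b u x))
      + 1 / 2 * weight1 a (u x) * Real.sqrt (gradSq b u x) ^ 3 *
        Real.sqrt (gradSq b (fun y => ζ y ^ N) x)) ≤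
      ∫ x, (a ^ 2 / 4 * (ζ x ^ N * energyDensity a b u x) + D ^ 2 / (a ^ 2 / 4) *
        (ζ x ^ (2 * k + 2) *
        (weight a (u x) * gradSq b u x + weight a (u x) * jap (u x) * subLap b u x))) := by
    have hsq : ∀ x, Real.sqrt (gradSq b (fun y => ζ y ^ N) x) =
        N * ζ x ^ (2 * k + 3) * Real.sqrt (gradSq b ζ x) := fun x =>
      sqrt_gradSq_pow (hζ.differentiable one_ne_zero) hζ0 N x
    have hsV : ∀ x, x ∉ V → Real.sqrt (gradSq b (fun y => ζ y ^ N) x) = 0 := fun x hx => by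
      rw [hsq, hj x hx]; simp
    refine integral_mono_of_nonneg (Eventually.of_forall fun x => ?_)
      ((iG.const_mul _).add (iR.const_mul _)) (Eventually.of_forall fun x => ?_)
    · by_cases hx : x ∈ V
      · have hs := hk.subLap_nonneg hx
        have := hw10 (u x)
        have := (weight_pos a (u x)).le
        simp only [Pi.zero_apply]
        positivity
      · simp [hsV x hx]
    · simp only
      by_cases hx : x ∈ V
      · have hs := hk.subLap_nonneg hx
        have hg := weight_pos a (u x)
        have hr := jap_pos (u x)
        have hP := gradSq_nonneg b u x
        have hC := commSq_nonneg b u x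
        have hz := hζ0 x
        have hE : Real.sqrt (gradSq b (fun y => ζ y ^ N) x) ≤ D * ζ x ^ (2 * k + 3) := by
          rw [hsq, hD]
          have := mul_le_mul_of_nonneg_left (hB x) (by positivity : 0 ≤ N * ζ x ^ (2 * k + 3))
          linarith
        have h1 : 1 / 2 * weight1 a (u x) ≤ weight a (u x) / jap (u x) := by
          have := weight1_le (a := a) (by linarith) (u x)
          have e : 2 * weight a (u x) / jap (u x) = 2 * (weight a (u x) / jap (u x)) := by ring
          linarith
        have hY := young_energy (ε := a ^ 2 / 4) (D := D) (z := ζ x) (g := weight a (u x))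
          (r := jap (u x)) (p := Real.sqrt (gradSq b u x)) (d := subLap b u x)
          (c := Real.sqrt (commSq b u x)) (by positivity) hg.le hr hs
        have p4 : Real.sqrt (gradSq b u x) ^ 4 = gradSq b u x ^ 2 := by
          rw [show (4:ℕ) = 2 * 2 by norm_num, pow_mul, Real.sq_sqrt hP]
        rw [p4, Real.sq_sqrt hP, Real.sq_sqrt hC] at hY
        have hY2 := mul_le_mul_of_nonneg_left hY (pow_nonneg hz (2 * k + 2))
        have hS : weight a (u x) * Real.sqrt (gradSq b (fun y => ζ y ^ N) x) *
            Real.sqrt (gradSq b u x) * (2 * subLap b u x + 3 / 2 * Real.sqrt (commSq b u x))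
            + 1 / 2 * weight1 a (u x) * Real.sqrt (gradSq b u x) ^ 3 *
            Real.sqrt (gradSq b (fun y => ζ y ^ N) x) ≤
            weight a (u x) * (D * ζ x ^ (2 * k + 3)) *
            Real.sqrt (gradSq b u x) * (2 * subLap b u x + 3 / 2 * Real.sqrt (commSq b u x))
            + weight a (u x) / jap (u x) * Real.sqrt (gradSq b u x) ^ 3 *
            (D * ζ x ^ (2 * k + 3)) := by
          gcongr
        refine hS.trans (le_trans (le_of_eq ?_) (hY2.trans (le_of_eq ?_)))
        · ring
        · unfold energyDensity
          rw [hN]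
          ring
      · have hNz : N ≠ 0 := by omega
        simp [hsV x hx, hj x hx, hNz]
  rw [integral_add (iG.const_mul _) (iR.const_mul _), integral_const_mul, integral_const_mul]
    at hup
  have h := hlow.trans (key.trans hup)
  have ha3 : 0 < a ^ 2 := by positivity
  set T1 := ∫ x, ζ x ^ N * energyDensity a b u x
  set T2 := ∫ x, ζ x ^ (2 * k + 2) *
      (weight a (u x) * gradSq b u x + weight a (u x) * jap (u x) * subLap b u x)
  have h4 : a ^ 2 / 4 * T1 ≤ D ^ 2 / (a ^ 2 / 4) * T2 := by linarith
  have h5 := mul_le_mul_of_nonneg_left h4 (by positivity : 0 ≤ 4 / a ^ 2)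
  refine le_trans (le_of_eq ?_) (h5.trans (le_of_eq ?_))
  · field_simp
  · field_simp

lemma integral_weight_mul_subLap_le (hb : ∀ i, ContDiff ℝ (⊤ : ℕ∞) (b i)) (hd : DivFree V b)
    (hζ : ContDiff ℝ 1 ζ) (hζs : HasCompactSupport ζ)
    (hζV : tsupport ζ ⊆ V) (hζ0 : ∀ x, 0 ≤ ζ x)
    (hB : ∀ x, Real.sqrt (gradSq b ζ x) ≤ B) (ha : 0 < a) (ha2 : a ≤ 1) {k : ℕ} (hk0 : k ≠ 0)
    (hu : ContDiff ℝ 2 u) :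
    ∫ x, ζ x ^ (2 * k + 2) * (weight a (u x) * jap (u x) * subLap b u x) ≤
      4 * (∫ x, ζ x ^ (2 * k + 2) * (weight a (u x) * gradSq b u x)) +
      ((2 * k + 2 : ℕ) * B) ^ 2 * ∫ x, ζ x ^ (2 * k) * (weight a (u x) * jap (u x) ^ 2) := by
  have hB0 : 0 ≤ B := (Real.sqrt_nonneg _).trans (hB 0)
  have hu1 : ContDiff ℝ 1 u := hu.of_le one_le_two
  have cP := continuous_gradSq hb hu1
  have cu := hu.continuous
  have cw : Continuous (weight a) := (contDiff_weight (k := 0) a).continuous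
  have cj : Continuous jap := (contDiff_jap (k := 0)).continuous
  have c1 : Continuous (weight1 a) :=
    continuous_iff_continuousAt.2 fun t => (hasDerivAt_weight1 a t).continuousAt
  have hj : ∀ t, jap t ≠ 0 := fun t => (jap_pos t).ne'
  have iP : Integrable fun x => ζ x ^ (2 * k + 2) * (weight a (u x) * gradSq b u x) :=
    integrable_pow_mul hζ.continuous hζs (by fun_prop) (by omega)
  have iV : Integrable fun x => ζ x ^ (2 * k) * (weight a (u x) * jap (u x) ^ 2) :=
    integrable_pow_mul hζ.continuous hζs (by fun_prop) (by omega)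
  have hηs : HasCompactSupport fun x => ζ x ^ (2 * k + 2) :=
    hζs.comp_left (g := fun t => t ^ (2 * k + 2)) (by simp)
  have hηV : tsupport (fun x => ζ x ^ (2 * k + 2)) ⊆ V :=
    (closure_mono fun x hx => by
      simp only [Function.mem_support] at hx ⊢
      exact fun h => hx (by simp [h])).trans hζV
  have hF : ∀ t, HasDerivAt (fun t => weight a t * jap t)
      (weight1 a t * jap t + weight a t * (t / jap t)) t := fun t =>
    (hasDerivAt_weight a t).mul (hasDerivAt_jap t)
  have key := integral_mul_comp_subLap_le hb hd hu hF (by fun_prop (disch := simp [hj]))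
    (hζ.pow (2 * k + 2)) hηs hηV (fun x => pow_nonneg (hζ0 x) _)
    ((iP.const_mul 4).add (iV.const_mul (((2 * k + 2 : ℕ) * B) ^ 2))) (fun x => by
      simp only [Pi.add_apply]
      have hg := weight_pos a (u x)
      have hr := jap_pos (u x)
      have hP := gradSq_nonneg b u x
      have hz := hζ0 x
      set D : ℝ := (2 * k + 2 : ℕ) * B with hD
      have hD0 : 0 ≤ D := by positivity
      have hE : Real.sqrt (gradSq b (fun y => ζ y ^ (2 * k + 2)) x) ≤ D * ζ x ^ (2 * k + 1) := by
        rw [sqrt_gradSq_pow (hζ.differentiable one_ne_zero) hζ0, hD]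
        have := mul_le_mul_of_nonneg_left (hB x)
          (by positivity : 0 ≤ ((2 * k + 2 : ℕ) : ℝ) * ζ x ^ (2 * k + 1))
        rw [show 2 * k + 2 - 1 = 2 * k + 1 by omega]
        linarith
      have hf : |weight a (u x) * jap (u x)| = weight a (u x) * jap (u x) :=
        abs_of_nonneg (by positivity)
      have h10 : 0 ≤ weight1 a (u x) := by
        refine le_trans ?_ (le_weight1 (by linarith) (u x))
        positivity
      have hf1 : |weight1 a (u x) * jap (u x) + weight a (u x) * (u x / jap (u x))| ≤
          3 * weight a (u x) := by
        have h1 : weight1 a (u x) * jap (u x) ≤ 2 * weight a (u x) := by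
          have := weight1_le (a := a) (by linarith) (u x)
          rwa [le_div_iff₀ hr] at this
        have h2 : |u x / jap (u x)| ≤ 1 := by
          rw [abs_div, abs_of_pos hr, div_le_one hr]
          exact abs_le_jap _
        have h3 := abs_add_le (weight1 a (u x) * jap (u x)) (weight a (u x) * (u x / jap (u x)))
        rw [abs_of_nonneg (by positivity : 0 ≤ weight1 a (u x) * jap (u x)), abs_mul,
          abs_of_pos hg] at h3
        nlinarith
      rw [hf]
      have hp := Real.sqrt_nonneg (gradSq b u x)
      have hp2 := Real.sq_sqrt hP
      set p := Real.sqrt (gradSq b u x)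
      rw [← hp2]
      calc _ ≤ weight a (u x) * jap (u x) * (D * ζ x ^ (2 * k + 1)) * p +
            ζ x ^ (2 * k + 2) * (3 * weight a (u x)) * p ^ 2 := by gcongr
        _ = ζ x ^ (2 * k) * weight a (u x) *
            (D * jap (u x) * (ζ x * p) + 3 * (ζ x * p) ^ 2) := by ring
        _ ≤ ζ x ^ (2 * k) * weight a (u x) * (D ^ 2 * jap (u x) ^ 2 + 4 * (ζ x * p) ^ 2) := by
          have aux : ∀ s y : ℝ, s * y + 3 * y ^ 2 ≤ s ^ 2 + 4 * y ^ 2 := fun s y => by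
            nlinarith [sq_nonneg (s - y), sq_nonneg s, sq_nonneg y]
          have := aux (D * jap (u x)) (ζ x * p)
          rw [mul_pow D] at this
          exact mul_le_mul_of_nonneg_left this (by positivity)
        _ = _ := by ring)
  simp only [Pi.add_apply] at key
  rw [integral_add (iP.const_mul _) (iV.const_mul _), integral_const_mul, integral_const_mul]
    at key
  simpa only [mul_assoc] using key

lemma integral_weight_mul_gradSq_le (hb : ∀ i, ContDiff ℝ (⊤ : ℕ∞) (b i))
    (hζ : ContDiff ℝ 1 ζ) (hζs : HasCompactSupport ζ)
    (hζV : tsupport ζ ⊆ V) (hζ0 : ∀ x, 0 ≤ ζ x) {k : ℕ} (hk0 : k ≠ 0)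
    (hu : ContDiff ℝ 2 u) (hk : IsKConvex V b 2 u) {ε : ℝ} (hε : 0 < ε) :
    ∫ x, ζ x ^ (2 * k + 2) * (weight a (u x) * gradSq b u x) ≤
      ε * (∫ x, ζ x ^ (2 * k + 4) * energyDensity a b u x) +
      ε⁻¹ * ∫ x, ζ x ^ (2 * k) * (weight a (u x) * jap (u x) ^ 2) := by
  have hu1 : ContDiff ℝ 1 u := hu.of_le one_le_two
  have cP := continuous_gradSq hb hu1
  have cu := hu.continuous
  have cw : Continuous (weight a) := (contDiff_weight (k := 0) a).continuous
  have cj : Continuous jap := (contDiff_jap (k := 0)).continuous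
  have iG : Integrable fun x => ζ x ^ (2 * k + 4) * energyDensity a b u x :=
    integrable_pow_mul hζ.continuous hζs (continuous_energyDensity hb hu) (by omega)
  have iP : Integrable fun x => ζ x ^ (2 * k + 2) * (weight a (u x) * gradSq b u x) :=
    integrable_pow_mul hζ.continuous hζs (by fun_prop) (by omega)
  have iV : Integrable fun x => ζ x ^ (2 * k) * (weight a (u x) * jap (u x) ^ 2) :=
    integrable_pow_mul hζ.continuous hζs (by fun_prop) (by omega)
  rw [← integral_const_mul, ← integral_const_mul,
    ← integral_add (iG.const_mul _) (iV.const_mul _)]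
  refine integral_mono iP ((iG.const_mul _).add (iV.const_mul _)) fun x => ?_
  simp only
  by_cases hx : x ∈ V
  · have hs := hk.subLap_nonneg hx
    have hg := weight_pos a (u x)
    have hr := jap_pos (u x)
    have hP := gradSq_nonneg b u x
    have hC := commSq_nonneg b u x
    have hz := hζ0 x
    have h1 : weight a (u x) / jap (u x) ^ 2 * gradSq b u x ^ 2 ≤ energyDensity a b u x := by
      unfold energyDensity
      have : 0 ≤ weight a (u x) * commSq b u x := by positivity
      have : 0 ≤ weight a (u x) / jap (u x) * gradSq b u x * subLap b u x := by positivity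
      linarith
    have h2 : ζ x ^ 2 * gradSq b u x ≤
        ε * ζ x ^ 4 * gradSq b u x ^ 2 / jap (u x) ^ 2 + ε⁻¹ * jap (u x) ^ 2 := by
      have e : ε * ζ x ^ 4 * gradSq b u x ^ 2 / jap (u x) ^ 2 + ε⁻¹ * jap (u x) ^ 2 -
          2 * (ζ x ^ 2 * gradSq b u x) =
          (ε * ζ x ^ 2 * gradSq b u x - jap (u x) ^ 2) ^ 2 / (ε * jap (u x) ^ 2) := by
        field_simp
        ring
      have : 0 ≤ (ε * ζ x ^ 2 * gradSq b u x - jap (u x) ^ 2) ^ 2 / (ε * jap (u x) ^ 2) := by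
        positivity
      have : 0 ≤ ζ x ^ 2 * gradSq b u x := by positivity
      linarith
    calc ζ x ^ (2 * k + 2) * (weight a (u x) * gradSq b u x)
        = ζ x ^ (2 * k) * weight a (u x) * (ζ x ^ 2 * gradSq b u x) := by ring
      _ ≤ ζ x ^ (2 * k) * weight a (u x) *
          (ε * ζ x ^ 4 * gradSq b u x ^ 2 / jap (u x) ^ 2 + ε⁻¹ * jap (u x) ^ 2) := by gcongr
      _ = ε * (ζ x ^ (2 * k + 4) * (weight a (u x) / jap (u x) ^ 2 * gradSq b u x ^ 2)) +
          ε⁻¹ * (ζ x ^ (2 * k) * (weight a (u x) * jap (u x) ^ 2)) := by ring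
      _ ≤ _ := by gcongr
  · have : ζ x = 0 := image_eq_zero_of_notMem_tsupport fun h => hx (hζV h)
    simp [this, hk0]

/-- The weighted energy is controlled by the weighted square norm of `u`. -/
lemma exists_energy_le (hb : ∀ i, ContDiff ℝ (⊤ : ℕ∞) (b i)) (hd : DivFree V b)
    (h2 : SecondCommVanish V b) (hζ : ContDiff ℝ 1 ζ) (hζs : HasCompactSupport ζ)
    (hζV : tsupport ζ ⊆ V) (hζ0 : ∀ x, 0 ≤ ζ x)
    (hB : ∀ x, Real.sqrt (gradSq b ζ x) ≤ B) (ha : 0 < a) (ha2 : a ≤ 1) {k : ℕ} (hk0 : k ≠ 0) :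
    ∃ C, 0 ≤ C ∧ ∀ u : (Fin n → ℝ) → ℝ, ContDiff ℝ 2 u → IsKConvex V b 2 u →
      ∫ x, ζ x ^ (2 * k + 4) * energyDensity a b u x ≤
        C * ∫ x, ζ x ^ (2 * k) * (weight a (u x) * jap (u x) ^ 2) ∧
      ∫ x, ζ x ^ (2 * k + 2) * (weight a (u x) * gradSq b u x) ≤
        C * ∫ x, ζ x ^ (2 * k) * (weight a (u x) * jap (u x) ^ 2) := by
  set A : ℝ := ((2 * k + 4 : ℕ) * B) ^ 2 * (4 / a ^ 2) ^ 2 with hA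
  set D : ℝ := ((2 * k + 2 : ℕ) * B) ^ 2 with hD
  have hA0 : 0 ≤ A := by positivity
  have hD0 : 0 ≤ D := by positivity
  set E : ℝ := A * (5 + D) + 1 with hE
  have hE0 : 0 < E := by positivity
  refine ⟨4 * E ^ 2 + 2 * E, by positivity, fun u hu hk => ?_⟩
  have hu1 : ContDiff ℝ 1 u := hu.of_le one_le_two
  have cP := continuous_gradSq hb hu1
  have cD := continuous_subLap hb hu
  have cu := hu.continuous
  have cw : Continuous (weight a) := (contDiff_weight (k := 0) a).continuous
  have cj : Continuous jap := (contDiff_jap (k := 0)).continuous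
  have iP : Integrable fun x => ζ x ^ (2 * k + 2) * (weight a (u x) * gradSq b u x) :=
    integrable_pow_mul hζ.continuous hζs (by fun_prop) (by omega)
  have iD : Integrable fun x => ζ x ^ (2 * k + 2) *
      (weight a (u x) * jap (u x) * subLap b u x) :=
    integrable_pow_mul hζ.continuous hζs (by fun_prop) (by omega)
  have s1 := integral_energyDensity_le hb hd h2 hζ hζs hζV hζ0 hB ha ha2 k hu hk
  have s2 := integral_weight_mul_subLap_le hb hd hζ hζs hζV hζ0 hB ha ha2 hk0 hu
  have s3 := integral_weight_mul_gradSq_le (a := a) hb hζ hζs hζV hζ0 hk0 hu hk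
    (ε := (2 * E)⁻¹) (by positivity)
  simp only [mul_add] at s1
  rw [integral_add iP iD] at s1
  have t4 : 0 ≤ ∫ x, ζ x ^ (2 * k) * (weight a (u x) * jap (u x) ^ 2) :=
    integral_nonneg fun x => by
      have := hζ0 x
      have := (weight_pos a (u x)).le
      positivity
  have t2 : 0 ≤ ∫ x, ζ x ^ (2 * k + 2) * (weight a (u x) * gradSq b u x) :=
    integral_nonneg fun x => by
      have := hζ0 x
      have := (weight_pos a (u x)).le
      have := gradSq_nonneg b u x
      positivity
  set T1 := ∫ x, ζ x ^ (2 * k + 4) * energyDensity a b u x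
  set T2 := ∫ x, ζ x ^ (2 * k + 2) * (weight a (u x) * gradSq b u x)
  set T3 := ∫ x, ζ x ^ (2 * k + 2) * (weight a (u x) * jap (u x) * subLap b u x)
  set T4 := ∫ x, ζ x ^ (2 * k) * (weight a (u x) * jap (u x) ^ 2)
  rw [inv_inv] at s3
  have u1 : T1 ≤ E * T2 + E * T4 := by
    have h1 : A * (T2 + T3) ≤ A * (T2 + (4 * T2 + D * T4)) := by gcongr
    have h2 : A * (T2 + (4 * T2 + D * T4)) ≤ E * T2 + E * T4 := by
      have e1 : A * 5 ≤ E := by rw [hE]; nlinarith [mul_nonneg hA0 hD0]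
      have e2 : A * D ≤ E := by rw [hE]; nlinarith [mul_nonneg hA0 hD0]
      have := mul_le_mul_of_nonneg_right e1 t2
      have := mul_le_mul_of_nonneg_right e2 t4
      nlinarith
    linarith
  have u2 : E * T2 ≤ 1 / 2 * T1 + 2 * E ^ 2 * T4 := by
    have := mul_le_mul_of_nonneg_left s3 hE0.le
    have e : E * ((2 * E)⁻¹ * T1 + 2 * E * T4) = 1 / 2 * T1 + 2 * E ^ 2 * T4 := by
      field_simp
    linarith
  have u3 : T1 ≤ (4 * E ^ 2 + 2 * E) * T4 := by linarith
  refine ⟨u3, ?_⟩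
  have u4 : E * T2 ≤ E * ((4 * E ^ 2 + 2 * E) * T4) := by
    have hE1 : 1 ≤ E := by rw [hE]; nlinarith [mul_nonneg hA0 hD0]
    have : 1 / 2 * T1 + 2 * E ^ 2 * T4 ≤ (4 * E ^ 2 + E) * T4 := by linarith
    have h5 : (4 * E ^ 2 + E) * T4 ≤ E * ((4 * E ^ 2 + 2 * E) * T4) := by
      have : 4 * E ^ 2 + E ≤ E * (4 * E ^ 2 + 2 * E) := by nlinarith [sq_nonneg E, mul_pos hE0 hE0, mul_nonneg (mul_pos hE0 hE0).le (sub_nonneg.2 hE1), mul_nonneg hE0.le (sub_nonneg.2 hE1)]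
      nlinarith [mul_le_mul_of_nonneg_right this t4]
    linarith
  exact le_of_mul_le_mul_left u4 hE0

end EnergyEstimate

section Interpolation

/-- Pointwise interpolation between the powers `q` and `1/2`. -/
lemma interpolation_pointwise {q z v s Y : ℝ} (hq : 2 < q) (hz : 0 ≤ z) (hz1 : z ≤ 1) (hv : 0 ≤ v)
    (hs : 0 ≤ s) (hvs : v ≤ s ^ 2) (hY : 0 < Y) {k : ℕ} (hk0 : k ≠ 0)
    (hk : 4 * (q - 1 / 2) ≤ (k + 1) * (q - 2)) :
    z ^ (2 * k) * v ^ 2 ≤ Y ^ (2 - (q - 2) / (q - 1 / 2) / 2) *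
      ((z ^ (k + 1) * v) ^ q / Y ^ q + s) := by
  have hq1 : 0 < q - 1 / 2 := by linarith
  set β := (q - 2) / (q - 1 / 2) with hβ
  have hβ0 : 0 < β := div_pos (by linarith) hq1
  have hβ1 : β ≤ 1 := by rw [hβ, div_le_one hq1]; linarith
  set α := 2 - β / 2 with hα
  have hα0 : 0 < α := by linarith
  have hsum : α / q + β = 1 := by
    have h1 : β * (q - 1 / 2) = q - 2 := div_mul_cancel₀ _ hq1.ne'
    have h2 : q ≠ 0 := by linarith
    rw [div_add' _ _ _ h2, div_eq_one_iff_eq h2, hα]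
    linarith
  have hkβ : (k + 1) * α ≤ 2 * k := by
    have : 4 ≤ (k + 1) * β := by
      rw [hβ, ← mul_div_assoc, le_div_iff₀ hq1]
      linarith
    rw [hα]
    linarith
  rcases hz.eq_or_lt with rfl | hz'
  · rw [zero_pow (by omega), zero_mul]
    positivity
  have hw : 0 ≤ z ^ (k + 1) * v := by positivity
  have h1 : z ^ (2 * k) * v ^ 2 ≤ (z ^ (k + 1) * v) ^ α * s ^ β := by
    have e1 : (z ^ (k + 1) * v) ^ α = z ^ ((k + 1) * α) * v ^ α := by
      rw [Real.mul_rpow (by positivity) hv, ← Real.rpow_natCast z (k + 1), ← Real.rpow_mul hz]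
      push_cast
      rfl
    have e2 : z ^ (2 * k) ≤ z ^ ((k + 1) * α) := by
      rw [← Real.rpow_natCast]
      refine Real.rpow_le_rpow_of_exponent_ge hz' hz1 ?_
      push_cast
      exact hkβ
    have e3 : v ^ (β / 2) ≤ s ^ β := by
      calc v ^ (β / 2) ≤ (s ^ 2) ^ (β / 2) := Real.rpow_le_rpow hv hvs (by positivity)
        _ = s ^ β := by
          rw [← Real.rpow_natCast, ← Real.rpow_mul hs]
          congr 1
          push_cast
          ring
    have e4 : v ^ 2 = v ^ α * v ^ (β / 2) := by
      rw [← Real.rpow_add' hv (by rw [hα]; norm_num), hα, sub_add_cancel]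
      norm_num
    rw [e1, e4, mul_assoc]
    gcongr
  have h2 : (z ^ (k + 1) * v) ^ α = Y ^ α * ((z ^ (k + 1) * v) ^ q / Y ^ q) ^ (α / q) := by
    rw [← Real.div_rpow hw hY.le, ← Real.rpow_mul (by positivity),
      mul_div_cancel₀ _ (by linarith : q ≠ 0), ← Real.mul_rpow hY.le (by positivity),
      mul_div_cancel₀ _ hY.ne']
  have hX : 0 ≤ (z ^ (k + 1) * v) ^ q / Y ^ q := by positivity
  have h3 := Real.geom_mean_le_arith_mean2_weighted (by positivity : 0 ≤ α / q) hβ0.le hX hs hsum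
  have h4 : α / q * ((z ^ (k + 1) * v) ^ q / Y ^ q) + β * s ≤
      (z ^ (k + 1) * v) ^ q / Y ^ q + s := by
    have : α / q ≤ 1 := by linarith
    exact add_le_add (mul_le_of_le_one_left hX this) (mul_le_of_le_one_left hs hβ1)
  calc _ ≤ _ := h1
    _ = Y ^ α * (((z ^ (k + 1) * v) ^ q / Y ^ q) ^ (α / q) * s ^ β) := by rw [h2, mul_assoc]
    _ ≤ _ := by gcongr; exact h3.trans h4

end Interpolation

section EnergyEstimate

variable {n m : ℕ} {V : Set (Fin n → ℝ)} {b : Fin m → (Fin n → ℝ) → (Fin n → ℝ)}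
  {u ζ : (Fin n → ℝ) → ℝ} {a B : ℝ}

/-- The function `√weight · jap`. -/
noncomputable def rootWeight (a t : ℝ) : ℝ := Real.sqrt (weight a t) * jap t

lemma rootWeight_pos (a t : ℝ) : 0 < rootWeight a t :=
  mul_pos (Real.sqrt_pos.2 (weight_pos a t)) (jap_pos t)

lemma rootWeight_sq (a t : ℝ) : rootWeight a t ^ 2 = weight a t * jap t ^ 2 := by
  rw [rootWeight, mul_pow, Real.sq_sqrt (weight_pos a t).le]

lemma contDiff_rootWeight (a : ℝ) {k : WithTop ℕ∞} : ContDiff ℝ k (rootWeight a) :=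
  ((contDiff_weight a).sqrt fun t => (weight_pos a t).ne').mul contDiff_jap

lemma hasDerivAt_rootWeight (a t : ℝ) : HasDerivAt (rootWeight a)
    (weight1 a t / (2 * Real.sqrt (weight a t)) * jap t +
      Real.sqrt (weight a t) * (t / jap t)) t :=
  ((hasDerivAt_weight a t).sqrt (weight_pos a t).ne').mul (hasDerivAt_jap t)

lemma abs_deriv_rootWeight_le (ha : 0 < a) (ha2 : a ≤ 1) (t : ℝ) :
    |weight1 a t / (2 * Real.sqrt (weight a t)) * jap t +
      Real.sqrt (weight a t) * (t / jap t)| ≤ 2 * Real.sqrt (weight a t) := by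
  have hg := weight_pos a t
  have hr := jap_pos t
  have hs := Real.sqrt_pos.2 hg
  have h1 : weight1 a t * jap t ≤ 2 * weight a t := by
    have := weight1_le (a := a) (by linarith) t
    rwa [le_div_iff₀ hr] at this
  have h10 : 0 ≤ weight1 a t := by
    refine le_trans ?_ (le_weight1 (by linarith) t)
    positivity
  have h2 : |t / jap t| ≤ 1 := by
    rw [abs_div, abs_of_pos hr, div_le_one hr]
    exact abs_le_jap _
  refine (abs_add_le _ _).trans ?_
  rw [abs_of_nonneg (by positivity : 0 ≤ weight1 a t / (2 * Real.sqrt (weight a t)) * jap t),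
    abs_mul, abs_of_pos hs]
  have h3 : weight1 a t / (2 * Real.sqrt (weight a t)) * jap t ≤ Real.sqrt (weight a t) := by
    rw [div_mul_eq_mul_div, div_le_iff₀ (by positivity)]
    nlinarith [Real.mul_self_sqrt hg.le]
  nlinarith

lemma rootWeight_le (ha : 0 ≤ a) (ha2 : a ≤ 2) (t : ℝ) :
    rootWeight a t ≤ (2 * jap t) ^ 2 := by
  have hr := jap_pos t
  have : Real.sqrt (weight a t) ≤ 3 * jap t := by
    refine Real.sqrt_le_iff.2 ⟨by positivity, ?_⟩
    have := weight_le ha ha2 t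
    linarith
  unfold rootWeight
  nlinarith

lemma xnrm_sq (b : Fin m → (Fin n → ℝ) → (Fin n → ℝ)) (φ : (Fin n → ℝ) → ℝ) :
    xnrm b φ ^ 2 = (∫ x, φ x ^ 2) + ∑ i, ∫ x, Xop (b i) φ x ^ 2 :=
  Real.sq_sqrt (add_nonneg (integral_nonneg fun _ => sq_nonneg _)
    (Finset.sum_nonneg fun _ _ => integral_nonneg fun _ => sq_nonneg _))

lemma xnrm_cutoff_mul_rootWeight_le (hb : ∀ i, ContDiff ℝ (⊤ : ℕ∞) (b i))
    (hζ : ContDiff ℝ 1 ζ) (hζs : HasCompactSupport ζ) (hζ0 : ∀ x, 0 ≤ ζ x) (hζ1 : ∀ x, ζ x ≤ 1)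
    (hB : ∀ x, Real.sqrt (gradSq b ζ x) ≤ B) (ha : 0 < a) (ha2 : a ≤ 1) {k : ℕ} (hk0 : k ≠ 0)
    (hu : ContDiff ℝ 1 u) :
    xnrm b (fun x => ζ x ^ (k + 1) * rootWeight a (u x)) ^ 2 ≤
      (1 + 2 * ((k + 1) * B) ^ 2) * (∫ x, ζ x ^ (2 * k) * (weight a (u x) * jap (u x) ^ 2)) +
      8 * ∫ x, ζ x ^ (2 * k + 2) * (weight a (u x) * gradSq b u x) := by
  have cP := continuous_gradSq hb hu
  have cu := hu.continuous
  have cw : Continuous (weight a) := (contDiff_weight (k := 0) a).continuous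
  have cj : Continuous jap := (contDiff_jap (k := 0)).continuous
  have iP : Integrable fun x => ζ x ^ (2 * k + 2) * (weight a (u x) * gradSq b u x) :=
    integrable_pow_mul hζ.continuous hζs (by fun_prop) (by omega)
  have iV : Integrable fun x => ζ x ^ (2 * k) * (weight a (u x) * jap (u x) ^ 2) :=
    integrable_pow_mul hζ.continuous hζs (by fun_prop) (by omega)
  set w : (Fin n → ℝ) → ℝ := fun x => ζ x ^ (k + 1) * rootWeight a (u x) with hw
  have hw1 : ContDiff ℝ 1 w := (hζ.pow (k + 1)).mul ((contDiff_rootWeight a).comp hu)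
  have hws : HasCompactSupport w :=
    (hζs.comp_left (g := fun t => t ^ (k + 1)) (by simp)).mul_right
  have iw : Integrable fun x => w x ^ 2 := integrable_sq hw1.continuous hws
  have iX : ∀ i, Integrable fun x => Xop (b i) w x ^ 2 := fun i =>
    integrable_sq (continuous_xop (hb i) hw1) (hasCompactSupport_xop _ hws)
  have iXs : Integrable fun x => ∑ i, Xop (b i) w x ^ 2 := integrable_finsetSum _ fun i _ => iX i
  have iwX : Integrable fun x => w x ^ 2 + ∑ i, Xop (b i) w x ^ 2 := iw.add iXs
  rw [xnrm_sq, ← integral_finsetSum _ fun i _ => iX i, ← integral_add iw iXs,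
    ← integral_const_mul, ← integral_const_mul, ← integral_add (iV.const_mul _) (iP.const_mul _)]
  refine integral_mono iwX ((iV.const_mul _).add (iP.const_mul _)) fun x => ?_
  simp only
  have hz := hζ0 x
  have hz1 := hζ1 x
  have hg := weight_pos a (u x)
  have hP := gradSq_nonneg b u x
  have hB2 : gradSq b ζ x ≤ B ^ 2 := by
    rw [← Real.sq_sqrt (gradSq_nonneg b ζ x)]
    exact pow_le_pow_left₀ (Real.sqrt_nonneg _) (hB x) 2
  set R := rootWeight a (u x) with hR
  set R1 := weight1 a (u x) / (2 * Real.sqrt (weight a (u x))) * jap (u x) +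
      Real.sqrt (weight a (u x)) * (u x / jap (u x)) with hR1
  have hR1' : R1 ^ 2 ≤ 4 * weight a (u x) := by
    have := abs_deriv_rootWeight_le ha ha2 (u x)
    rw [← sq_abs]
    refine (pow_le_pow_left₀ (abs_nonneg _) this 2).trans (le_of_eq ?_)
    rw [mul_pow, Real.sq_sqrt hg.le]
    norm_num
  have hX : ∀ i, Xop (b i) w x ^ 2 ≤ 2 * (R * ((k + 1) * ζ x ^ k)) ^ 2 * Xop (b i) ζ x ^ 2 +
      2 * (ζ x ^ (k + 1) * R1) ^ 2 * Xop (b i) u x ^ 2 := fun i => by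
    have hud := hu.differentiable one_ne_zero x
    have hζd := hζ.differentiable one_ne_zero x
    have e : Xop (b i) w x = R * ((k + 1) * ζ x ^ k) * Xop (b i) ζ x +
        ζ x ^ (k + 1) * R1 * Xop (b i) u x := by
      rw [hw, xop_mul (u := fun x => ζ x ^ (k + 1)) (v := fun x => rootWeight a (u x))
        (hζd.pow (k + 1)) ((hasDerivAt_rootWeight a (u x)).differentiableAt.comp x hud),
        xop_comp (hasDerivAt_rootWeight a (u x)) hud,
        xop_comp (g := fun t => t ^ (k + 1)) (hasDerivAt_pow (k + 1) (ζ x)) hζd]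
      simp only [add_tsub_cancel_right]
      push_cast
      ring
    rw [e]
    nlinarith [sq_nonneg (R * ((k + 1) * ζ x ^ k) * Xop (b i) ζ x -
        ζ x ^ (k + 1) * R1 * Xop (b i) u x)]
  have hXs : ∑ i, Xop (b i) w x ^ 2 ≤ 2 * (R * ((k + 1) * ζ x ^ k)) ^ 2 * gradSq b ζ x +
      2 * (ζ x ^ (k + 1) * R1) ^ 2 * gradSq b u x := by
    unfold gradSq
    rw [Finset.mul_sum, Finset.mul_sum, ← Finset.sum_add_distrib]
    exact Finset.sum_le_sum fun i _ => hX i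
  have hRs : R ^ 2 = weight a (u x) * jap (u x) ^ 2 := rootWeight_sq a (u x)
  rw [← hRs]
  have h1 : w x ^ 2 ≤ ζ x ^ (2 * k) * R ^ 2 := by
    have : w x ^ 2 = ζ x ^ (2 * k) * R ^ 2 * ζ x ^ 2 := by rw [hw]; ring
    rw [this]
    exact mul_le_of_le_one_right (by positivity) (pow_le_one₀ hz hz1)
  have h2 : 2 * (R * ((k + 1) * ζ x ^ k)) ^ 2 * gradSq b ζ x ≤
      2 * ((k + 1) * B) ^ 2 * (ζ x ^ (2 * k) * R ^ 2) := by
    have := mul_le_mul_of_nonneg_left hB2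
      (by positivity : 0 ≤ 2 * (R * ((k + 1) * ζ x ^ k)) ^ 2)
    refine this.trans (le_of_eq (by ring))
  have h3 : 2 * (ζ x ^ (k + 1) * R1) ^ 2 * gradSq b u x ≤
      8 * (ζ x ^ (2 * k + 2) * (weight a (u x) * gradSq b u x)) := by
    have := mul_le_mul_of_nonneg_left hR1'
      (by positivity : 0 ≤ 2 * ζ x ^ (2 * k + 2) * gradSq b u x)
    refine le_trans (le_of_eq (by ring)) (this.trans (le_of_eq (by ring)))
  linarith

lemma le_rpow_of_le_mul_rpow {I L Q α β : ℝ} (hI : 0 ≤ I) (hL : 0 ≤ L) (hQ : 0 ≤ Q) (hβ : 0 < β)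
    (hα : α = 2 - β / 2) (h : I ≤ (L * Real.sqrt I) ^ α * Q) : I ≤ (L ^ α * Q) ^ (4 / β) := by
  rcases hI.eq_or_lt with rfl | hI'
  · positivity
  have h1 : (L * Real.sqrt I) ^ α = L ^ α * I ^ (α / 2) := by
    rw [Real.mul_rpow hL (Real.sqrt_nonneg _), Real.sqrt_eq_rpow, ← Real.rpow_mul hI]
    congr 2
    ring
  have h2 : I ^ (β / 4) ≤ L ^ α * Q := by
    have e : I = I ^ (β / 4) * I ^ (α / 2) := by
      rw [← Real.rpow_add hI', hα]
      ring_nf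
      rw [Real.rpow_one]
    have h3 : I ^ (β / 4) * I ^ (α / 2) ≤ L ^ α * Q * I ^ (α / 2) := by
      rw [← e]
      refine h.trans (le_of_eq ?_)
      rw [h1]
      ring
    exact le_of_mul_le_mul_right h3 (Real.rpow_pos_of_pos hI' _)
  calc I = (I ^ (β / 4)) ^ (4 / β) := by
        rw [← Real.rpow_mul hI, show β / 4 * (4 / β) = 1 by field_simp, Real.rpow_one]
    _ ≤ _ := Real.rpow_le_rpow (by positivity) h2 (by positivity)

lemma integral_weight_sq_le_interpolation (hζ : Continuous ζ) (hζs : HasCompactSupport ζ)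
    (hζ0 : ∀ x, 0 ≤ ζ x) (hζ1 : ∀ x, ζ x ≤ 1) (ha : 0 < a) (ha2 : a ≤ 1) {k : ℕ} (hk0 : k ≠ 0)
    {q : ℝ} (hq : 2 < q) (hk : 4 * (q - 1 / 2) ≤ (k + 1) * (q - 2)) (hu : Continuous u)
    (huK : ∫ x in tsupport ζ, |u x| ≤ 1) {Y : ℝ} (hY : 0 < Y)
    (hwY : ∫ x, |ζ x ^ (k + 1) * rootWeight a (u x)| ^ q ≤ Y ^ q) :
    ∫ x, ζ x ^ (2 * k) * (weight a (u x) * jap (u x) ^ 2) ≤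
      Y ^ (2 - (q - 2) / (q - 1 / 2) / 2) * (1 + 2 * (volume.real (tsupport ζ) + 1)) := by
  have hR : Continuous (rootWeight a) := (contDiff_rootWeight a (k := 0)).continuous
  have cw : Continuous (weight a) := (contDiff_weight (k := 0) a).continuous
  have cj : Continuous jap := (contDiff_jap (k := 0)).continuous
  have hT : IsCompact (tsupport ζ) := hζs
  have hTm : MeasurableSet (tsupport ζ) := (isClosed_tsupport ζ).measurableSet
  have iV : Integrable fun x => ζ x ^ (2 * k) * (weight a (u x) * jap (u x) ^ 2) :=
    integrable_pow_mul hζ hζs (by fun_prop) (by omega)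
  have iW : Integrable fun x => |ζ x ^ (k + 1) * rootWeight a (u x)| ^ q := by
    refine Continuous.integrable_of_hasCompactSupport
      (Continuous.rpow_const (by fun_prop) fun x => Or.inr (by linarith)) ?_
    refine HasCompactSupport.intro hζs fun x hx => ?_
    rw [image_eq_zero_of_notMem_tsupport hx]
    simp [Real.zero_rpow (by linarith : q ≠ 0)]
  have iJ : IntegrableOn (fun x => 2 * jap (u x)) (tsupport ζ) :=
    ContinuousOn.integrableOn_compact hT (by fun_prop)
  have iA : IntegrableOn (fun x => 2 * (1 + |u x|)) (tsupport ζ) :=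
    ContinuousOn.integrableOn_compact hT (by fun_prop)
  have iU : IntegrableOn (fun x => |u x|) (tsupport ζ) :=
    ContinuousOn.integrableOn_compact hT (by fun_prop)
  have hS : ∫ x in tsupport ζ, 2 * jap (u x) ≤ 2 * (volume.real (tsupport ζ) + 1) := by
    have h1 : ∫ x in tsupport ζ, 2 * jap (u x) ≤ ∫ x in tsupport ζ, 2 * (1 + |u x|) :=
      integral_mono iJ iA fun x => by have := jap_le (u x); dsimp only; linarith
    refine h1.trans ?_
    rw [integral_const_mul, integral_add ?_ iU]
    · simp only [integral_const, smul_eq_mul, mul_one, measureReal_restrict_apply_univ]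
      linarith
    · exact (integrableOn_const (hs := hT.measure_lt_top.ne))
  set α := 2 - (q - 2) / (q - 1 / 2) / 2
  have iS : Integrable ((tsupport ζ).indicator fun x => 2 * jap (u x)) :=
    (integrable_indicator_iff hTm).2 iJ
  have iR : Integrable fun x => Y ^ α * (|ζ x ^ (k + 1) * rootWeight a (u x)| ^ q / Y ^ q +
      (tsupport ζ).indicator (fun x => 2 * jap (u x)) x) :=
    ((iW.div_const _).add iS).const_mul _
  have h := integral_mono iV iR fun x => by
    by_cases hx : x ∈ tsupport ζ
    · have hv := rootWeight_pos a (u x)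
      have hj := jap_pos (u x)
      have hz := hζ0 x
      simp only [Set.indicator_of_mem hx]
      rw [← rootWeight_sq, abs_of_nonneg (by positivity)]
      exact interpolation_pointwise hq hz (hζ1 x) hv.le (by positivity)
        (rootWeight_le ha.le (by linarith) _) hY hk0 hk
    · simp only [image_eq_zero_of_notMem_tsupport hx, Set.indicator_of_notMem hx]
      rw [zero_pow (by omega), zero_mul]
      positivity
  refine h.trans ?_
  rw [integral_const_mul, integral_add (iW.div_const _) iS, integral_div,
    integral_indicator hTm]
  have hYq : 0 < Y ^ q := Real.rpow_pos_of_pos hY q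
  have : (∫ x, |ζ x ^ (k + 1) * rootWeight a (u x)| ^ q) / Y ^ q ≤ 1 := by
    rwa [div_le_one hYq]
  gcongr

/-- Bootstrapping an `L¹` bound into a bound of the weighted energy. -/
lemma exists_weighted_bound (hb : ∀ i, ContDiff ℝ (⊤ : ℕ∞) (b i)) (hd : DivFree V b)
    (h2 : SecondCommVanish V b) (hζ : ContDiff ℝ 2 ζ) (hζs : HasCompactSupport ζ)
    (hζV : tsupport ζ ⊆ V) (hζ0 : ∀ x, 0 ≤ ζ x) (hζ1 : ∀ x, ζ x ≤ 1)
    (hB : ∀ x, Real.sqrt (gradSq b ζ x) ≤ B) (ha : 0 < a) (ha2 : a ≤ 1)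
    {q : ℝ} (hq : 2 < q) {Cs : ℝ} (hS : ∀ φ : (Fin n → ℝ) → ℝ,
      ContDiff ℝ 2 φ → tsupport φ ⊆ tsupport ζ → ∫ x, |φ x| ^ q ≤ Cs * xnrm b φ ^ q) :
    ∃ k : ℕ, k ≠ 0 ∧ ∃ C, 0 ≤ C ∧ ∀ u : (Fin n → ℝ) → ℝ, ContDiff ℝ 2 u → IsKConvex V b 2 u →
      ∫ x in tsupport ζ, |u x| ≤ 1 →
      ∫ x, |ζ x ^ (k + 1) * rootWeight a (u x)| ^ q ≤ C ∧
      ∫ x, ζ x ^ (2 * k + 4) * energyDensity a b u x ≤ C := by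
  obtain ⟨j, hj⟩ := exists_nat_ge (4 * (q - 1 / 2) / (q - 2))
  set k := j + 1 with hk'
  have hk0 : k ≠ 0 := by omega
  have hk : 4 * (q - 1 / 2) ≤ (k + 1) * (q - 2) := by
    rw [div_le_iff₀ (by linarith)] at hj
    rw [hk']
    push_cast
    nlinarith
  have hζc : ContDiff ℝ 1 ζ := hζ.of_le one_le_two
  obtain ⟨C1, hC1, hen⟩ := exists_energy_le hb hd h2 hζc hζs hζV hζ0 hB ha ha2 hk0
  set C2 : ℝ := 1 + 2 * ((k + 1) * B) ^ 2 + 8 * C1 with hC2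
  have hC20 : 0 < C2 := by positivity
  set L : ℝ := max Cs 1 * Real.sqrt C2 with hL
  have hm : 1 ≤ max Cs 1 := le_max_right _ _
  have hL0 : 0 < L := mul_pos (by linarith) (Real.sqrt_pos.2 hC20)
  set Q : ℝ := 1 + 2 * (volume.real (tsupport ζ) + 1) with hQ
  have hQ0 : 0 ≤ Q := by positivity
  have hq1 : 0 < q - 1 / 2 := by linarith
  set β := (q - 2) / (q - 1 / 2) with hβ
  have hβ0 : 0 < β := div_pos (by linarith) hq1
  set C0 : ℝ := (L ^ (2 - β / 2) * Q) ^ (4 / β) with hC0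
  have hC00 : 0 ≤ C0 := by positivity
  refine ⟨k, hk0, (L * Real.sqrt C0) ^ q + C1 * C0, by positivity, fun u hu hkc huK => ?_⟩
  have hu1 : ContDiff ℝ 1 u := hu.of_le one_le_two
  obtain ⟨en1, en2⟩ := hen u hu hkc
  have hx := xnrm_cutoff_mul_rootWeight_le hb hζc hζs hζ0 hζ1 hB ha ha2 hk0 hu1
  have hw2 : ContDiff ℝ 2 fun x => ζ x ^ (k + 1) * rootWeight a (u x) :=
    (hζ.pow (k + 1)).mul ((contDiff_rootWeight a).comp hu)
  have hsub : tsupport (fun x => ζ x ^ (k + 1) * rootWeight a (u x)) ⊆ tsupport ζ :=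
    closure_mono fun x hx => by
      simp only [Function.mem_support] at hx ⊢
      exact fun h => hx (by simp [h])
  have hSu := hS _ hw2 hsub
  have hI0 : 0 ≤ ∫ x, ζ x ^ (2 * k) * (weight a (u x) * jap (u x) ^ 2) :=
    integral_nonneg fun x => by
      have := hζ0 x
      have := (weight_pos a (u x)).le
      positivity
  have hinterp := fun (Y : ℝ) (hY : 0 < Y) hwY => integral_weight_sq_le_interpolation (a := a)
    (u := u) hζ.continuous hζs hζ0 hζ1 ha ha2 hk0 hq hk hu.continuous huK (Y := Y) hY hwY
  set I := ∫ x, ζ x ^ (2 * k) * (weight a (u x) * jap (u x) ^ 2)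
  have hxI : xnrm b (fun x => ζ x ^ (k + 1) * rootWeight a (u x)) ≤
      Real.sqrt C2 * Real.sqrt I := by
    rw [← Real.sqrt_mul hC20.le]
    refine Real.le_sqrt_of_sq_le (hx.trans ?_)
    rw [hC2]
    linarith
  have hwq : ∫ x, |ζ x ^ (k + 1) * rootWeight a (u x)| ^ q ≤ (L * Real.sqrt I) ^ q := by
    refine hSu.trans ?_
    have h1 : xnrm b (fun x => ζ x ^ (k + 1) * rootWeight a (u x)) ^ q ≤
        (Real.sqrt C2 * Real.sqrt I) ^ q :=
      Real.rpow_le_rpow (xnrm_nonneg _ _) hxI (by linarith)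
    have h2 : Cs ≤ (max Cs 1) ^ q :=
      (le_max_left _ _).trans (Real.self_le_rpow_of_one_le hm (by linarith))
    rw [hL, mul_assoc, Real.mul_rpow (by linarith) (by positivity)]
    exact mul_le_mul h2 h1 (Real.rpow_nonneg (xnrm_nonneg _ _) _) (by positivity)
  have hIC : I ≤ C0 := by
    rcases hI0.eq_or_lt with h0 | hI'
    · rw [← h0]; exact hC00
    · exact le_rpow_of_le_mul_rpow hI0 hL0.le hQ0 hβ0 rfl
        (hinterp _ (mul_pos hL0 (Real.sqrt_pos.2 hI')) hwq)
  have h3 : C1 * I ≤ C1 * C0 := by gcongr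
  have h4 : (L * Real.sqrt I) ^ q ≤ (L * Real.sqrt C0) ^ q := by gcongr
  have h5 : 0 ≤ (L * Real.sqrt C0) ^ q := by positivity
  have h6 : 0 ≤ C1 * C0 := by positivity
  exact ⟨by linarith, by linarith⟩

end EnergyEstimate

section UnweightedEstimate

variable {n m : ℕ} {V : Set (Fin n → ℝ)} {b : Fin m → (Fin n → ℝ) → (Fin n → ℝ)}
  {u ζ : (Fin n → ℝ) → ℝ} {a B : ℝ}

lemma exists_jap_sq_div_weight_le (ha : 0 < a) {q : ℝ} (hq : 0 < q)
    (haq : 2 + 3 * a ≤ q * (1 - a / 2)) :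
    ∃ C, 0 ≤ C ∧ ∀ t, jap t ^ 2 / weight a t ≤ C * rootWeight a t ^ q ∧
      jap t ^ 2 / weight a t ^ 3 ≤ C * rootWeight a t ^ q := by
  refine ⟨2 ^ (3 * a) * 2 ^ (a * q / 2), by positivity, fun t => ?_⟩
  have hg := weight_pos a t
  have hr := jap_pos t
  have hr1 := one_le_jap t
  have h1 := one_le_weight_mul ha t
  set e := (2 * jap t) ^ a with he
  have he1 : 1 ≤ e := Real.one_le_rpow (by linarith) ha.le
  have hge : 1 / weight a t ≤ e := by
    rw [div_le_iff₀ hg]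
    linarith
  have hW : jap t ^ 2 * e ^ 3 ≤ 2 ^ (3 * a) * 2 ^ (a * q / 2) * rootWeight a t ^ q := by
    have e1 : jap t ^ 2 * e ^ 3 = 2 ^ (3 * a) * jap t ^ (2 + 3 * a) := by
      rw [he, ← Real.rpow_natCast ((2 * jap t) ^ a), ← Real.rpow_mul (by positivity),
        Real.mul_rpow (by norm_num) hr.le, Real.rpow_add hr, ← Real.rpow_natCast (jap t)]
      push_cast
      ring_nf
    have e2 : jap t ^ (2 + 3 * a) ≤ jap t ^ (q * (1 - a / 2)) :=
      Real.rpow_le_rpow_of_exponent_le hr1 haq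
    have e3 : jap t ^ (1 - a / 2) ≤ 2 ^ (a / 2) * rootWeight a t := by
      have f1 : 1 ≤ Real.sqrt (weight a t) * (2 * jap t) ^ (a / 2) := by
        have : (2 * jap t) ^ (a / 2) = Real.sqrt e := by
          rw [he, Real.sqrt_eq_rpow, ← Real.rpow_mul (by positivity)]
          ring_nf
        rw [this, ← Real.sqrt_mul hg.le]
        exact Real.one_le_sqrt.2 h1
      have f2 : jap t = jap t ^ (1 - a / 2) * jap t ^ (a / 2) := by
        rw [← Real.rpow_add hr]
        simp
      have f3 : 0 < jap t ^ (1 - a / 2) := Real.rpow_pos_of_pos hr _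
      rw [Real.mul_rpow (by norm_num) hr.le] at f1
      calc jap t ^ (1 - a / 2) ≤ jap t ^ (1 - a / 2) *
            (Real.sqrt (weight a t) * (2 ^ (a / 2) * jap t ^ (a / 2))) :=
            le_mul_of_one_le_right f3.le f1
        _ = 2 ^ (a / 2) * (Real.sqrt (weight a t) * (jap t ^ (1 - a / 2) * jap t ^ (a / 2))) := by
            ring
        _ = _ := by rw [← f2]; rfl
    have e4 : jap t ^ (q * (1 - a / 2)) ≤ 2 ^ (a * q / 2) * rootWeight a t ^ q := by
      calc jap t ^ (q * (1 - a / 2)) = (jap t ^ (1 - a / 2)) ^ q := by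
            rw [← Real.rpow_mul hr.le, mul_comm]
        _ ≤ (2 ^ (a / 2) * rootWeight a t) ^ q :=
            Real.rpow_le_rpow (by positivity) e3 hq.le
        _ = _ := by
            rw [Real.mul_rpow (by positivity) (rootWeight_pos a t).le, ← Real.rpow_mul (by norm_num)]
            ring_nf
    rw [e1, mul_assoc]
    exact mul_le_mul_of_nonneg_left (e2.trans e4) (by positivity)
  constructor
  · refine le_trans ?_ hW
    rw [div_eq_mul_one_div]
    refine mul_le_mul_of_nonneg_left (hge.trans ?_) (by positivity)
    exact le_self_pow₀ he1 (by norm_num)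
  · refine le_trans ?_ hW
    rw [div_eq_mul_one_div, ← one_div_pow]
    exact mul_le_mul_of_nonneg_left (pow_le_pow_left₀ (by positivity) hge 3) (by positivity)

lemma exists_sqrt_gradSq_le (hb : ∀ i, ContDiff ℝ (⊤ : ℕ∞) (b i)) (hζ : ContDiff ℝ 1 ζ)
    (hζs : HasCompactSupport ζ) : ∃ B, 0 ≤ B ∧ ∀ x, Real.sqrt (gradSq b ζ x) ≤ B := by
  have hc : Continuous fun x => Real.sqrt (gradSq b ζ x) := (continuous_gradSq hb hζ).sqrt
  have hs : HasCompactSupport fun x => Real.sqrt (gradSq b ζ x) :=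
    HasCompactSupport.intro hζs fun x hx => by
      simp [gradSq, xop_eq_zero_of_notMem_tsupport hx]
  obtain ⟨B, hB⟩ := hc.bounded_above_of_compact_support hs
  exact ⟨B, (norm_nonneg _).trans (hB 0), fun x => (le_abs_self _).trans (hB x)⟩

lemma hasDerivAt_jap_div_weight (a t : ℝ) : HasDerivAt (fun t => jap t / weight a t)
    ((t / jap t * weight a t - jap t * weight1 a t) / weight a t ^ 2) t :=
  (hasDerivAt_jap t).div (hasDerivAt_weight a t) (weight_pos a t).ne'

lemma abs_deriv_jap_div_weight_le (ha : 0 < a) (ha2 : a ≤ 1) (t : ℝ) :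
    |(t / jap t * weight a t - jap t * weight1 a t) / weight a t ^ 2| ≤ 3 / weight a t := by
  have hg := weight_pos a t
  have hr := jap_pos t
  have h1 : weight1 a t * jap t ≤ 2 * weight a t := by
    have := weight1_le (a := a) (by linarith) t
    rwa [le_div_iff₀ hr] at this
  have h10 : 0 ≤ weight1 a t := by
    refine le_trans ?_ (le_weight1 (by linarith) t)
    positivity
  have h2 : |t / jap t| ≤ 1 := by
    rw [abs_div, abs_of_pos hr, div_le_one hr]
    exact abs_le_jap _
  have h3 : |t / jap t * weight a t - jap t * weight1 a t| ≤ 3 * weight a t := by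
    refine (abs_sub _ _).trans ?_
    rw [abs_mul, abs_of_pos hg, abs_of_nonneg (by positivity : 0 ≤ jap t * weight1 a t)]
    nlinarith
  rw [abs_div, abs_of_pos (by positivity : 0 < weight a t ^ 2), div_le_div_iff₀ (by positivity) hg]
  nlinarith

/-- If `Φ` dominates the weighted quantities near the support of the cutoffs, the commutators are
square integrable with a bound in terms of `∫ Φ`. -/
lemma integral_sq_mul_commSq_le (hb : ∀ i, ContDiff ℝ (⊤ : ℕ∞) (b i)) (hd : DivFree V b)
    (h2 : SecondCommVanish V b) (ha : 0 < a) (ha2 : a ≤ 1) {ζ₀ η : (Fin n → ℝ) → ℝ}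
    (hζ : ContDiff ℝ 1 ζ₀) (hζs : HasCompactSupport ζ₀)
    (hζV : tsupport ζ₀ ⊆ V) (hζ0 : ∀ x, 0 ≤ ζ₀ x) (hζ1 : ∀ x, ζ₀ x ≤ 1)
    (hη : ContDiff ℝ 1 η) (hηs : HasCompactSupport η)
    (hη0 : ∀ x, 0 ≤ η x) (hη1 : ∀ x, η x ≤ 1) (hηζ : ∀ x ∈ tsupport η, ζ₀ x = 1)
    {B₀ B₁ : ℝ} (hB₀ : ∀ x, Real.sqrt (gradSq b ζ₀ x) ≤ B₀)
    (hB₁ : ∀ x, Real.sqrt (gradSq b η x) ≤ B₁)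
    (hu : ContDiff ℝ 2 u) (hk : IsKConvex V b 2 u) {Φ : (Fin n → ℝ) → ℝ} (hΦ : Integrable Φ)
    (hΦ0 : ∀ x, 0 ≤ Φ x) (hΦ1 : ∀ x ∈ tsupport ζ₀, jap (u x) ^ 2 / weight a (u x) ≤ Φ x)
    (hΦ2 : ∀ x ∈ tsupport ζ₀, gradSq b u x / weight a (u x) ≤ Φ x)
    (hΦ3 : ∀ x ∈ tsupport ζ₀, gradSq b u x ≤ Φ x)
    (hΦ4 : ∀ x ∈ tsupport ζ₀,
      weight a (u x) / jap (u x) * gradSq b u x * subLap b u x ≤ Φ x) :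
    ∫ x, η x ^ 2 * commSq b u x ≤
      4 * (4 * B₁ + 9 / 2 * B₁ ^ 2 + 4 * B₁ * (2 * B₀ + 3)) * ∫ x, Φ x := by
  have hB₀0 : 0 ≤ B₀ := (Real.sqrt_nonneg _).trans (hB₀ 0)
  have hB₁0 : 0 ≤ B₁ := (Real.sqrt_nonneg _).trans (hB₁ 0)
  have hu1 : ContDiff ℝ 1 u := hu.of_le one_le_two
  have cP := continuous_gradSq hb hu1
  have cD := continuous_subLap hb hu
  have cC := continuous_commSq hb hu
  have cu := hu.continuous
  have cw : Continuous (weight a) := (contDiff_weight (k := 0) a).continuous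
  have cj : Continuous jap := (contDiff_jap (k := 0)).continuous
  have c1 : Continuous (weight1 a) :=
    continuous_iff_continuousAt.2 fun t => (hasDerivAt_weight1 a t).continuousAt
  have hj : ∀ t, jap t ≠ 0 := fun t => (jap_pos t).ne'
  have hw : ∀ t, weight a t ≠ 0 := fun t => (weight_pos a t).ne'
  have hsup : tsupport η ⊆ tsupport ζ₀ := fun x hx => by
    by_contra h
    have := hηζ x hx
    rw [image_eq_zero_of_notMem_tsupport h] at this
    norm_num at this
  -- the bound for the sub-Laplacian
  have hlap : ∫ x, ζ₀ x * (jap (u x) / weight a (u x)) * subLap b u x ≤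
      (2 * B₀ + 3) * ∫ x, Φ x := by
    rw [← integral_const_mul]
    refine integral_mul_comp_subLap_le hb hd hu (hasDerivAt_jap_div_weight a)
      (by fun_prop (disch := simp [hw])) hζ hζs hζV hζ0 (hΦ.const_mul _) fun x => ?_
    by_cases hx : x ∈ tsupport ζ₀
    · have hg := weight_pos a (u x)
      have hr := jap_pos (u x)
      have hP := gradSq_nonneg b u x
      have hF1 := abs_deriv_jap_div_weight_le ha ha2 (u x)
      rw [abs_of_pos (div_pos hr hg)]
      have hp := Real.sqrt_nonneg (gradSq b u x)
      have hp2 := Real.sq_sqrt hP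
      have e1 : jap (u x) / weight a (u x) * B₀ * Real.sqrt (gradSq b u x) ≤ 2 * B₀ * Φ x := by
        have : jap (u x) * Real.sqrt (gradSq b u x) ≤ jap (u x) ^ 2 + gradSq b u x := by
          nlinarith [sq_nonneg (jap (u x) - Real.sqrt (gradSq b u x))]
        have h3 : jap (u x) * Real.sqrt (gradSq b u x) / weight a (u x) ≤ 2 * Φ x := by
          have := div_le_div_of_nonneg_right this hg.le
          rw [add_div] at this
          linarith [hΦ1 x hx, hΦ2 x hx]
        have := mul_le_mul_of_nonneg_left h3 hB₀0
        refine le_trans (le_of_eq (by ring)) (this.trans (le_of_eq (by ring)))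
      have e2 : 1 * (3 / weight a (u x)) * gradSq b u x ≤ 3 * Φ x := by
        have := hΦ2 x hx
        refine le_trans (le_of_eq ?_) (mul_le_mul_of_nonneg_left this (by norm_num : (0:ℝ) ≤ 3))
        ring
      calc _ ≤ jap (u x) / weight a (u x) * B₀ * Real.sqrt (gradSq b u x) +
            1 * (3 / weight a (u x)) * gradSq b u x := by
            have := hB₀ x
            have := hζ1 x
            gcongr
        _ ≤ _ := by linarith
    · have h0 : gradSq b ζ₀ x = 0 := by simp [gradSq, xop_eq_zero_of_notMem_tsupport hx]
      rw [h0, image_eq_zero_of_notMem_tsupport hx]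
      have := hΦ0 x
      simp only [Real.sqrt_zero, mul_zero, zero_mul, add_zero]
      positivity
  have hη2s : HasCompactSupport fun x => η x ^ 2 := hηs.comp_left (g := fun t => t ^ 2) (by simp)
  have hη2V : tsupport (fun x => η x ^ 2) ⊆ V :=
    (closure_mono fun x hx => by
      simp only [Function.mem_support] at hx ⊢
      exact fun h => hx (by simp [h])).trans (hsup.trans hζV)
  have key := weighted_integral_le hb hd h2 hu hk (hη.pow 2) hη2s hη2V
    (fun x => sq_nonneg _) (g := fun _ => 1) (g1 := fun _ => 0) (g2 := fun _ => 0)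
    (fun t => hasDerivAt_const t 1) (fun t => hasDerivAt_const t 0) continuous_const
    (fun _ => zero_le_one) (fun _ => le_rfl)
  simp only [mul_zero, zero_mul, add_zero, mul_one, one_mul] at key
  have iC : Integrable fun x => η x ^ 2 * commSq b u x :=
    integrable_pow_mul hη.continuous hηs cC two_ne_zero
  have iL : Integrable fun x => ζ₀ x * (jap (u x) / weight a (u x)) * subLap b u x := by
    refine Continuous.integrable_of_hasCompactSupport ?_ hζs.mul_right.mul_right
    have := hζ.continuous
    fun_prop (disch := simp [hw])
  have hup : ∫ x, Real.sqrt (gradSq b (fun y => η y ^ 2) x) * Real.sqrt (gradSq b u x) *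
      (2 * subLap b u x + 3 / 2 * Real.sqrt (commSq b u x)) ≤
      ∫ x, (1 / 2 * (η x ^ 2 * commSq b u x) + (4 * B₁ + 9 / 2 * B₁ ^ 2) * Φ x +
        4 * B₁ * (ζ₀ x * (jap (u x) / weight a (u x)) * subLap b u x)) := by
    have hsq : ∀ x, Real.sqrt (gradSq b (fun y => η y ^ 2) x) =
        2 * η x * Real.sqrt (gradSq b η x) := fun x => by
      rw [sqrt_gradSq_pow (hη.differentiable one_ne_zero) hη0 2 x]
      simp
    refine integral_mono_of_nonneg (Eventually.of_forall fun x => ?_)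
      (((iC.const_mul _).add (hΦ.const_mul _)).add (iL.const_mul _))
      (Eventually.of_forall fun x => ?_)
    · by_cases hx : x ∈ V
      · have hs := hk.subLap_nonneg hx
        simp only [Pi.zero_apply]
        positivity
      · have : η x = 0 := image_eq_zero_of_notMem_tsupport fun h => hx (hζV (hsup h))
        simp [hsq, this]
    · simp only [hsq]
      have hC := commSq_nonneg b u x
      have hg := weight_pos a (u x)
      have hr := jap_pos (u x)
      have hΦx := hΦ0 x
      have hz := hζ0 x
      have hh := hη0 x
      by_cases hx : x ∈ tsupport η
      · have hx0 := hsup hx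
        have hs := hk.subLap_nonneg (hζV hx0)
        rw [hηζ x hx, one_mul]
        have hP := gradSq_nonneg b u x
        have hp := Real.sqrt_nonneg (gradSq b u x)
        have hp2 := Real.sq_sqrt hP
        have hc := Real.sqrt_nonneg (commSq b u x)
        have hc2 := Real.sq_sqrt hC
        have p1 : Real.sqrt (gradSq b u x) ≤
            weight a (u x) / jap (u x) * gradSq b u x + jap (u x) / weight a (u x) := by
          rw [← hp2]
          set p := Real.sqrt (gradSq b u x)
          rw [Real.sqrt_sq hp]
          have e : weight a (u x) / jap (u x) * p ^ 2 + jap (u x) / weight a (u x) - 2 * p =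
              (weight a (u x) * p - jap (u x)) ^ 2 / (weight a (u x) * jap (u x)) := by
            field_simp
            ring
          have : 0 ≤ (weight a (u x) * p - jap (u x)) ^ 2 / (weight a (u x) * jap (u x)) := by
            positivity
          linarith
        have p2 : Real.sqrt (gradSq b u x) * subLap b u x ≤
            Φ x + jap (u x) / weight a (u x) * subLap b u x := by
          have := mul_le_mul_of_nonneg_right p1 hs
          linarith [hΦ4 x hx0]
        have p3 : 3 * B₁ * η x * Real.sqrt (gradSq b u x) * Real.sqrt (commSq b u x) ≤
            1 / 2 * (η x ^ 2 * commSq b u x) + 9 / 2 * B₁ ^ 2 * Φ x := by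
          have := mul_le_mul_of_nonneg_left (hΦ3 x hx0) (by positivity : 0 ≤ 9 / 2 * B₁ ^ 2)
          rw [← hp2] at this
          rw [← hc2]
          set p := Real.sqrt (gradSq b u x)
          set c := Real.sqrt (commSq b u x)
          rw [Real.sqrt_sq hc]
          nlinarith [sq_nonneg (η x * c - 3 * B₁ * p)]
        calc 2 * η x * Real.sqrt (gradSq b η x) * Real.sqrt (gradSq b u x) *
              (2 * subLap b u x + 3 / 2 * Real.sqrt (commSq b u x))
            ≤ 2 * η x * B₁ * Real.sqrt (gradSq b u x) *
              (2 * subLap b u x + 3 / 2 * Real.sqrt (commSq b u x)) := by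
              have := hB₁ x
              gcongr
          _ = 4 * B₁ * (η x * (Real.sqrt (gradSq b u x) * subLap b u x)) +
              3 * B₁ * η x * Real.sqrt (gradSq b u x) * Real.sqrt (commSq b u x) := by ring
          _ ≤ 4 * B₁ * (1 * (Φ x + jap (u x) / weight a (u x) * subLap b u x)) +
              (1 / 2 * (η x ^ 2 * commSq b u x) + 9 / 2 * B₁ ^ 2 * Φ x) := by
              have := hη1 x
              gcongr
          _ = _ := by ring
      · have : η x = 0 := image_eq_zero_of_notMem_tsupport hx
        rw [this]
        simp only [mul_zero, zero_mul]
        have : 0 ≤ ζ₀ x * (jap (u x) / weight a (u x)) * subLap b u x := by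
          by_cases hxV : x ∈ V
          · have := hk.subLap_nonneg hxV
            positivity
          · rw [image_eq_zero_of_notMem_tsupport fun h => hxV (hζV h)]
            simp
        positivity
  have i12 : Integrable fun x => 1 / 2 * (η x ^ 2 * commSq b u x) +
      (4 * B₁ + 9 / 2 * B₁ ^ 2) * Φ x := (iC.const_mul _).add (hΦ.const_mul _)
  rw [integral_add i12 (iL.const_mul _), integral_add (iC.const_mul _) (hΦ.const_mul _),
    integral_const_mul, integral_const_mul, integral_const_mul] at hup
  have hlow : ∫ x, η x ^ 2 * (3 / 4 * commSq b u x) = 3 / 4 * ∫ x, η x ^ 2 * commSq b u x := by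
    rw [← integral_const_mul]
    exact integral_congr_ae (Eventually.of_forall fun x => by simp only; ring)
  rw [hlow] at key
  have := mul_le_mul_of_nonneg_left hlap (by positivity : 0 ≤ 4 * B₁)
  linarith

lemma isKConvex_two_iff : IsKConvex V b 2 u ↔
    ∀ x ∈ V, 0 ≤ subLap b u x ∧ ∑ i, ∑ j, symmHess b u x i j ^ 2 ≤ subLap b u x ^ 2 := by
  refine ⟨fun h x hx => ⟨h.subLap_nonneg hx, h.sum_sq_symmHess_le hx⟩, fun h x hx j h1 h2 => ?_⟩
  obtain ⟨hL, hS⟩ := h x hx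
  obtain rfl | rfl : j = 1 ∨ j = 2 := by omega
  · rwa [esymmF_one, sum_hessEig]
  · have h2 := two_mul_esymmF_two (hessEig b u x)
    rw [sum_hessEig] at h2
    rw [sum_sq_symmHess_eq] at hS
    linarith

lemma xop_const_mul {c : (Fin n → ℝ) → (Fin n → ℝ)} (hu : Differentiable ℝ u) (s : ℝ) :
    Xop c (fun y => s * u y) = fun x => s * Xop c u x := by
  funext x
  simp only [Xop]
  rw [fderiv_const_mul (hu x)]
  rfl

lemma xop_xop_const_mul (hb : ∀ i, ContDiff ℝ (⊤ : ℕ∞) (b i)) (hu : ContDiff ℝ 2 u) (s : ℝ)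
    (i j : Fin m) (x : Fin n → ℝ) :
    Xop (b i) (Xop (b j) (fun y => s * u y)) x = s * Xop (b i) (Xop (b j) u) x := by
  rw [xop_const_mul (hu.differentiable (by norm_num)),
    xop_const_mul ((contDiff_xop_one hb hu j).differentiable (by norm_num))]

lemma IsKConvex.const_mul (hb : ∀ i, ContDiff ℝ (⊤ : ℕ∞) (b i)) (hu : ContDiff ℝ 2 u)
    (h : IsKConvex V b 2 u) {s : ℝ} (hs : 0 ≤ s) : IsKConvex V b 2 (fun y => s * u y) := by
  rw [isKConvex_two_iff] at h ⊢
  intro x hx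
  obtain ⟨h1, h2⟩ := h x hx
  have e1 : subLap b (fun y => s * u y) x = s * subLap b u x := by
    simp only [subLap, xop_xop_const_mul hb hu, Finset.mul_sum]
  have e2 : ∀ i j, symmHess b (fun y => s * u y) x i j = s * symmHess b u x i j := fun i j => by
    simp only [symmHess, xop_xop_const_mul hb hu]
    ring
  refine ⟨e1 ▸ mul_nonneg hs h1, ?_⟩
  simp only [e1, e2, mul_pow, ← Finset.mul_sum]
  exact mul_le_mul_of_nonneg_left h2 (sq_nonneg s)

lemma commSq_const_mul (hb : ∀ i, ContDiff ℝ (⊤ : ℕ∞) (b i)) (hu : ContDiff ℝ 2 u) (s : ℝ)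
    (x : Fin n → ℝ) : commSq b (fun y => s * u y) x = s ^ 2 * commSq b u x := by
  simp only [commSq, commOp, xop_xop_const_mul hb hu, ← mul_sub, mul_pow, Finset.mul_sum]

lemma div_le_of_young {P g r : ℝ} (hg : 0 < g) (hr : 0 < r) :
    P / g ≤ g / r ^ 2 * P ^ 2 + r ^ 2 / g ^ 3 ∧ P ≤ g / r ^ 2 * P ^ 2 + r ^ 2 / g := by
  have h1 : g / r ^ 2 * P ^ 2 + r ^ 2 / g - P = ((g * P - r ^ 2 / 2) ^ 2 + 3 / 4 * r ^ 4) /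
      (r ^ 2 * g) := by
    field_simp
    ring
  have h2 : g / r ^ 2 * P ^ 2 + r ^ 2 / g ^ 3 - P / g =
      ((g ^ 2 * P - r ^ 2 / 2) ^ 2 + 3 / 4 * r ^ 4) / (r ^ 2 * g ^ 3) := by
    field_simp
    ring
  constructor
  · have : 0 ≤ ((g ^ 2 * P - r ^ 2 / 2) ^ 2 + 3 / 4 * r ^ 4) / (r ^ 2 * g ^ 3) := by positivity
    linarith
  · have : 0 ≤ ((g * P - r ^ 2 / 2) ^ 2 + 3 / 4 * r ^ 4) / (r ^ 2 * g) := by positivity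
    linarith

lemma exists_exponent {q : ℝ} (hq : 2 < q) :
    ∃ a : ℝ, 0 < a ∧ a ≤ 1 ∧ 2 + 3 * a ≤ q * (1 - a / 2) := by
  refine ⟨min (1 / 2) ((2 * q - 4) / (q + 6)), lt_min (by norm_num)
    (div_pos (by linarith) (by linarith)), (min_le_left _ _).trans (by norm_num), ?_⟩
  have h : min (1 / 2) ((2 * q - 4) / (q + 6)) ≤ (2 * q - 4) / (q + 6) := min_le_right _ _
  rw [le_div_iff₀ (by linarith)] at h
  nlinarith

/-- Normalised form of the interior commutator estimate. -/
lemma exists_integral_commSq_le_of_le_one (hV : IsOpen V) {K : Set (Fin n → ℝ)} (hK : IsCompact K)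
    (hKV : K ⊆ V) (hb : ∀ i, ContDiff ℝ (⊤ : ℕ∞) (b i)) (hbs : ∀ i, HasCompactSupport (b i))
    (hd : DivFree V b) (hH : Hormander V b) (h2 : SecondCommVanish V b) :
    ∃ K' : Set (Fin n → ℝ), IsCompact K' ∧ K' ⊆ V ∧ ∃ C, 0 ≤ C ∧
      ∀ u : (Fin n → ℝ) → ℝ, ContDiff ℝ 2 u → IsKConvex V b 2 u →
        ∫ x in K', |u x| ≤ 1 → ∫ x in K, commSq b u x ≤ C := by
  obtain ⟨η, hη, hηs, hηV, hηK, hη01⟩ := exists_smooth_cutoff hK hV hKV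
  obtain ⟨ζ₀, hζ₀, hζ₀s, hζ₀V, hζ₀K, hζ₀01⟩ := exists_smooth_cutoff hηs hV hηV
  obtain ⟨ζ, hζ, hζs, hζV, hζK, hζ01⟩ := exists_smooth_cutoff hζ₀s hV hζ₀V
  have hle1 : (1 : WithTop ℕ∞) ≤ ((⊤ : ℕ∞) : WithTop ℕ∞) := by exact_mod_cast le_top
  have hη1 := hη.of_le hle1
  have hζ₀1 := hζ₀.of_le hle1
  have hζ2 := hζ.of_le two_le_top
  obtain ⟨q, hq, Cs, hCs, hS⟩ := exists_sobolev hb hbs hH hζs hζV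
  obtain ⟨a, ha, ha1, haq⟩ := exists_exponent hq
  obtain ⟨B, -, hB⟩ := exists_sqrt_gradSq_le hb (hζ.of_le hle1) hζs
  obtain ⟨B₀, hB₀0, hB₀⟩ := exists_sqrt_gradSq_le hb hζ₀1 hζ₀s
  obtain ⟨B₁, hB₁0, hB₁⟩ := exists_sqrt_gradSq_le hb hη1 hηs
  obtain ⟨Cr, hCr, hr⟩ := exists_jap_sq_div_weight_le ha (by linarith : 0 < q) haq
  obtain ⟨k, hk, C, hC, hE⟩ := exists_weighted_bound hb hd h2 hζ2 hζs hζV (fun x => (hζ01 x).1)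
    (fun x => (hζ01 x).2) hB ha ha1 hq hS
  refine ⟨tsupport ζ, hζs, hζV,
    4 * (4 * B₁ + 9 / 2 * B₁ ^ 2 + 4 * B₁ * (2 * B₀ + 3)) * (C + Cr * C), by positivity,
    fun u hu hconv hle => ?_⟩
  obtain ⟨hI1, hI2⟩ := hE u hu hconv hle
  have hζone : ∀ x ∈ tsupport ζ₀, ζ x = 1 := fun x hx =>
    (eventually_nhdsSet_iff_forall.1 hζK x hx).self_of_nhds
  have iE : Integrable fun x => ζ x ^ (2 * k + 4) * energyDensity a b u x :=
    integrable_pow_mul hζ.continuous hζs (continuous_energyDensity hb hu) (by omega)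
  have hcont : Continuous fun x => |ζ x ^ (k + 1) * rootWeight a (u x)| ^ q :=
    Continuous.rpow_const (((hζ.continuous.pow _).mul
      ((contDiff_rootWeight (k := 0) a).continuous.comp hu.continuous)).abs)
      fun x => Or.inr (by linarith)
  have iW : Integrable fun x => |ζ x ^ (k + 1) * rootWeight a (u x)| ^ q := by
    refine hcont.integrable_of_hasCompactSupport (hζs.mono' ?_)
    intro x hx
    by_contra h
    apply hx
    simp only
    rw [image_eq_zero_of_notMem_tsupport h, zero_pow (by omega), zero_mul, abs_zero,
      Real.zero_rpow (by linarith)]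
  have hEn : ∀ x, 0 ≤ ζ x ^ (2 * k + 4) * energyDensity a b u x := fun x => by
    by_cases h : x ∈ tsupport ζ
    · exact mul_nonneg (pow_nonneg (hζ01 x).1 _)
        (energyDensity_nonneg (hconv.subLap_nonneg (hζV h)))
    · rw [image_eq_zero_of_notMem_tsupport h, zero_pow (by omega), zero_mul]
  set Φ : (Fin n → ℝ) → ℝ := fun x => ζ x ^ (2 * k + 4) * energyDensity a b u x +
    Cr * |ζ x ^ (k + 1) * rootWeight a (u x)| ^ q with hΦdef
  have iΦ : Integrable Φ := iE.add (iW.const_mul Cr)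
  have hΦone : ∀ x ∈ tsupport ζ₀, Φ x = energyDensity a b u x + Cr * rootWeight a (u x) ^ q := by
    intro x hx
    simp only [hΦdef, hζone x hx, one_pow, one_mul, abs_of_pos (rootWeight_pos a (u x))]
  have hparts : ∀ x ∈ tsupport ζ₀, 0 ≤ weight a (u x) * commSq b u x ∧
      0 ≤ weight a (u x) / jap (u x) * gradSq b u x * subLap b u x ∧
      0 ≤ weight a (u x) / jap (u x) ^ 2 * gradSq b u x ^ 2 ∧
      0 ≤ Cr * rootWeight a (u x) ^ q := fun x hx => by
    have := weight_pos a (u x)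
    have := jap_pos (u x)
    have := commSq_nonneg b u x
    have := gradSq_nonneg b u x
    have := hconv.subLap_nonneg (hζ₀V hx)
    have := rootWeight_pos a (u x)
    refine ⟨?_, ?_, ?_, ?_⟩ <;> positivity
  have hmain := integral_sq_mul_commSq_le hb hd h2 ha ha1 hζ₀1 hζ₀s hζ₀V (fun x => (hζ₀01 x).1)
    (fun x => (hζ₀01 x).2) hη1 hηs (fun x => (hη01 x).1) (fun x => (hη01 x).2)
    (fun x hx => (eventually_nhdsSet_iff_forall.1 hζ₀K x hx).self_of_nhds) hB₀ hB₁ hu hconv iΦ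
    (fun x => add_nonneg (hEn x) (by positivity))
    (fun x hx => by
      rw [hΦone x hx, energyDensity]
      obtain ⟨p1, p2, p3, p4⟩ := hparts x hx
      linarith [(hr (u x)).1])
    (fun x hx => by
      rw [hΦone x hx, energyDensity]
      obtain ⟨p1, p2, p3, p4⟩ := hparts x hx
      linarith [(hr (u x)).2, (div_le_of_young (P := gradSq b u x) (weight_pos a (u x))
        (jap_pos (u x))).1])
    (fun x hx => by
      rw [hΦone x hx, energyDensity]
      obtain ⟨p1, p2, p3, p4⟩ := hparts x hx
      linarith [(hr (u x)).1, (div_le_of_young (P := gradSq b u x) (weight_pos a (u x))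
        (jap_pos (u x))).2])
    (fun x hx => by
      rw [hΦone x hx, energyDensity]
      obtain ⟨p1, p2, p3, p4⟩ := hparts x hx
      linarith)
  have hΦle : ∫ x, Φ x ≤ C + Cr * C := by
    rw [hΦdef, integral_add iE (iW.const_mul Cr), integral_const_mul]
    exact add_le_add hI2 (mul_le_mul_of_nonneg_left hI1 hCr)
  have hlow : ∫ x in K, commSq b u x ≤ ∫ x, η x ^ 2 * commSq b u x := by
    have i1 : Integrable fun x => η x ^ 2 * commSq b u x :=
      integrable_pow_mul hη.continuous hηs (continuous_commSq hb hu) two_ne_zero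
    calc ∫ x in K, commSq b u x = ∫ x in K, η x ^ 2 * commSq b u x :=
          setIntegral_congr_fun hK.measurableSet fun x hx => by
            rw [(eventually_nhdsSet_iff_forall.1 hηK x hx).self_of_nhds, one_pow, one_mul]
      _ ≤ _ := setIntegral_le_integral i1 (ae_of_all _ fun x =>
          mul_nonneg (sq_nonneg _) (commSq_nonneg b u x))
  exact hlow.trans (hmain.trans (mul_le_mul_of_nonneg_left hΦle (by positivity)))

/-- Interior estimate of the commutators of smooth `2`-convex functions. -/
theorem exists_integral_commSq_le (hV : IsOpen V) {K : Set (Fin n → ℝ)} (hK : IsCompact K)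
    (hKV : K ⊆ V) (hb : ∀ i, ContDiff ℝ (⊤ : ℕ∞) (b i)) (hbs : ∀ i, HasCompactSupport (b i))
    (hd : DivFree V b) (hH : Hormander V b) (h2 : SecondCommVanish V b) :
    ∃ K' : Set (Fin n → ℝ), IsCompact K' ∧ K' ⊆ V ∧ ∃ C, 0 ≤ C ∧
      ∀ u : (Fin n → ℝ) → ℝ, ContDiff ℝ 2 u → IsKConvex V b 2 u →
        ∫ x in K, commSq b u x ≤ C * (∫ x in K', |u x|) ^ 2 := by
  obtain ⟨K', hK', hK'V, C, hC, h⟩ := exists_integral_commSq_le_of_le_one hV hK hKV hb hbs hd hH h2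
  refine ⟨K', hK', hK'V, C, hC, fun u hu hconv => ?_⟩
  set t := ∫ x in K', |u x| with ht
  have ht0 : 0 ≤ t := integral_nonneg fun x => abs_nonneg _
  have key : ∀ ε > 0, ∫ x in K, commSq b u x ≤ C * (t + ε) ^ 2 := by
    intro ε hε
    have hpos : 0 < t + ε := by linarith
    have h1 := h (fun y => (t + ε)⁻¹ * u y) (contDiff_const.mul hu)
      (hconv.const_mul hb hu (by positivity)) (by
        simp only [abs_mul, integral_const_mul, abs_of_pos (inv_pos.2 hpos), ← ht]
        rw [inv_mul_le_iff₀ hpos]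
        linarith)
    simp only [commSq_const_mul hb hu, integral_const_mul] at h1
    rwa [inv_pow, inv_mul_le_iff₀ (by positivity), mul_comm] at h1
  have hlim : Tendsto (fun ε : ℝ => C * (t + ε) ^ 2) (𝓝[>] 0) (𝓝 (C * (t + 0) ^ 2)) :=
    (Continuous.tendsto (by fun_prop) 0).mono_left nhdsWithin_le_nhds
  rw [add_zero] at hlim
  exact ge_of_tendsto hlim (eventually_mem_nhdsWithin.mono fun ε hε => key ε hε)

end UnweightedEstimate

section Localization

variable {n m : ℕ} {V : Set (Fin n → ℝ)} {b b' : Fin m → (Fin n → ℝ) → (Fin n → ℝ)}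
  {u u' : (Fin n → ℝ) → ℝ}

lemma fderiv_eqOn_of_isOpen {F : Type*} [NormedAddCommGroup F] [NormedSpace ℝ F]
    {f g : (Fin n → ℝ) → F} (hV : IsOpen V) (h : Set.EqOn f g V) :
    Set.EqOn (fderiv ℝ f) (fderiv ℝ g) V := fun _ hx =>
  Filter.EventuallyEq.fderiv_eq (h.eventuallyEq_of_mem (hV.mem_nhds hx))

lemma xop_eqOn (hV : IsOpen V) {c c' : (Fin n → ℝ) → (Fin n → ℝ)} (hc : Set.EqOn c c' V)
    (hu : Set.EqOn u u' V) : Set.EqOn (Xop c u) (Xop c' u') V := fun x hx => by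
  rw [Xop, Xop, fderiv_eqOn_of_isOpen hV hu hx, hc hx]

lemma vfBracket_eqOn (hV : IsOpen V) {c c' d d' : (Fin n → ℝ) → (Fin n → ℝ)}
    (hc : Set.EqOn c c' V) (hd : Set.EqOn d d' V) :
    Set.EqOn (vfBracket c d) (vfBracket c' d') V := fun x hx => by
  funext l
  have h1 : Set.EqOn (fun y => c y l) (fun y => c' y l) V := fun y hy => congrFun (hc hy) l
  have h2 : Set.EqOn (fun y => d y l) (fun y => d' y l) V := fun y hy => congrFun (hd hy) l
  rw [vfBracket, vfBracket, fderiv_eqOn_of_isOpen hV h1 hx, fderiv_eqOn_of_isOpen hV h2 hx, hc hx,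
    hd hx]

lemma commOp_eqOn (hV : IsOpen V) (hb : ∀ i, Set.EqOn (b i) (b' i) V) (hu : Set.EqOn u u' V)
    (i j : Fin m) : Set.EqOn (commOp b i j u) (commOp b' i j u') V := fun x hx => by
  rw [commOp, commOp, xop_eqOn hV (hb i) (xop_eqOn hV (hb j) hu) hx,
    xop_eqOn hV (hb j) (xop_eqOn hV (hb i) hu) hx]

lemma IsKConvex.congr (hV : IsOpen V) (hb : ∀ i, Set.EqOn (b i) (b' i) V) (hu : Set.EqOn u u' V)
    {k : ℕ} (h : IsKConvex V b k u) : IsKConvex V b' k u' := fun x hx => by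
  have e : symmHess b u x = symmHess b' u' x := by
    ext i j
    rw [symmHess, symmHess, xop_eqOn hV (hb i) (xop_eqOn hV (hb j) hu) hx,
      xop_eqOn hV (hb j) (xop_eqOn hV (hb i) hu) hx]
  have e' : hessEig b' u' x = hessEig b u x := by
    unfold hessEig
    congr 1
    exact e.symm
  rw [e']
  exact h x hx

lemma DivFree.congr (hV : IsOpen V) (hb : ∀ i, Set.EqOn (b i) (b' i) V) (h : DivFree V b) :
    DivFree V b' := fun i x hx => by
  have e : ∀ j, Set.EqOn (fun y => b' i y j) (fun y => b i y j) V := fun j y hy =>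
    congrFun (hb i hy).symm j
  simp only [fderiv_eqOn_of_isOpen hV (e _) hx]
  exact h i x hx

lemma SecondCommVanish.congr (hV : IsOpen V) (hb : ∀ i, Set.EqOn (b i) (b' i) V)
    (h : SecondCommVanish V b) : SecondCommVanish V b' := fun i j x hx =>
  (vfBracket_eqOn hV (hb i) (vfBracket_eqOn hV (hb i) (hb j)) hx).symm.trans (h i j x hx)

lemma LieGen.exists_eqOn (hV : IsOpen V) (hb : ∀ i, Set.EqOn (b i) (b' i) V)
    {c : (Fin n → ℝ) → (Fin n → ℝ)} (h : LieGen b c) : ∃ c', LieGen b' c' ∧ Set.EqOn c c' V := by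
  induction h with
  | base i => exact ⟨b' i, .base i, hb i⟩
  | bracket _ _ h1 h2 =>
    obtain ⟨c', hc', ec⟩ := h1
    obtain ⟨d', hd', ed⟩ := h2
    exact ⟨_, .bracket hc' hd', vfBracket_eqOn hV ec ed⟩

lemma Hormander.congr (hV : IsOpen V) (hb : ∀ i, Set.EqOn (b i) (b' i) V) (h : Hormander V b) :
    Hormander V b' := fun x hx => by
  rw [eq_top_iff, ← h x hx]
  refine Submodule.span_mono ?_
  rintro v ⟨c, hc, rfl⟩
  obtain ⟨c', hc', e⟩ := hc.exists_eqOn hV hb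
  exact ⟨c', hc', (e hx).symm⟩

lemma contDiff_smul_of_tsupport_subset {F : Type*} [NormedAddCommGroup F] [NormedSpace ℝ F]
    {k : WithTop ℕ∞} {χ : (Fin n → ℝ) → ℝ} {f : (Fin n → ℝ) → F} (hV : IsOpen V)
    (hχ : ContDiff ℝ k χ) (hχV : tsupport χ ⊆ V) (hf : ContDiffOn ℝ k f V) :
    ContDiff ℝ k fun x => χ x • f x := by
  rw [contDiff_iff_contDiffAt]
  intro x
  by_cases hx : x ∈ tsupport χ
  · exact hχ.contDiffAt.smul (hf.contDiffAt (hV.mem_nhds (hχV hx)))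
  · refine (contDiffAt_const (c := (0 : F))).congr_of_eventuallyEq ?_
    filter_upwards [(isClosed_tsupport χ).isOpen_compl.mem_nhds hx] with y hy
    rw [image_eq_zero_of_notMem_tsupport hy, zero_smul]

lemma commOp_eq_zero_of_notMem_tsupport (b : Fin m → (Fin n → ℝ) → (Fin n → ℝ)) (i j : Fin m)
    {x : Fin n → ℝ} (hx : x ∉ tsupport u) : commOp b i j u x = 0 := by
  rw [commOp, xop_eq_zero_of_notMem_tsupport fun h => hx (tsupport_xop_subset _ _ h),
    xop_eq_zero_of_notMem_tsupport fun h => hx (tsupport_xop_subset _ _ h), sub_zero]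

lemma commOp_eq_of_tsupport_subset (hV : IsOpen V) (hb : ∀ i, Set.EqOn (b i) (b' i) V)
    (hu : tsupport u ⊆ V) (i j : Fin m) : commOp b i j u = commOp b' i j u := by
  funext x
  by_cases hx : x ∈ tsupport u
  · exact commOp_eqOn hV hb (Set.eqOn_refl u V) i j (hu hx)
  · rw [commOp_eq_zero_of_notMem_tsupport b i j hx, commOp_eq_zero_of_notMem_tsupport b' i j hx]

lemma continuous_commOp (hb : ∀ i, ContDiff ℝ (⊤ : ℕ∞) (b i)) (hu : ContDiff ℝ 2 u)
    (i j : Fin m) : Continuous (commOp b i j u) :=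
  (continuous_xop (hb i) (contDiff_xop_one hb hu j)).sub
    (continuous_xop (hb j) (contDiff_xop_one hb hu i))

lemma hasCompactSupport_commOp (b : Fin m → (Fin n → ℝ) → (Fin n → ℝ)) (i j : Fin m)
    (hu : HasCompactSupport u) : HasCompactSupport (commOp b i j u) :=
  hu.mono' fun x hx => by
    by_contra h
    exact hx (commOp_eq_zero_of_notMem_tsupport b i j h)

/-- Divergence free fields have skew-adjoint commutators. -/
lemma integral_commOp_mul (hb : ∀ i, ContDiff ℝ (⊤ : ℕ∞) (b i)) (hd : DivFree V b)
    (hu : ContDiff ℝ 2 u) {η : (Fin n → ℝ) → ℝ} (hη : ContDiff ℝ 2 η) (hηs : HasCompactSupport η)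
    (hηV : tsupport η ⊆ V) (i j : Fin m) :
    ∫ x, commOp b i j u x * η x = -∫ x, u x * commOp b i j η x := by
  have key : ∀ i j, ∫ x, Xop (b i) (Xop (b j) u) x * η x =
      ∫ x, u x * Xop (b j) (Xop (b i) η) x := fun i j => by
    rw [integral_xop_mul_of_divf ((hb i).of_le (by exact_mod_cast le_top))
      (fun x hx => hd.divf_eq_zero i hx) (contDiff_xop_one hb hu j) (hη.of_le one_le_two) hηs hηV,
      integral_xop_mul_of_divf ((hb j).of_le (by exact_mod_cast le_top))
      (fun x hx => hd.divf_eq_zero j hx) (hu.of_le one_le_two) (contDiff_xop_one hb hη i)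
      (hasCompactSupport_xop _ hηs) ((tsupport_xop_subset _ _).trans hηV), neg_neg]
  have i1 : ∀ i j, Integrable fun x => Xop (b i) (Xop (b j) u) x * η x := fun i j =>
    ((continuous_xop (hb i) (contDiff_xop_one hb hu j)).mul
      hη.continuous).integrable_of_hasCompactSupport hηs.mul_left
  have i2 : ∀ i j, Integrable fun x => u x * Xop (b i) (Xop (b j) η) x := fun i j =>
    (hu.continuous.mul (continuous_xop (hb i)
      (contDiff_xop_one hb hη j))).integrable_of_hasCompactSupport
      (hasCompactSupport_xop _ (hasCompactSupport_xop _ hηs)).mul_left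
  have e1 : ∫ x, commOp b i j u x * η x =
      (∫ x, Xop (b i) (Xop (b j) u) x * η x) - ∫ x, Xop (b j) (Xop (b i) u) x * η x := by
    rw [← integral_sub (i1 i j) (i1 j i)]
    exact integral_congr_ae (Eventually.of_forall fun x => sub_mul _ _ _)
  have e2 : ∫ x, u x * commOp b i j η x =
      (∫ x, u x * Xop (b i) (Xop (b j) η) x) - ∫ x, u x * Xop (b j) (Xop (b i) η) x := by
    rw [← integral_sub (i2 i j) (i2 j i)]
    exact integral_congr_ae (Eventually.of_forall fun x => mul_sub _ _ _)
  rw [e1, e2, key, key, neg_sub]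

end Localization

section RieszRepresentation

variable {n m : ℕ}

/-- Riesz representation of a functional dominated by the norm of a linear map into a Hilbert
space. -/
lemma exists_inner_eq_of_norm_le {H T : Type*} [NormedAddCommGroup H] [InnerProductSpace ℝ H]
    [CompleteSpace H] [AddCommGroup T] [Module ℝ T] (e : T →ₗ[ℝ] H) (L : T →ₗ[ℝ] ℝ) {A : ℝ}
    (hA : 0 ≤ A) (hL : ∀ t, |L t| ≤ A * ‖e t‖) :
    ∃ w : H, ‖w‖ ≤ A ∧ ∀ t, inner ℝ w (e t) = L t := by
  set S := (LinearMap.range e).topologicalClosure with hS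
  have : CompleteSpace S := (LinearMap.range e).isClosed_topologicalClosure.completeSpace_coe
  set e' : T →ₗ[ℝ] S := e.codRestrict S fun t =>
    (LinearMap.range e).le_topologicalClosure (LinearMap.mem_range_self e t) with he'
  have hd : DenseRange e' := by
    intro s
    rw [Topology.IsInducing.subtypeVal.closure_eq_preimage_closure_image, ← Set.range_comp]
    exact s.2
  have hb : ∀ t, ‖L t‖ ≤ A * ‖e' t‖ := hL
  refine ⟨((InnerProductSpace.toDual ℝ S).symm (L.extendOfNorm e') : S), ?_, fun t => ?_⟩
  · rw [← Submodule.coe_norm, LinearIsometryEquiv.norm_map]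
    exact LinearMap.opNorm_extendOfNorm_le hd hA hb
  · have := InnerProductSpace.toDual_symm_apply (𝕜 := ℝ) (x := e' t) (y := L.extendOfNorm e')
    rw [LinearMap.extendOfNorm_eq hd ⟨A, hb⟩] at this
    exact this

/-- The smooth functions with compact support in `V`. -/
def testFunctions (V : Set (Fin n → ℝ)) : Submodule ℝ ((Fin n → ℝ) → ℝ) where
  carrier := {η | ContDiff ℝ (⊤ : ℕ∞) η ∧ HasCompactSupport η ∧ tsupport η ⊆ V}
  add_mem' := fun ⟨h1, h2, h3⟩ ⟨k1, k2, k3⟩ =>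
    ⟨h1.add k1, h2.add k2, (tsupport_add _ _).trans (Set.union_subset h3 k3)⟩
  zero_mem' := ⟨contDiff_const, HasCompactSupport.zero, by simp [tsupport]⟩
  smul_mem' := fun c η ⟨h1, h2, h3⟩ =>
    ⟨contDiff_const.smul h1, h2.smul_left (f := fun _ => c), (tsupport_smul_subset_right
      (fun _ => c) η).trans h3⟩

lemma exists_memLp_of_bounded (V : Set (Fin n → ℝ)) (L : testFunctions V →ₗ[ℝ] ℝ) {A : ℝ}
    (hA : 0 ≤ A) (hL : ∀ η : testFunctions V, |L η| ≤ A * nrm η.1) :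
    ∃ w : (Fin n → ℝ) → ℝ, MemLp w 2 ∧ ∫ x, w x ^ 2 ≤ A ^ 2 ∧
      ∀ η : testFunctions V, ∫ x, w x * η.1 x = L η := by
  have hmem : ∀ η : testFunctions V, MemLp η.1 2 volume := fun η =>
    η.2.1.continuous.memLp_of_hasCompactSupport η.2.2.1
  set e : testFunctions V →ₗ[ℝ] Lp ℝ 2 (volume : Measure (Fin n → ℝ)) :=
    { toFun := fun η => (hmem η).toLp η.1
      map_add' := fun η ξ => MemLp.toLp_add (hmem η) (hmem ξ)
      map_smul' := fun c η => MemLp.toLp_const_smul c (hmem η) } with he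
  have hsq : ∀ f : Lp ℝ 2 (volume : Measure (Fin n → ℝ)), ‖f‖ ^ 2 = ∫ x, f x ^ 2 := fun f => by
    rw [← real_inner_self_eq_norm_sq, L2.inner_def]
    simp [sq]
  have hn : ∀ η, ‖e η‖ = nrm η.1 := fun η => by
    rw [nrm, ← Real.sqrt_sq (norm_nonneg (e η)), hsq]
    congr 1
    refine integral_congr_ae ?_
    filter_upwards [(hmem η).coeFn_toLp] with x hx
    exact congrArg (· ^ 2) hx
  obtain ⟨w, hw, hwe⟩ := exists_inner_eq_of_norm_le e L hA fun η => by
    rw [hn]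
    exact hL η
  refine ⟨w, Lp.memLp w, ?_, fun η => ?_⟩
  · rw [← hsq]
    exact pow_le_pow_left₀ (norm_nonneg w) hw 2
  · rw [← hwe, L2.inner_def]
    refine integral_congr_ae ?_
    filter_upwards [(hmem η).coeFn_toLp] with x hx
    have : (e η : (Fin n → ℝ) → ℝ) x = η.1 x := hx
    rw [this]
    simp [mul_comm]

lemma abs_integral_mul_le {K : Set (Fin n → ℝ)} (hK : IsCompact K) {f η : (Fin n → ℝ) → ℝ}
    (hf : Continuous f) (hη : Continuous η) (hηK : tsupport η ⊆ K) :
    |∫ x, f x * η x| ≤ Real.sqrt (∫ x in K, f x ^ 2) * nrm η := by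
  have hηs : HasCompactSupport η := hK.of_isClosed_subset (isClosed_tsupport η) hηK
  have e1 : ∫ x, f x * η x = ∫ x in K, f x * η x :=
    (setIntegral_eq_integral_of_forall_compl_eq_zero fun x hx => by
      rw [image_eq_zero_of_notMem_tsupport fun h => hx (hηK h), mul_zero]).symm
  have e2 : ∫ x, η x ^ 2 = ∫ x in K, η x ^ 2 :=
    (setIntegral_eq_integral_of_forall_compl_eq_zero fun x hx => by
      rw [image_eq_zero_of_notMem_tsupport fun h => hx (hηK h), zero_pow two_ne_zero]).symm
  have : IsFiniteMeasure (volume.restrict K) := ⟨by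
    rw [Measure.restrict_apply_univ]
    exact hK.measure_lt_top⟩
  have hm : ∀ g : (Fin n → ℝ) → ℝ, Continuous g → MemLp g (ENNReal.ofReal 2) (volume.restrict K) :=
    fun g hg => by
      obtain ⟨D, hD⟩ := hK.exists_bound_of_continuousOn hg.continuousOn
      exact MemLp.of_bound hg.aestronglyMeasurable D
        ((ae_restrict_iff' hK.measurableSet).2 (ae_of_all _ hD))
  have h := integral_mul_norm_le_Lp_mul_Lq (μ := volume.restrict K) (f := f) (g := η)
    Real.HolderConjugate.two_two (hm f hf) (hm η hη)
  have h2 : |∫ x in K, f x * η x| ≤ ∫ x in K, ‖f x‖ * ‖η x‖ := by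
    rw [← Real.norm_eq_abs]
    refine (norm_integral_le_integral_norm _).trans (le_of_eq ?_)
    simp only [norm_mul]
  rw [nrm, e1, e2]
  refine h2.trans (h.trans (le_of_eq ?_))
  simp [Real.sqrt_eq_rpow]

end RieszRepresentation

section LocalRepresentation

variable {n m : ℕ} {b : Fin m → (Fin n → ℝ) → (Fin n → ℝ)}

lemma tendsto_setIntegral_of_tendsto_L1 {K : Set (Fin n → ℝ)} (hK : IsCompact K)
    {f : ℕ → (Fin n → ℝ) → ℝ} {u g : (Fin n → ℝ) → ℝ} (hf : ∀ l, IntegrableOn (f l) K)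
    (hu : IntegrableOn u K) (hg : Continuous g)
    (h : Tendsto (fun l => ∫ x in K, |f l x - u x|) atTop (𝓝 0)) :
    Tendsto (fun l => ∫ x in K, f l x * g x) atTop (𝓝 (∫ x in K, u x * g x)) ∧
      Tendsto (fun l => ∫ x in K, |f l x|) atTop (𝓝 (∫ x in K, |u x|)) := by
  obtain ⟨D, hD⟩ := hK.exists_bound_of_continuousOn hg.continuousOn
  have hm : ∀ v : (Fin n → ℝ) → ℝ, IntegrableOn v K → IntegrableOn (fun x => v x * g x) K :=
    fun v hv => hv.mul_continuousOn hg.continuousOn hK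
  have hd : ∀ l, IntegrableOn (fun x => |f l x - u x|) K := fun l => ((hf l).sub hu).abs
  constructor
  · rw [tendsto_iff_norm_sub_tendsto_zero]
    refine squeeze_zero (fun _ => norm_nonneg _) (fun l => ?_) (by simpa using h.const_mul D)
    rw [← integral_sub (hm _ (hf l)) (hm _ hu), ← integral_const_mul]
    refine (norm_integral_le_integral_norm _).trans (setIntegral_mono_on ?_ ((hd l).const_mul D)
      hK.measurableSet fun x hx => ?_)
    · exact ((hm _ (hf l)).sub (hm _ hu)).norm
    · rw [← sub_mul, norm_mul, mul_comm D]
      exact mul_le_mul_of_nonneg_left (hD x hx) (norm_nonneg _)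
  · rw [tendsto_iff_norm_sub_tendsto_zero]
    refine squeeze_zero (fun _ => norm_nonneg _) (fun l => ?_) h
    rw [← integral_sub (hf l).abs hu.abs]
    refine (norm_integral_le_integral_norm _).trans (setIntegral_mono_on ?_ (hd l)
      hK.measurableSet fun x hx => ?_)
    · exact ((hf l).abs.sub hu.abs).norm
    · exact abs_abs_sub_abs_le_abs_sub _ _

lemma integrable_mul_commOp (hb : ∀ i, ContDiff ℝ (⊤ : ℕ∞) (b i)) (i j : Fin m)
    {u η : (Fin n → ℝ) → ℝ} (hη : ContDiff ℝ 2 η) (hηs : HasCompactSupport η)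
    (hu : IntegrableOn u (tsupport η)) : Integrable fun x => u x * commOp b i j η x := by
  refine (integrableOn_iff_integrable_of_support_subset fun x hx => ?_).1
    (hu.mul_continuousOn (continuous_commOp hb hη i j).continuousOn hηs)
  by_contra h
  exact hx (by simp only [commOp_eq_zero_of_notMem_tsupport b i j h, mul_zero])

lemma commOp_add (hb : ∀ i, ContDiff ℝ (⊤ : ℕ∞) (b i)) (i j : Fin m) {f g : (Fin n → ℝ) → ℝ}
    (hf : ContDiff ℝ 2 f) (hg : ContDiff ℝ 2 g) (x : Fin n → ℝ) :
    commOp b i j (fun y => f y + g y) x = commOp b i j f x + commOp b i j g x := by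
  have e : ∀ k, Xop (b k) (fun y => f y + g y) = fun y => Xop (b k) f y + Xop (b k) g y :=
    fun k => funext fun y => xop_add (hf.differentiable two_ne_zero y)
      (hg.differentiable two_ne_zero y)
  have e2 : ∀ k l, Xop (b k) (Xop (b l) fun y => f y + g y) x =
      Xop (b k) (Xop (b l) f) x + Xop (b k) (Xop (b l) g) x := fun k l => by
    rw [e l]
    exact xop_add ((contDiff_xop_one hb hf l).differentiable one_ne_zero x)
      ((contDiff_xop_one hb hg l).differentiable one_ne_zero x)
  rw [commOp, commOp, commOp, e2, e2]
  ring

lemma commOp_const_mul (hb : ∀ i, ContDiff ℝ (⊤ : ℕ∞) (b i)) (i j : Fin m)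
    {f : (Fin n → ℝ) → ℝ} (hf : ContDiff ℝ 2 f) (c : ℝ) (x : Fin n → ℝ) :
    commOp b i j (fun y => c * f y) x = c * commOp b i j f x := by
  rw [commOp, commOp, xop_xop_const_mul hb hf, xop_xop_const_mul hb hf]
  ring

/-- The distributional commutator of `u`, tested against smooth functions. -/
noncomputable def weakCommOp (hb : ∀ i, ContDiff ℝ (⊤ : ℕ∞) (b i)) (i j : Fin m)
    {V : Set (Fin n → ℝ)} {u : (Fin n → ℝ) → ℝ} (hu : ∀ K ⊆ V, IsCompact K → IntegrableOn u K) :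
    testFunctions V →ₗ[ℝ] ℝ where
  toFun η := -∫ x, u x * commOp b i j η.1 x
  map_add' η ξ := by
    have h1 := η.2.1.of_le two_le_top
    have h2 := ξ.2.1.of_le two_le_top
    rw [← neg_add, ← integral_add (integrable_mul_commOp hb i j h1 η.2.2.1 (hu _ η.2.2.2 η.2.2.1))
      (integrable_mul_commOp hb i j h2 ξ.2.2.1 (hu _ ξ.2.2.2 ξ.2.2.1))]
    congr 1
    refine integral_congr_ae (Eventually.of_forall fun x => ?_)
    simp only
    rw [← mul_add, ← commOp_add hb i j h1 h2]
    rfl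
  map_smul' c η := by
    have h1 := η.2.1.of_le two_le_top
    simp only [RingHom.id_apply, smul_eq_mul, mul_neg]
    rw [← integral_const_mul]
    congr 1
    refine integral_congr_ae (Eventually.of_forall fun x => ?_)
    simp only
    rw [mul_left_comm, ← commOp_const_mul hb i j h1]
    rfl

lemma abs_integral_mul_commOp_le (hb : ∀ i, ContDiff ℝ (⊤ : ℕ∞) (b i)) {V K K' : Set (Fin n → ℝ)}
    (hd : DivFree V b) (hK : IsCompact K) (hKV : K ⊆ V) {C : ℝ} (hC : 0 ≤ C)
    {f η : (Fin n → ℝ) → ℝ} (hf : ContDiff ℝ 2 f)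
    (hfC : ∫ x in K, commSq b f x ≤ C * (∫ x in K', |f x|) ^ 2)
    (hη : ContDiff ℝ 2 η) (hηK : tsupport η ⊆ K) (i j : Fin m) :
    |∫ x, f x * commOp b i j η x| ≤ Real.sqrt C * (∫ x in K', |f x|) * nrm η := by
  have hηs : HasCompactSupport η := hK.of_isClosed_subset (isClosed_tsupport η) hηK
  have e := integral_commOp_mul hb hd hf hη hηs (hηK.trans hKV) i j
  rw [← abs_neg, ← e]
  have cc := continuous_commOp hb hf
  refine (abs_integral_mul_le hK (cc i j) hη.continuous hηK).trans ?_
  refine mul_le_mul_of_nonneg_right ?_ (nrm_nonneg η)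
  have h1 : ∫ x in K, commOp b i j f x ^ 2 ≤ ∫ x in K, commSq b f x := by
    refine setIntegral_mono (((cc i j).pow 2).continuousOn.integrableOn_compact hK)
      ((continuous_commSq hb hf).continuousOn.integrableOn_compact hK) fun x => ?_
    exact (Finset.single_le_sum (f := fun j => commOp b i j f x ^ 2) (fun _ _ => sq_nonneg _)
      (Finset.mem_univ j)).trans (Finset.single_le_sum
      (f := fun i => ∑ j, commOp b i j f x ^ 2)
      (fun _ _ => Finset.sum_nonneg fun _ _ => sq_nonneg _) (Finset.mem_univ i))
  calc Real.sqrt (∫ x in K, commOp b i j f x ^ 2)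
      ≤ Real.sqrt (C * (∫ x in K', |f x|) ^ 2) := Real.sqrt_le_sqrt (h1.trans hfC)
    _ = Real.sqrt C * (∫ x in K', |f x|) := by
      rw [Real.sqrt_mul hC, Real.sqrt_sq (integral_nonneg fun _ => abs_nonneg _)]

end LocalRepresentation

section LocalCommutator

variable {n m : ℕ} {b : Fin m → (Fin n → ℝ) → (Fin n → ℝ)}

/-- On a relatively compact subdomain the data can be replaced by globally smooth ones. -/
lemma exists_global_extension {Ω K : Set (Fin n → ℝ)} (hΩo : IsOpen Ω) (hK : IsCompact K)
    (hKΩ : K ⊆ Ω) (hb : ∀ i, ContDiffOn ℝ (⊤ : ℕ∞) (b i) Ω) :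
    ∃ Ω₁ V : Set (Fin n → ℝ), CptIn Ω₁ Ω ∧ IsOpen V ∧ K ⊆ V ∧ V ⊆ Ω₁ ∧
      ∃ χ : (Fin n → ℝ) → ℝ, ∃ bt : Fin m → (Fin n → ℝ) → (Fin n → ℝ),
        (∀ f : (Fin n → ℝ) → ℝ, ContDiffOn ℝ 2 f Ω₁ → ContDiff ℝ 2 fun x => χ x * f x) ∧
        (∀ x ∈ V, χ x = 1) ∧ (∀ i, ContDiff ℝ (⊤ : ℕ∞) (bt i)) ∧
        (∀ i, HasCompactSupport (bt i)) ∧ ∀ i, Set.EqOn (b i) (bt i) V := by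
  obtain ⟨Ω₁, hΩ₁, hKΩ₁, hcl, hcpt⟩ := exists_open_between_and_isCompact_closure hK hΩo hKΩ
  obtain ⟨V, hV, hKV, hclV, hcptV⟩ := exists_open_between_and_isCompact_closure hK hΩ₁ hKΩ₁
  obtain ⟨χ, hχ, hχs, hχΩ, hχone, -⟩ := exists_smooth_cutoff hcptV hΩ₁ hclV
  have hχV : ∀ x ∈ V, χ x = 1 := fun x hx =>
    (eventually_nhdsSet_iff_forall.1 hχone x (subset_closure hx)).self_of_nhds
  refine ⟨Ω₁, V, ⟨hΩ₁, hcpt, hcl⟩, hV, hKV, subset_closure.trans hclV, χ,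
    fun i x => χ x • b i x, fun f hf => contDiff_smul_of_tsupport_subset hΩ₁
      (hχ.of_le two_le_top) hχΩ hf, hχV, fun i => contDiff_smul_of_tsupport_subset hΩ₁ hχ hχΩ
      ((hb i).mono (subset_closure.trans hcl)), fun i => hχs.smul_right, fun i x hx => ?_⟩
  simp only [hχV x hx, one_smul]

/-- The distributional commutators of functions of class `φ²` on a relatively compact subdomain. -/
lemma exists_local_commutator {Ω Ω' : Set (Fin n → ℝ)} (hΩo : IsOpen Ω)
    (hb : ∀ i, ContDiffOn ℝ (⊤ : ℕ∞) (b i) Ω) (hd : DivFree Ω b) (hH : Hormander Ω b)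
    (h2 : SecondCommVanish Ω b) (hcp : CptIn Ω' Ω) :
    ∃ C, 0 ≤ C ∧ ∃ K : Set (Fin n → ℝ), IsCompact K ∧ K ⊆ Ω ∧
      ∀ u : (Fin n → ℝ) → ℝ, PhiK Ω b 2 u → ∀ i j : Fin m,
        ∃ w : (Fin n → ℝ) → ℝ, MemLp w 2 ∧ IsWeakComm Ω' b i j u w ∧
          ∫ x in Ω', w x ^ 2 ≤ (C * ∫ x in K, |u x|) ^ 2 := by
  obtain ⟨hΩ'o, hK, hKΩ⟩ := hcp
  obtain ⟨Ω₁, V, hΩ₁, hV, hKV, hVΩ₁, χ, bt, hχ, hχV, hbt, hbts, hE⟩ :=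
    exists_global_extension hΩo hK hKΩ hb
  have hΩ₁Ω : Ω₁ ⊆ Ω := subset_closure.trans hΩ₁.2.2
  have hVΩ : V ⊆ Ω := hVΩ₁.trans hΩ₁Ω
  have hdt : DivFree V bt := DivFree.congr hV hE fun i x hx => hd i x (hVΩ hx)
  have hHt : Hormander V bt := Hormander.congr hV hE fun x hx => hH x (hVΩ hx)
  have h2t : SecondCommVanish V bt := SecondCommVanish.congr hV hE fun i j x hx => h2 i j x (hVΩ hx)
  obtain ⟨K', hK', hK'V, C, hC, hmain⟩ :=
    exists_integral_commSq_le hV hK hKV hbt hbts hdt hHt h2t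
  refine ⟨Real.sqrt C, Real.sqrt_nonneg C, K', hK', hK'V.trans hVΩ, fun u hu i j => ?_⟩
  obtain ⟨hul, hus⟩ := hu
  obtain ⟨us, hus1, hus2⟩ := hus Ω₁ hΩ₁
  have hInt : ∀ L ⊆ V, IsCompact L → IntegrableOn u L := fun L hL hLc =>
    hul.integrableOn_compact_subset (hL.trans hVΩ) hLc
  have hΩ'V : Ω' ⊆ V := subset_closure.trans hKV
  set f : ℕ → (Fin n → ℝ) → ℝ := fun l x => χ x * us l x with hf
  have hf2 : ∀ l, ContDiff ℝ 2 (f l) := fun l => hχ _ (hus1 l).1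
  have hfV : ∀ l, Set.EqOn (us l) (f l) V := fun l x hx => by
    simp only [hf, hχV x hx, one_mul]
  have hfc : ∀ l, IsKConvex V bt 2 (f l) := fun l =>
    IsKConvex.congr hV hE (hfV l) fun x hx => (hus1 l).2 x (hVΩ₁ hx)
  have hft : ∀ L ⊆ V, IsCompact L → Tendsto (fun l => ∫ x in L, |f l x - u x|) atTop (𝓝 0) := by
    intro L hL hLc
    refine (hus2 L (hL.trans hVΩ₁) hLc).congr fun l => ?_
    refine setIntegral_congr_fun hLc.measurableSet fun x hx => ?_
    simp only [hfV l (hL hx)]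
  have hfint : ∀ L, IsCompact L → ∀ l, IntegrableOn (f l) L := fun L hL l =>
    (hf2 l).continuous.continuousOn.integrableOn_compact hL
  have hbound : ∀ η : testFunctions Ω', |weakCommOp hbt i j
      (fun L hL => hInt L (hL.trans hΩ'V)) η| ≤ Real.sqrt C * (∫ x in K', |u x|) * nrm η.1 := by
    rintro ⟨η, hη, hηs, hηΩ⟩
    have hη2 := hη.of_le two_le_top
    have hηK : tsupport η ⊆ closure Ω' := hηΩ.trans subset_closure
    have hzero : ∀ x, x ∉ closure Ω' → commOp bt i j η x = 0 := fun x hx =>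
      commOp_eq_zero_of_notMem_tsupport bt i j fun h => hx (hηK h)
    have hrestr : ∀ v : (Fin n → ℝ) → ℝ, ∫ x, v x * commOp bt i j η x =
        ∫ x in closure Ω', v x * commOp bt i j η x := fun v =>
      (setIntegral_eq_integral_of_forall_compl_eq_zero fun x hx => by
        rw [hzero x hx, mul_zero]).symm
    have t1 := (tendsto_setIntegral_of_tendsto_L1 hK (hfint _ hK) (hInt _ hKV hK)
      (continuous_commOp hbt hη2 i j) (hft _ hKV hK)).1
    have t2 := (tendsto_setIntegral_of_tendsto_L1 hK' (hfint _ hK') (hInt _ hK'V hK')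
      continuous_const (hft _ hK'V hK') (g := fun _ => (0 : ℝ))).2
    change |-∫ x, u x * commOp bt i j η x| ≤ Real.sqrt C * (∫ x in K', |u x|) * nrm η
    rw [abs_neg, hrestr]
    refine le_of_tendsto_of_tendsto' t1.abs ((t2.const_mul _).mul_const _) fun l => ?_
    rw [← hrestr]
    exact abs_integral_mul_commOp_le hbt hdt hK hKV hC (hf2 l) (hmain _ (hf2 l) (hfc l)) hη2 hηK i j
  obtain ⟨w, hw, hwA, hwL⟩ := exists_memLp_of_bounded Ω' _ (by positivity) hbound
  refine ⟨w, hw, fun η hη hηs hηΩ => ?_, (setIntegral_le_integral hw.integrable_sq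
    (ae_of_all _ fun x => sq_nonneg _)).trans hwA⟩
  have h := hwL ⟨η, hη, hηs, hηΩ⟩
  have e1 : ∫ x in Ω', w x * η x = ∫ x, w x * η x :=
    setIntegral_eq_integral_of_forall_compl_eq_zero fun x hx => by
      rw [image_eq_zero_of_notMem_tsupport fun h => hx (hηΩ h), mul_zero]
  have e2 : ∫ x in Ω', u x * commOp b i j η x = ∫ x, u x * commOp b i j η x :=
    setIntegral_eq_integral_of_forall_compl_eq_zero fun x hx => by
      rw [commOp_eq_zero_of_notMem_tsupport b i j fun h => hx (hηΩ h), mul_zero]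
  rw [e1, e2, commOp_eq_of_tsupport_subset hV hE (hηΩ.trans hΩ'V) i j]
  exact h

end LocalCommutator

section Gluing

variable {n m : ℕ} {b : Fin m → (Fin n → ℝ) → (Fin n → ℝ)}

lemma exists_monotone_exhaustion {Ω : Set (Fin n → ℝ)} (hΩo : IsOpen Ω) :
    ∃ U : ℕ → Set (Fin n → ℝ), (∀ k, CptIn (U k) Ω) ∧ Monotone U ∧ ⋃ k, U k = Ω := by
  have := hΩo.locallyCompactSpace
  set E : CompactExhaustion Ω := default
  refine ⟨fun k => Subtype.val '' interior (E k), fun k => ⟨hΩo.isOpenMap_subtype_val _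
    isOpen_interior, ?_, ?_⟩, fun k l h => Set.image_mono (interior_mono (E.subset h)), ?_⟩
  · exact ((E.isCompact k).image continuous_subtype_val).closure_of_subset
      (Set.image_mono interior_subset)
  · refine (closure_minimal (Set.image_mono interior_subset)
      ((E.isCompact k).image continuous_subtype_val).isClosed).trans ?_
    rintro _ ⟨x, -, rfl⟩
    exact x.2
  · ext x
    simp only [Set.mem_iUnion, Set.mem_image]
    constructor
    · rintro ⟨k, y, -, rfl⟩
      exact y.2
    · intro hx
      obtain ⟨k, hk⟩ := E.exists_mem ⟨x, hx⟩
      exact ⟨k + 1, ⟨x, hx⟩, E.subset_interior_succ k hk, rfl⟩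

lemma exists_subset_of_isCompact {Ω K : Set (Fin n → ℝ)} {U : ℕ → Set (Fin n → ℝ)}
    (hU : ∀ k, CptIn (U k) Ω) (hmono : Monotone U) (hUn : ⋃ k, U k = Ω) (hK : IsCompact K)
    (hKΩ : K ⊆ Ω) : ∃ k, K ⊆ U k :=
  hK.elim_directed_cover U (fun k => (hU k).1) (hUn ▸ hKΩ) hmono.directed_le

lemma isWeakComm_iff {Ω : Set (Fin n → ℝ)} {i j : Fin m} {u w : (Fin n → ℝ) → ℝ} :
    IsWeakComm Ω b i j u w ↔ ∀ η : (Fin n → ℝ) → ℝ, ContDiff ℝ (⊤ : ℕ∞) η → HasCompactSupport η →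
      tsupport η ⊆ Ω → ∫ x, w x * η x = -∫ x, u x * commOp b i j η x := by
  refine forall_congr' fun η => forall_congr' fun _ => forall_congr' fun _ =>
    forall_congr' fun h => ?_
  rw [setIntegral_eq_integral_of_forall_compl_eq_zero fun x hx => by
      rw [image_eq_zero_of_notMem_tsupport fun h' => hx (h h'), mul_zero],
    setIntegral_eq_integral_of_forall_compl_eq_zero fun x hx => by
      rw [commOp_eq_zero_of_notMem_tsupport b i j fun h' => hx (h h'), mul_zero]]

lemma IsWeakComm.mono {Ω Ω' : Set (Fin n → ℝ)} {i j : Fin m} {u w : (Fin n → ℝ) → ℝ}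
    (h : IsWeakComm Ω b i j u w) (hsub : Ω' ⊆ Ω) : IsWeakComm Ω' b i j u w := by
  rw [isWeakComm_iff] at h ⊢
  exact fun η h1 h2 h3 => h η h1 h2 (h3.trans hsub)

lemma IsWeakComm.ae_eq {V : Set (Fin n → ℝ)} {i j : Fin m} {u w w' : (Fin n → ℝ) → ℝ}
    (hV : IsOpen V) (hw : LocallyIntegrableOn w V) (hw' : LocallyIntegrableOn w' V)
    (h : IsWeakComm V b i j u w) (h' : IsWeakComm V b i j u w') :
    ∀ᵐ x, x ∈ V → w x = w' x := by
  rw [isWeakComm_iff] at h h'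
  have key := hV.ae_eq_zero_of_integral_contDiff_smul_eq_zero (hw.sub hw')
    fun g hg hgs hgV => by
      have hi : ∀ v : (Fin n → ℝ) → ℝ, LocallyIntegrableOn v V →
          Integrable fun x => v x * g x := fun v hv => by
        refine (integrableOn_iff_integrable_of_support_subset fun x hx => ?_).1
          ((hv.integrableOn_compact_subset hgV hgs).mul_continuousOn hg.continuous.continuousOn hgs)
        by_contra h0
        exact hx (by simp only [image_eq_zero_of_notMem_tsupport h0, mul_zero])
      calc ∫ x, g x • (w - w') x = ∫ x, (w x * g x - w' x * g x) :=
            integral_congr_ae (Eventually.of_forall fun x => by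
              simp only [smul_eq_mul, Pi.sub_apply]
              ring)
        _ = 0 := by
          rw [integral_sub (hi w hw) (hi w' hw'), h g hg hgs hgV, h' g hg hgs hgV, sub_self]
  filter_upwards [key] with x hx hxV
  exact sub_eq_zero.1 (hx hxV)

/-- The local commutators patch together to a global one. -/
lemma exists_weakComm_of_local {Ω : Set (Fin n → ℝ)} (hΩo : IsOpen Ω) {i j : Fin m}
    {u : (Fin n → ℝ) → ℝ}
    (hloc : ∀ Ω', CptIn Ω' Ω → ∃ w : (Fin n → ℝ) → ℝ, MemLp w 2 ∧ IsWeakComm Ω' b i j u w) :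
    ∃ w : (Fin n → ℝ) → ℝ, IsWeakComm Ω b i j u w ∧
      ∀ Ω' w', CptIn Ω' Ω → MemLp w' 2 → IsWeakComm Ω' b i j u w' →
        ∀ᵐ x, x ∈ Ω' → w x = w' x := by
  classical
  obtain ⟨U, hU, hmono, hUn⟩ := exists_monotone_exhaustion hΩo
  choose w hw hwc using fun k => hloc (U k) (hU k)
  have hli : ∀ (v : (Fin n → ℝ) → ℝ) (V : Set (Fin n → ℝ)), MemLp v 2 →
      LocallyIntegrableOn v V := fun v V hv =>
    (hv.locallyIntegrable one_le_two).locallyIntegrableOn V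
  have hex : ∀ x, x ∈ Ω → ∃ k, x ∈ U k := fun x hx => Set.mem_iUnion.1 (hUn ▸ hx)
  set W : (Fin n → ℝ) → ℝ := fun x => if h : ∃ k, x ∈ U k then w (Nat.find h) x else 0 with hW
  have hWk : ∀ k, ∀ᵐ x, x ∈ U k → W x = w k x := fun k => by
    have h : ∀ᵐ x, ∀ l, l ≤ k → x ∈ U l → w l x = w k x := by
      rw [ae_all_iff]
      intro l
      by_cases hl : l ≤ k
      · filter_upwards [IsWeakComm.ae_eq (hU l).1 (hli _ _ (hw l)) (hli _ _ (hw k)) (hwc l)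
          ((hwc k).mono (hmono hl))] with x hx _ using hx
      · exact Eventually.of_forall fun x h => absurd h hl
    filter_upwards [h] with x hx hxk
    have hk : ∃ k, x ∈ U k := ⟨k, hxk⟩
    simp only [hW, dif_pos hk]
    exact hx _ (Nat.find_min' hk hxk) (Nat.find_spec hk)
  have hWeak : ∀ k, IsWeakComm (U k) b i j u W := fun k η h1 h2 h3 => by
    rw [← hwc k η h1 h2 h3]
    refine setIntegral_congr_ae (hU k).1.measurableSet ?_
    filter_upwards [hWk k] with x hx hxk
    rw [hx hxk]
  refine ⟨W, ?_, fun Ω' w' hcp hw' hwc' => ?_⟩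
  · rw [isWeakComm_iff]
    intro η h1 h2 h3
    obtain ⟨k, hk⟩ := exists_subset_of_isCompact hU hmono hUn h2 h3
    exact isWeakComm_iff.1 (hWeak k) η h1 h2 hk
  · obtain ⟨k, hk⟩ := exists_subset_of_isCompact hU hmono hUn hcp.2.1 hcp.2.2
    have hsub : Ω' ⊆ U k := subset_closure.trans hk
    filter_upwards [hWk k, IsWeakComm.ae_eq hcp.1 (hli _ _ (hw k)) (hli _ _ hw')
      ((hwc k).mono hsub) hwc'] with x h1 h2 hx
    rw [h1 (hsub hx), h2 hx]

end Gluing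

/-- For `u ∈ φ²(Ω)` the distributional commutators `[X_i,X_j]u`
belong to `L²_loc(Ω)`, with `‖[X_i,X_j]u‖_{L²(Ω')} ≤ C ∫_Ω |u|`. -/
theorem commutators_L2loc (n m : ℕ) (Ω : Set (Fin n → ℝ))
    (hΩo : IsOpen Ω) (hΩb : Bornology.IsBounded Ω)
    (b : Fin m → (Fin n → ℝ) → (Fin n → ℝ))
    (hb : ∀ i, ContDiffOn ℝ (⊤ : ℕ∞) (b i) (closure Ω))
    (hcond1 : DivFree Ω b) (hcond2 : Hormander Ω b) (hcond3 : SecondCommVanish Ω b) :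
    (∀ u : (Fin n → ℝ) → ℝ, PhiK Ω b 2 u → ∀ i j : Fin m,
      ∃ w : (Fin n → ℝ) → ℝ, IsWeakComm Ω b i j u w ∧
        ∀ K : Set (Fin n → ℝ), K ⊆ Ω → IsCompact K →
          MeasureTheory.IntegrableOn (fun x => (w x) ^ 2) K) ∧
    (∀ Ω' : Set (Fin n → ℝ), CptIn Ω' Ω →
      ∃ C > (0 : ℝ), ∀ u : (Fin n → ℝ) → ℝ,
        PhiK Ω b 2 u → MeasureTheory.IntegrableOn u Ω → ∀ i j : Fin m,
        ∃ w : (Fin n → ℝ) → ℝ, IsWeakComm Ω b i j u w ∧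
          (∫ x in Ω', (w x) ^ 2) ^ (1 / 2 : ℝ) ≤ C * ∫ x in Ω, |u x|) := by
  have hbΩ : ∀ i, ContDiffOn ℝ (⊤ : ℕ∞) (b i) Ω := fun i => (hb i).mono subset_closure
  have hlocal := fun Ω' (hcp : CptIn Ω' Ω) =>
    exists_local_commutator hΩo hbΩ hcond1 hcond2 hcond3 hcp
  have hglobal := fun u (hu : PhiK Ω b 2 u) i j =>
    exists_weakComm_of_local hΩo (b := b) (i := i) (j := j) (u := u) fun Ω' hcp => by
      obtain ⟨C, -, K, -, -, h⟩ := hlocal Ω' hcp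
      obtain ⟨w, hw, hwc, -⟩ := h u hu i j
      exact ⟨w, hw, hwc⟩
  refine ⟨fun u hu i j => ?_, fun Ω' hcp => ?_⟩
  · obtain ⟨w, hw, hae⟩ := hglobal u hu i j
    refine ⟨w, hw, fun K hKΩ hK => ?_⟩
    obtain ⟨V, hV, hKV, hclV, hcptV⟩ := exists_open_between_and_isCompact_closure hK hΩo hKΩ
    obtain ⟨C, -, K₁, -, -, h⟩ := hlocal V ⟨hV, hcptV, hclV⟩
    obtain ⟨w', hw', hwc', -⟩ := h u hu i j
    refine (hw'.integrable_sq.integrableOn (s := K)).congr_fun_ae ?_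
    rw [EventuallyEq, ae_restrict_iff' hK.measurableSet]
    filter_upwards [hae V w' ⟨hV, hcptV, hclV⟩ hw' hwc'] with x hx hxK
    rw [hx (hKV hxK)]
  · obtain ⟨C, hC, K, hK, hKΩ, h⟩ := hlocal Ω' hcp
    refine ⟨C + 1, by linarith, fun u hu hInt i j => ?_⟩
    obtain ⟨w, hw, hae⟩ := hglobal u hu i j
    obtain ⟨w', hw', hwc', hle⟩ := h u hu i j
    refine ⟨w, hw, ?_⟩
    have e : ∫ x in Ω', w x ^ 2 = ∫ x in Ω', w' x ^ 2 := by
      refine setIntegral_congr_ae hcp.1.measurableSet ?_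
      filter_upwards [hae Ω' w' hcp hw' hwc'] with x hx hxΩ
      rw [hx hxΩ]
    have h0 : 0 ≤ ∫ x in K, |u x| := integral_nonneg fun _ => abs_nonneg _
    have h1 : ∫ x in K, |u x| ≤ ∫ x in Ω, |u x| :=
      setIntegral_mono_set hInt.abs (ae_of_all _ fun _ => abs_nonneg _) hKΩ.eventuallyLE
    rw [e, ← Real.sqrt_eq_rpow]
    calc Real.sqrt (∫ x in Ω', w' x ^ 2) ≤ C * ∫ x in K, |u x| :=
          Real.sqrt_le_iff.2 ⟨by positivity, hle⟩
      _ ≤ (C + 1) * ∫ x in Ω, |u x| :=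
          mul_le_mul (by linarith) h1 h0 (by linarith)
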